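/- Let u_ε be a sequence of stable solutions of (E_ε) such that for every small r > 0 there exists c_r > 0 with u_ε − 2 ln ε < c_r on Ω ∖ ∪_j B_r(p_{j,2}). Fix p = p_{j,2} ∈ Z₂ and set û_ε(x) := u_ε(εx) in local coordinates. If τ = 1 or m_{j,2} ∈ [0,1], then for every η > 0, lim_{ε→0} sup_{|x−p|=η} û_ε(x) = −∞. Moreover, if w_ε := u_ε − 2 ln ε converges in C²_loc(Ω∖Z₂), then the same conclusion holds without any restriction on τ or m_{j,2}. -/

import Mathlib

open MeasureTheory Real Filter Set Metric Topology

noncomputable section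

/-- The Euclidean plane `ℝ²`. -/
abbrev Pl := EuclideanSpace ℝ (Fin 2)

/-- The unit lattice `ℤ² ⊆ ℝ²`; the flat 2-torus `Ω` is its quotient, which we model by
working with doubly periodic functions on the plane. -/
def unitLattice : Set Pl :=
  {v | ∃ a b : ℤ, v = (a : ℝ) • EuclideanSpace.single 0 (1:ℝ) +
      (b : ℝ) • EuclideanSpace.single 1 (1:ℝ)}

/-- A fundamental domain for the torus `Ω` (of total area `|Ω| = 1`). -/
def fund : Set Pl := {x | x 0 ∈ Ico (0:ℝ) 1 ∧ x 1 ∈ Ico (0:ℝ) 1}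

/-- A doubly periodic function on the plane, i.e. a function on the torus `Ω`. -/
def Periodic2 (u : Pl → ℝ) : Prop := ∀ x : Pl, ∀ v ∈ unitLattice, u (x + v) = u x

/-- Partial derivative in the `i`-th coordinate direction. -/
def pd (u : Pl → ℝ) (i : Fin 2) : Pl → ℝ :=
  fun x => lineDeriv ℝ u x (EuclideanSpace.single i (1:ℝ))

/-- The Laplacian `Δu`. -/
def lap (u : Pl → ℝ) (x : Pl) : ℝ := pd (pd u 0) 0 x + pd (pd u 1) 1 x

/-- `|∇u|²`. -/
def gradSq (u : Pl → ℝ) (x : Pl) : ℝ := (pd u 0 x) ^ 2 + (pd u 1 x) ^ 2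

/-- The nonlinearity `f_τ(t) = e^t (1 − e^t) / (τ + e^t)³`. -/
def fτ (τ t : ℝ) : ℝ := exp t * (1 - exp t) / (τ + exp t) ^ 3

/-- `f_τ'(t) = e^t (τ − 2(τ+1) e^t + e^{2t}) / (τ + e^t)⁴`. -/
def fτ' (τ t : ℝ) : ℝ := exp t * (τ - 2 * (τ + 1) * exp t + exp (2 * t)) / (τ + exp t) ^ 4

/-- The antiderivative `F_{2,τ}(t) = e^t ((1−τ) e^t + 2τ) / (2τ² (τ+e^t)²)` of `f_τ`. -/
def F2τ (τ t : ℝ) : ℝ := exp t * ((1 - τ) * exp t + 2 * τ) / (2 * τ ^ 2 * (τ + exp t) ^ 2)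

/-- `u − 2a ln‖· − p‖` extends smoothly across `p`: this encodes the distributional
equation `Δu = 4πa δ_p + (smooth)` near `p`. -/
def LogSing (u : Pl → ℝ) (p : Pl) (a : ℝ) : Prop :=
  ∃ r > 0, ∃ v : Pl → ℝ, ContDiffOn ℝ (⊤ : ℕ∞) v (ball p r) ∧
    ∀ x ∈ ball p r, x ≠ p → u x = 2 * a * Real.log ‖x - p‖ + v x

/-- The vortex data: distinct points `p_{j,1}` (`1 ≤ j ≤ d₁`), `p_{j,2}` (`1 ≤ j ≤ d₂`)
of the torus with multiplicities `m_{j,1} ≥ 0`, `m_{j,2} ≥ 0`. -/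
structure VortexData where
  d₁ : ℕ
  d₂ : ℕ
  p₁ : Fin d₁ → Pl
  p₂ : Fin d₂ → Pl
  m₁ : Fin d₁ → ℝ
  m₂ : Fin d₂ → ℝ
  m₁_nonneg : ∀ j, 0 ≤ m₁ j
  m₂_nonneg : ∀ j, 0 ≤ m₂ j
  distinct : ∀ i j : Fin d₁ ⊕ Fin d₂, i ≠ j → ∀ v ∈ unitLattice,
      Sum.elim p₁ p₂ i ≠ Sum.elim p₁ p₂ j + v

namespace VortexData
variable (V : VortexData)

/-- The set `Z₁` of vortex points `p_{j,1}` (viewed in the plane: all lattice translates). -/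
def Z1 : Set Pl := {x | ∃ j v, v ∈ unitLattice ∧ x = V.p₁ j + v}

/-- The set `Z₂` of vortex points `p_{j,2}` (viewed in the plane: all lattice translates). -/
def Z2 : Set Pl := {x | ∃ j v, v ∈ unitLattice ∧ x = V.p₂ j + v}

/-- The full vortex set `Z = Z₁ ∪ Z₂`. -/
def Z : Set Pl := V.Z1 ∪ V.Z2

/-- `N₁ = Σ_j m_{j,1}`. -/
def N1 : ℝ := ∑ j, V.m₁ j

/-- `N₂ = Σ_j m_{j,2}`. -/
def N2 : ℝ := ∑ j, V.m₂ j

end VortexData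

/-- `u` is a solution of `(E_ε)`:
`Δu + ε⁻² f_τ(u) = 4π Σ_j m_{j,1} δ_{p_{j,1}} − 4π Σ_j m_{j,2} δ_{p_{j,2}}` on `Ω`,
formulated classically: `u` is doubly periodic, smooth away from `Z`, solves the PDE
classically off `Z`, and has the prescribed logarithmic singularities at the vortices. -/
structure IsSolution (V : VortexData) (τ ε : ℝ) (u : Pl → ℝ) : Prop where
  periodic : Periodic2 u
  smooth : ContDiffOn ℝ (⊤ : ℕ∞) u (V.Z)ᶜ
  pde : ∀ x ∉ V.Z, lap u x + (ε ^ 2)⁻¹ * fτ τ (u x) = 0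
  sing₁ : ∀ j, LogSing u (V.p₁ j) (V.m₁ j)
  sing₂ : ∀ j, LogSing u (V.p₂ j) (-(V.m₂ j))

/-- The quadratic form `∫_Ω |∇φ|² − ε⁻² f_τ'(u) φ²` of the linearized operator at `u`. -/
def QuadForm (τ ε : ℝ) (u φ : Pl → ℝ) : ℝ :=
  ∫ x in fund, (gradSq φ x - (ε ^ 2)⁻¹ * fτ' τ (u x) * (φ x) ^ 2)

/-- `u` is a stable solution: the first eigenvalue `μ_ε` of the linearized operator is
nonnegative, i.e. the quadratic form is nonnegative on all (smooth, doubly periodic)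
test functions. -/
def Stable (τ ε : ℝ) (u : Pl → ℝ) : Prop :=
  ∀ φ : Pl → ℝ, ContDiff ℝ (⊤ : ℕ∞) φ → Periodic2 φ → 0 ≤ QuadForm τ ε u φ

/-- `u` is strictly stable: the first eigenvalue `μ_ε` of the linearized operator is
strictly positive. -/
def StrictlyStable (τ ε : ℝ) (u : Pl → ℝ) : Prop :=
  ∃ μ > 0, ∀ φ : Pl → ℝ, ContDiff ℝ (⊤ : ℕ∞) φ → Periodic2 φ →
    μ * (∫ x in fund, (φ x) ^ 2) ≤ QuadForm τ ε u φ

/-- `u_n → w` in `C²_loc(s)`: locally uniform convergence of the functions and of their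
first and second partial derivatives on `s`. -/
def TendstoC2LocOn (u : ℕ → Pl → ℝ) (w : Pl → ℝ) (s : Set Pl) : Prop :=
  TendstoLocallyUniformlyOn u w atTop s ∧
  (∀ i : Fin 2, TendstoLocallyUniformlyOn (fun n => pd (u n) i) (pd w i) atTop s) ∧
  (∀ i j : Fin 2, TendstoLocallyUniformlyOn
      (fun n => pd (pd (u n) i) j) (pd (pd w i) j) atTop s)

/-- Case 1 of the hypotheses: `w_ε = u_ε − 2 ln ε → w` in `C²_loc(Ω∖Z₂)`, where `w` solves
`Δw + e^w/τ³ = 4π Σ_j m_{j,1} δ_{p_{j,1}} + 4π Σ_j β_{j,2} δ_{p_{j,2}}` on `Ω`. -/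
def Case1 (V : VortexData) (τ : ℝ) (ε : ℕ → ℝ) (u : ℕ → Pl → ℝ)
    (β : Fin V.d₂ → ℝ) (w : Pl → ℝ) : Prop :=
  TendstoC2LocOn (fun n x => u n x - 2 * Real.log (ε n)) w (V.Z2)ᶜ ∧
  Periodic2 w ∧ ContDiffOn ℝ (⊤ : ℕ∞) w (V.Z)ᶜ ∧
  (∀ x ∉ V.Z, lap w x + Real.exp (w x) / τ ^ 3 = 0) ∧
  (∀ j, LogSing w (V.p₁ j) (V.m₁ j)) ∧ (∀ j, LogSing w (V.p₂ j) (β j))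

/-- Case 2 of the hypotheses: `w_ε − w_ε(x₀) → g` in `C²_loc(Ω∖Z₂)` for a fixed
`x₀ ∈ Ω∖Z`, where `Δg = 4π Σ_j m_{j,1} δ_{p_{j,1}} + 4π Σ_j β_{j,2} δ_{p_{j,2}}` on `Ω`. -/
def Case2 (V : VortexData) (u : ℕ → Pl → ℝ) (β : Fin V.d₂ → ℝ)
    (x₀ : Pl) (g : Pl → ℝ) : Prop :=
  x₀ ∉ V.Z ∧
  TendstoC2LocOn (fun n x => u n x - u n x₀) g (V.Z2)ᶜ ∧
  Periodic2 g ∧ ContDiffOn ℝ (⊤ : ℕ∞) g (V.Z)ᶜ ∧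
  (∀ x ∉ V.Z, lap g x = 0) ∧
  (∀ j, LogSing g (V.p₁ j) (V.m₁ j)) ∧ (∀ j, LogSing g (V.p₂ j) (β j))

/-! ### Calculus on the half-infinite cylinder -/

/-- the open half cylinder `{t < T}` -/
def strip (T : ℝ) : Set (ℝ × ℝ) := {z | z.1 < T}

lemma isOpen_strip (T : ℝ) : IsOpen (strip T) := isOpen_lt continuous_fst continuous_const

def Sm (T : ℝ) (Φ : ℝ × ℝ → ℝ) : Prop := ContDiffOn ℝ (⊤ : ℕ∞) Φ (strip T)

def Dt (Φ : ℝ × ℝ → ℝ) (z : ℝ × ℝ) : ℝ := fderiv ℝ Φ z (1, 0)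
def Dh (Φ : ℝ × ℝ → ℝ) (z : ℝ × ℝ) : ℝ := fderiv ℝ Φ z (0, 1)

/-- circle integral -/
def cI (Φ : ℝ × ℝ → ℝ) (t : ℝ) : ℝ := ∫ θ in (0 : ℝ)..(2 * π), Φ (t, θ)

def PerH (Φ : ℝ × ℝ → ℝ) : Prop := ∀ t θ, Φ (t, θ + 2 * π) = Φ (t, θ)

lemma Sm.contDiffAt {T : ℝ} {Φ : ℝ × ℝ → ℝ} (h : Sm T Φ) {z : ℝ × ℝ} (hz : z.1 < T) :
    ContDiffAt ℝ (⊤ : ℕ∞) Φ z :=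
  ContDiffOn.contDiffAt h ((isOpen_strip T).mem_nhds hz)

lemma Sm.diffAt {T : ℝ} {Φ : ℝ × ℝ → ℝ} (h : Sm T Φ) {z : ℝ × ℝ} (hz : z.1 < T) :
    DifferentiableAt ℝ Φ z := (h.contDiffAt hz).differentiableAt (by simp)

lemma Sm.contOn {T : ℝ} {Φ : ℝ × ℝ → ℝ} (h : Sm T Φ) : ContinuousOn Φ (strip T) :=
  ContDiffOn.continuousOn h

lemma Sm.fderivAp {T : ℝ} {Φ : ℝ × ℝ → ℝ} (h : Sm T Φ) (v : ℝ × ℝ) :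
    Sm T (fun z => fderiv ℝ Φ z v) := by
  have h1 : ContDiffOn ℝ (⊤ : ℕ∞) (fderiv ℝ Φ) (strip T) :=
    ContDiffOn.fderiv_of_isOpen h (isOpen_strip T) (by simp)
  exact h1.clm_apply contDiffOn_const

lemma Sm.dt {T : ℝ} {Φ : ℝ × ℝ → ℝ} (h : Sm T Φ) : Sm T (Dt Φ) := h.fderivAp _
lemma Sm.dh {T : ℝ} {Φ : ℝ × ℝ → ℝ} (h : Sm T Φ) : Sm T (Dh Φ) := h.fderivAp _

lemma Sm.add {T : ℝ} {Φ Ψ : ℝ × ℝ → ℝ} (h : Sm T Φ) (h' : Sm T Ψ) :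
    Sm T (fun z => Φ z + Ψ z) := ContDiffOn.add h h'
lemma Sm.sub {T : ℝ} {Φ Ψ : ℝ × ℝ → ℝ} (h : Sm T Φ) (h' : Sm T Ψ) :
    Sm T (fun z => Φ z - Ψ z) := ContDiffOn.sub h h'
lemma Sm.mul {T : ℝ} {Φ Ψ : ℝ × ℝ → ℝ} (h : Sm T Φ) (h' : Sm T Ψ) :
    Sm T (fun z => Φ z * Ψ z) := ContDiffOn.mul h h'
lemma Sm.neg {T : ℝ} {Φ : ℝ × ℝ → ℝ} (h : Sm T Φ) : Sm T (fun z => - Φ z) := ContDiffOn.neg h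
lemma Sm.pow {T : ℝ} {Φ : ℝ × ℝ → ℝ} (h : Sm T Φ) (n : ℕ) : Sm T (fun z => Φ z ^ n) :=
  ContDiffOn.pow h n
lemma Sm.comp {T : ℝ} {Φ : ℝ × ℝ → ℝ} (h : Sm T Φ) {F : ℝ → ℝ} (hF : ContDiff ℝ (⊤ : ℕ∞) F) :
    Sm T (fun z => F (Φ z)) := hF.comp_contDiffOn h
lemma Sm.of_t (T : ℝ) {F : ℝ → ℝ} (hF : ContDiff ℝ (⊤ : ℕ∞) F) :
    Sm T (fun z => F z.1) := (hF.comp contDiff_fst).contDiffOn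
lemma Sm.const (T c : ℝ) : Sm T (fun _ => c) := contDiffOn_const

lemma hasDerivAt_t {Φ : ℝ × ℝ → ℝ} {t θ : ℝ} (h : DifferentiableAt ℝ Φ (t, θ)) :
    HasDerivAt (fun s => Φ (s, θ)) (Dt Φ (t, θ)) t := by
  have h2 : HasDerivAt (fun s : ℝ => (s, θ)) ((1 : ℝ), (0 : ℝ)) t :=
    (hasDerivAt_id t).prodMk (hasDerivAt_const t θ)
  exact h.hasFDerivAt.comp_hasDerivAt t h2

lemma hasDerivAt_h {Φ : ℝ × ℝ → ℝ} {t θ : ℝ} (h : DifferentiableAt ℝ Φ (t, θ)) :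
    HasDerivAt (fun s => Φ (t, s)) (Dh Φ (t, θ)) θ := by
  have h2 : HasDerivAt (fun s : ℝ => (t, s)) ((0 : ℝ), (1 : ℝ)) θ :=
    (hasDerivAt_const θ t).prodMk (hasDerivAt_id θ)
  exact h.hasFDerivAt.comp_hasDerivAt θ h2

lemma Dt_eq {Φ : ℝ × ℝ → ℝ} {t θ c : ℝ} (h : DifferentiableAt ℝ Φ (t, θ))
    (h2 : HasDerivAt (fun s => Φ (s, θ)) c t) : Dt Φ (t, θ) = c :=
  (hasDerivAt_t h).unique h2

lemma Dh_eq {Φ : ℝ × ℝ → ℝ} {t θ c : ℝ} (h : DifferentiableAt ℝ Φ (t, θ))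
    (h2 : HasDerivAt (fun s => Φ (t, s)) c θ) : Dh Φ (t, θ) = c :=
  (hasDerivAt_h h).unique h2

lemma Dt_congr {T : ℝ} {Φ Ψ : ℝ × ℝ → ℝ} (h : ∀ z, z.1 < T → Φ z = Ψ z) {z : ℝ × ℝ}
    (hz : z.1 < T) : Dt Φ z = Dt Ψ z := by
  have : Φ =ᶠ[𝓝 z] Ψ := by
    filter_upwards [(isOpen_strip T).mem_nhds hz] with w hw using h w hw
  simp only [Dt, this.fderiv_eq]

lemma Dh_congr {T : ℝ} {Φ Ψ : ℝ × ℝ → ℝ} (h : ∀ z, z.1 < T → Φ z = Ψ z) {z : ℝ × ℝ}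
    (hz : z.1 < T) : Dh Φ z = Dh Ψ z := by
  have : Φ =ᶠ[𝓝 z] Ψ := by
    filter_upwards [(isOpen_strip T).mem_nhds hz] with w hw using h w hw
  simp only [Dh, this.fderiv_eq]

lemma Dt_Dh_comm {T : ℝ} {Φ : ℝ × ℝ → ℝ} (h : Sm T Φ) {z : ℝ × ℝ} (hz : z.1 < T) :
    Dt (Dh Φ) z = Dh (Dt Φ) z := by
  have h1 := h.contDiffAt hz
  have hs : IsSymmSndFDerivAt ℝ Φ z :=
    h1.isSymmSndFDerivAt (by
      simp only [minSmoothness_of_isRCLikeNormedField]; exact WithTop.coe_le_coe.2 (le_top : (2 : ℕ∞) ≤ ⊤))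
  have hd : DifferentiableAt ℝ (fderiv ℝ Φ) z := by
    have : ContDiffAt ℝ 1 (fderiv ℝ Φ) z := h1.fderiv_right (m := 1) (by norm_cast)
    exact this.differentiableAt (by simp)
  have e : ∀ v w, fderiv ℝ (fun y => fderiv ℝ Φ y v) z w = fderiv ℝ (fderiv ℝ Φ) z w v := by
    intro v w
    rw [fderiv_clm_apply hd (differentiableAt_const _)]
    simp
  unfold Dt Dh
  rw [e, e]
  exact hs _ _

/-! periodicity -/
lemma PerH.dt {Φ : ℝ × ℝ → ℝ} (h : PerH Φ) : PerH (Dt Φ) := by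
  intro t θ
  have e : Φ = fun z => Φ (z + (0, 2 * π)) := by
    funext z; obtain ⟨a, b⟩ := z; simp [h a b]
  unfold Dt
  conv_rhs => rw [e]
  rw [fderiv_comp_add_right]; simp

lemma PerH.dh {Φ : ℝ × ℝ → ℝ} (h : PerH Φ) : PerH (Dh Φ) := by
  intro t θ
  have e : Φ = fun z => Φ (z + (0, 2 * π)) := by
    funext z; obtain ⟨a, b⟩ := z; simp [h a b]
  unfold Dh
  conv_rhs => rw [e]
  rw [fderiv_comp_add_right]; simp

/-! circle integrals -/

lemma contOn_circle {T : ℝ} {Φ : ℝ × ℝ → ℝ} (h : ContinuousOn Φ (strip T)) {t : ℝ} (ht : t < T) :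
    Continuous (fun θ => Φ (t, θ)) := by
  rw [← continuousOn_univ]
  exact h.comp (by fun_prop) (fun θ _ => ht)

lemma contOn_line {T : ℝ} {Φ : ℝ × ℝ → ℝ} (h : ContinuousOn Φ (strip T)) (θ : ℝ) :
    ContinuousOn (fun t => Φ (t, θ)) (Iio T) :=
  h.comp (by fun_prop) (fun t ht => ht)

lemma intg {T : ℝ} {Φ : ℝ × ℝ → ℝ} (h : ContinuousOn Φ (strip T)) {t : ℝ} (ht : t < T) (a b : ℝ) :
    IntervalIntegrable (fun θ => Φ (t, θ)) volume a b :=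
  (contOn_circle h ht).intervalIntegrable _ _

/-- uniform bound on compact part -/
lemma exists_bd {T : ℝ} {Φ : ℝ × ℝ → ℝ} (h : ContinuousOn Φ (strip T)) {a b : ℝ} (hb : b < T)
    (c d : ℝ) :
    ∃ C, ∀ t ∈ Icc a b, ∀ θ ∈ Icc c d, |Φ (t, θ)| ≤ C := by
  have hc : IsCompact (Icc a b ×ˢ Icc c d) := isCompact_Icc.prod isCompact_Icc
  obtain ⟨C, hC⟩ := hc.exists_bound_of_continuousOn (f := Φ)
    (h.mono (fun z hz => lt_of_le_of_lt hz.1.2 hb))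
  exact ⟨C, fun t ht θ hθ => hC (t, θ) ⟨ht, hθ⟩⟩

lemma cI_contOn {T : ℝ} {Φ : ℝ × ℝ → ℝ} (h : ContinuousOn Φ (strip T)) :
    ContinuousOn (cI Φ) (Iio T) := by
  intro t ht
  apply ContinuousAt.continuousWithinAt
  have ht : t < T := ht
  obtain ⟨s, hs1, hs2⟩ := exists_between ht
  obtain ⟨C, hC⟩ := exists_bd h hs2 (a := t - 1) 0 (2 * π)
  apply intervalIntegral.continuousAt_of_dominated_interval (bound := fun _ => C)
  · filter_upwards [Iio_mem_nhds ht] with x hx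
    exact (contOn_circle h hx).aestronglyMeasurable
  · filter_upwards [Icc_mem_nhds (show t - 1 < t by linarith) hs1] with x hx
    refine Eventually.of_forall fun θ hθ => ?_
    rw [uIoc_of_le (by positivity)] at hθ
    exact hC x hx θ ⟨hθ.1.le, hθ.2⟩
  · simp
  · refine Eventually.of_forall fun θ _ => ?_
    exact (contOn_line h θ).continuousAt (Iio_mem_nhds ht)

lemma cI_hasDerivAt {T : ℝ} {Φ : ℝ × ℝ → ℝ} (h : Sm T Φ) {t : ℝ} (ht : t < T) :
    HasDerivAt (cI Φ) (cI (Dt Φ) t) t := by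
  obtain ⟨s, hs1, hs2⟩ := exists_between ht
  obtain ⟨C, hC⟩ := exists_bd h.dt.contOn hs2 (a := t - 1) 0 (2 * π)
  have := intervalIntegral.hasDerivAt_integral_of_dominated_loc_of_deriv_le (μ := volume)
    (F := fun t θ => Φ (t, θ)) (F' := fun t θ => Dt Φ (t, θ)) (x₀ := t) (a := 0) (b := 2 * π)
    (bound := fun _ => C) (s := Icc (t - 1) s)
    (Icc_mem_nhds (show t - 1 < t by linarith) hs1) ?_ (intg h.contOn ht _ _) ?_ ?_ ?_ ?_
  · exact this.2
  · filter_upwards [Iio_mem_nhds ht] with x hx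
    exact (contOn_circle h.contOn hx).aestronglyMeasurable
  · exact (contOn_circle h.dt.contOn ht).aestronglyMeasurable
  · refine Eventually.of_forall fun θ hθ x hx => ?_
    rw [uIoc_of_le (by positivity)] at hθ
    exact hC x hx θ ⟨hθ.1.le, hθ.2⟩
  · simp
  · refine Eventually.of_forall fun θ hθ x hx => ?_
    exact hasDerivAt_t (h.diffAt (lt_of_le_of_lt hx.2 hs2))

lemma cI_dh {T : ℝ} {Φ : ℝ × ℝ → ℝ} (h : Sm T Φ) (hp : PerH Φ) {t : ℝ} (ht : t < T) :
    cI (Dh Φ) t = 0 := by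
  unfold cI
  rw [intervalIntegral.integral_eq_sub_of_hasDerivAt (f := fun θ => Φ (t, θ))]
  · have := hp t 0; simp at this; simp [this]
  · intro θ _; exact hasDerivAt_h (h.diffAt ht)
  · exact intg h.dh.contOn ht _ _

lemma cI_congr {Φ Ψ : ℝ × ℝ → ℝ} {t : ℝ} (h : ∀ θ, Φ (t, θ) = Ψ (t, θ)) : cI Φ t = cI Ψ t := by
  unfold cI; simp only [h]

lemma cI_mono {T : ℝ} {Φ Ψ : ℝ × ℝ → ℝ} (hΦ : ContinuousOn Φ (strip T))
    (hΨ : ContinuousOn Ψ (strip T)) {t : ℝ} (ht : t < T) (h : ∀ θ, Φ (t, θ) ≤ Ψ (t, θ)) :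
    cI Φ t ≤ cI Ψ t :=
  intervalIntegral.integral_mono_on (by positivity) (intg hΦ ht _ _) (intg hΨ ht _ _)
    (fun θ _ => h θ)

lemma cI_const (c t : ℝ) : cI (fun _ => c) t = 2 * π * c := by simp [cI]

lemma cI_le {T : ℝ} {Φ : ℝ × ℝ → ℝ} (hΦ : ContinuousOn Φ (strip T)) {t c : ℝ} (ht : t < T)
    (h : ∀ θ, Φ (t, θ) ≤ c) : cI Φ t ≤ 2 * π * c := by
  rw [← cI_const c t]; exact cI_mono hΦ continuousOn_const ht h

lemma le_cI {T : ℝ} {Φ : ℝ × ℝ → ℝ} (hΦ : ContinuousOn Φ (strip T)) {t c : ℝ} (ht : t < T)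
    (h : ∀ θ, c ≤ Φ (t, θ)) : 2 * π * c ≤ cI Φ t := by
  rw [← cI_const c t]; exact cI_mono continuousOn_const hΦ ht h

lemma cI_nonneg {Φ : ℝ × ℝ → ℝ} {t : ℝ} (h : ∀ θ, 0 ≤ Φ (t, θ)) : 0 ≤ cI Φ t :=
  intervalIntegral.integral_nonneg (by positivity) (fun θ _ => h θ)

lemma cI_add {T : ℝ} {Φ Ψ : ℝ × ℝ → ℝ} (hΦ : ContinuousOn Φ (strip T))
    (hΨ : ContinuousOn Ψ (strip T)) {t : ℝ} (ht : t < T) :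
    cI (fun z => Φ z + Ψ z) t = cI Φ t + cI Ψ t :=
  intervalIntegral.integral_add (intg hΦ ht _ _) (intg hΨ ht _ _)

lemma cI_sub {T : ℝ} {Φ Ψ : ℝ × ℝ → ℝ} (hΦ : ContinuousOn Φ (strip T))
    (hΨ : ContinuousOn Ψ (strip T)) {t : ℝ} (ht : t < T) :
    cI (fun z => Φ z - Ψ z) t = cI Φ t - cI Ψ t :=
  intervalIntegral.integral_sub (intg hΦ ht _ _) (intg hΨ ht _ _)

lemma cI_smul (α : ℝ → ℝ) (Φ : ℝ × ℝ → ℝ) (t : ℝ) :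
    cI (fun z => α z.1 * Φ z) t = α t * cI Φ t := by
  unfold cI; exact intervalIntegral.integral_const_mul (α t) (fun θ => Φ (t, θ))

lemma cI_cmul (c : ℝ) (Φ : ℝ × ℝ → ℝ) (t : ℝ) :
    cI (fun z => c * Φ z) t = c * cI Φ t :=
  intervalIntegral.integral_const_mul _ _

lemma cI_abs {T : ℝ} {Φ : ℝ × ℝ → ℝ} (hΦ : ContinuousOn Φ (strip T)) {t c : ℝ} (ht : t < T)
    (h : ∀ θ, |Φ (t, θ)| ≤ c) : |cI Φ t| ≤ 2 * π * c := by
  rw [abs_le]; constructor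
  · have := le_cI (c := -c) hΦ ht (fun θ => (abs_le.1 (h θ)).1); linarith
  · exact cI_le hΦ ht (fun θ => (abs_le.1 (h θ)).2)

/-- Cauchy–Schwarz -/
lemma cI_sq {T : ℝ} {Φ : ℝ × ℝ → ℝ} (hΦ : ContinuousOn Φ (strip T)) {t : ℝ} (ht : t < T) :
    (cI Φ t) ^ 2 ≤ 2 * π * cI (fun z => Φ z ^ 2) t := by
  set a := cI Φ t / (2 * π) with ha
  have hpi : 0 < 2 * π := by positivity
  have h0 : 0 ≤ cI (fun z => (Φ z ^ 2 - (2 * a) * Φ z) + a ^ 2) t := by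
    apply cI_nonneg; intro θ; nlinarith [sq_nonneg (Φ (t, θ) - a)]
  rw [cI_add (T := T) (by fun_prop) (by fun_prop) ht, cI_sub (T := T) (by fun_prop) (by fun_prop) ht,
    cI_cmul, cI_const] at h0
  have : cI Φ t = a * (2 * π) := by rw [ha]; field_simp
  rw [this] at h0 ⊢
  nlinarith

lemma sm_int_t {T : ℝ} {q : ℝ → ℝ} (hq : ContinuousOn q (Iio T)) {a b : ℝ} (hab : a ≤ b)
    (hb : b < T) : IntervalIntegrable q volume a b :=
  (hq.mono (by rw [uIcc_of_le hab]; exact fun x hx => lt_of_le_of_lt hx.2 hb)).intervalIntegrable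

lemma ftc {T : ℝ} {F q : ℝ → ℝ} (hF : ∀ t < T, HasDerivAt F (q t) t)
    (hq : ContinuousOn q (Iio T)) {a b : ℝ} (hab : a ≤ b)
    (hb : b < T) : ∫ t in a..b, q t = F b - F a := by
  apply intervalIntegral.integral_eq_sub_of_hasDerivAt
  · intro t ht; rw [uIcc_of_le hab] at ht; exact hF t (lt_of_le_of_lt ht.2 hb)
  · exact sm_int_t hq hab hb

/-! maximum principle -/
lemma second_deriv_nonpos {f f1 : ℝ → ℝ} {x c : ℝ} (h : ∀ᶠ y in 𝓝 x, HasDerivAt f (f1 y) y)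
    (h2 : HasDerivAt f1 c x) (hm : IsLocalMax f x) : c ≤ 0 := by
  by_contra hc
  push Not at hc
  have e1 : deriv f =ᶠ[𝓝 x] f1 := by
    filter_upwards [h] with y hy using hy.deriv
  have e2 : deriv (deriv f) x = c := by rw [e1.deriv_eq]; exact h2.deriv
  have e3 : deriv f x = 0 := hm.deriv_eq_zero
  have hmin := isLocalMin_of_deriv_deriv_pos (by rw [e2]; exact hc) e3 h.self_of_nhds.continuousAt
  have hconst : f =ᶠ[𝓝 x] fun _ => f x := by
    filter_upwards [hm, hmin] with y h1 h2 using le_antisymm h1 h2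
  have e4 : deriv f =ᶠ[𝓝 x] fun _ => 0 := by
    have := hconst.deriv
    simpa using this
  have : deriv (deriv f) x = 0 := by rw [e4.deriv_eq]; simp
  linarith

lemma per_reduce {Φ : ℝ × ℝ → ℝ} (hp : PerH Φ) (t θ : ℝ) :
    ∃ θ' ∈ Ico (0 : ℝ) (2 * π), Φ (t, θ) = Φ (t, θ') := by
  have hper : Function.Periodic (fun s => Φ (t, s)) (2 * π) := fun s => hp t s
  have := hper.exists_mem_Ico₀ (by positivity) θ
  exact this

lemma max_principle {T a b : ℝ} {U : ℝ × ℝ → ℝ} (hU : Sm T U) (hp : PerH U) (hb : b < T)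
    {α α1 α2 : ℝ → ℝ} (hα : ∀ t, HasDerivAt α (α1 t) t) (hα1 : ∀ t, HasDerivAt α1 (α2 t) t)
    (hD : ∀ t θ, a < t → t < b → α t < U (t, θ) →
      α2 t ≤ Dt (Dt U) (t, θ) + Dh (Dh U) (t, θ))
    (ha' : ∀ θ, U (a, θ) ≤ α a) (hb' : ∀ θ, U (b, θ) ≤ α b) :
    ∀ t θ, a ≤ t → t ≤ b → U (t, θ) ≤ α t := by
  intro t0 θ0 ht0a ht0b
  by_contra hcon
  push Not at hcon
  -- perturb
  obtain ⟨δ, hδ, hδ2⟩ : ∃ δ > 0, δ * (b - a) ^ 2 < U (t0, θ0) - α t0 := by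
    refine ⟨(U (t0, θ0) - α t0) / 2 / ((b - a) ^ 2 + 1), by
      apply div_pos <;> [linarith; positivity], ?_⟩
    rw [div_mul_eq_mul_div, div_lt_iff₀ (by positivity)]
    nlinarith [sq_nonneg (b - a)]
  set W : ℝ × ℝ → ℝ := fun z => U z - α z.1 + δ * ((z.1 - a) ^ 2 - (b - a) ^ 2) with hW
  have hcα : Continuous α := continuous_iff_continuousAt.2 fun t => (hα t).continuousAt
  have hWc : ContinuousOn W (strip T) := by
    have h1 := hU.contOn
    have : Continuous (fun z : ℝ × ℝ => α z.1) := hcα.comp continuous_fst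
    fun_prop
  obtain ⟨θ1, hθ1, hθe⟩ := per_reduce hp t0 θ0
  have hc : IsCompact (Icc a b ×ˢ Icc 0 (2 * π)) := isCompact_Icc.prod isCompact_Icc
  obtain ⟨zm, hzm, hmax⟩ := hc.exists_isMaxOn ⟨(t0, θ1), ⟨ht0a, ht0b⟩, hθ1.1, hθ1.2.le⟩
    (hWc.mono (fun z hz => lt_of_le_of_lt hz.1.2 hb))
  obtain ⟨tm, θm⟩ := zm
  have hWpos : 0 < W (tm, θm) := by
    have h1 : W (t0, θ1) ≤ W (tm, θm) := hmax ⟨⟨ht0a, ht0b⟩, hθ1.1, hθ1.2.le⟩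
    have h2 : 0 < W (t0, θ1) := by
      simp only [hW]; rw [← hθe]; nlinarith [mul_nonneg hδ.le (sq_nonneg (t0 - a))]
    linarith
  have hgl : ∀ t θ, a ≤ t → t ≤ b → W (t, θ) ≤ W (tm, θm) := by
    intro t θ h1 h2
    obtain ⟨θ2, hθ2, he⟩ := per_reduce hp t θ
    have : W (t, θ) = W (t, θ2) := by simp only [hW]; rw [he]
    rw [this]; exact hmax ⟨⟨h1, h2⟩, hθ2.1, hθ2.2.le⟩
  have htm : a ≤ tm ∧ tm ≤ b := hzm.1
  have hsq : (tm - a) ^ 2 ≤ (b - a) ^ 2 := by nlinarith [htm.1, htm.2]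
  have hUα : α tm < U (tm, θm) := by
    simp only [hW] at hWpos
    nlinarith [mul_nonneg hδ.le (sub_nonneg.2 hsq)]
  have hta : a < tm := by
    rcases htm.1.lt_or_eq with h | h
    · exact h
    · exfalso; rw [← h] at hUα; linarith [ha' θm]
  have htb : tm < b := by
    rcases htm.2.lt_or_eq with h | h
    · exact h
    · exfalso; rw [h] at hUα; linarith [hb' θm]
  have hlt : tm < T := htb.trans hb
  -- t direction
  have h1 : Dt (Dt U) (tm, θm) - α2 tm + 2 * δ ≤ 0 := by
    apply second_deriv_nonpos (f := fun t => W (t, θm))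
      (f1 := fun t => Dt U (t, θm) - α1 t + δ * (2 * (t - a))) (x := tm)
    · filter_upwards [Iio_mem_nhds hlt] with t ht
      have := ((hasDerivAt_t (hU.diffAt (z := (t, θm)) ht)).sub (hα t)).add
        (((((hasDerivAt_id t).sub_const a).pow 2).sub_const ((b - a) ^ 2)).const_mul δ)
      exact this.congr_deriv (by simp)
    · have := ((hasDerivAt_t (hU.dt.diffAt (z := (tm, θm)) hlt)).sub (hα1 tm)).add
        ((((hasDerivAt_id tm).sub_const a).const_mul 2).const_mul δ)
      exact this.congr_deriv (by ring)
    · filter_upwards [Ioo_mem_nhds hta htb] with t ht using hgl t θm ht.1.le ht.2.le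
  have h2 : Dh (Dh U) (tm, θm) ≤ 0 := by
    apply second_deriv_nonpos (f := fun t => W (tm, t))
      (f1 := fun t => Dh U (tm, t)) (x := θm)
    · refine Eventually.of_forall fun t => ?_
      have := ((hasDerivAt_h (hU.diffAt (z := (tm, t)) hlt)).sub_const (α tm)).add_const
        (δ * ((tm - a) ^ 2 - (b - a) ^ 2))
      exact this
    · exact hasDerivAt_h (hU.dh.diffAt (z := (tm, θm)) hlt)
    · exact Eventually.of_forall fun t => hgl tm t hta.le htb.le
  have := hD tm θm hta htb hUα
  linarith

/-! ### The nonlinearity -/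
lemma fτ_contDiff {τ : ℝ} (hτ : 0 < τ) : ContDiff ℝ (⊤ : ℕ∞) (fτ τ) := by
  unfold fτ
  apply ContDiff.div
  · fun_prop
  · fun_prop
  · intro x; positivity

lemma fτ_hasDerivAt {τ : ℝ} (hτ : 0 < τ) (t : ℝ) : HasDerivAt (fτ τ) (fτ' τ t) t := by
  have h1 := Real.hasDerivAt_exp t
  have hne : (τ + exp t) ^ 3 ≠ 0 := by positivity
  have := (h1.mul (h1.const_sub 1)).div ((h1.const_add τ).pow 3) hne
  refine this.congr_deriv ?_
  have hp : 0 < exp t := exp_pos t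
  have h2 : exp (2 * t) = exp t ^ 2 := by rw [two_mul, exp_add]; ring
  unfold fτ'
  simp only [Pi.mul_apply, Pi.pow_apply]
  rw [h2]
  generalize exp t = x at *
  have : 0 < τ + x := by positivity
  field_simp
  ring

lemma fτ_nonneg {τ t : ℝ} (hτ : 0 < τ) (ht : t ≤ 0) : 0 ≤ fτ τ t := by
  have : exp t ≤ 1 := exp_le_one_iff.2 ht
  unfold fτ
  apply div_nonneg
  · exact mul_nonneg (exp_pos t).le (by linarith)
  · positivity

lemma fτ_nonpos {τ t : ℝ} (hτ : 0 < τ) (ht : 0 ≤ t) : fτ τ t ≤ 0 := by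
  have : 1 ≤ exp t := one_le_exp ht
  unfold fτ
  apply div_nonpos_of_nonpos_of_nonneg
  · exact mul_nonpos_of_nonneg_of_nonpos (exp_pos t).le (by linarith)
  · positivity

lemma fτ_le_exp {τ : ℝ} (t : ℝ) (hτ : 0 < τ) : fτ τ t ≤ exp t / τ ^ 3 := by
  have hp := exp_pos t
  unfold fτ
  apply div_le_div₀ hp.le
  · nlinarith
  · positivity
  · gcongr; linarith

lemma fτ_le_const {τ : ℝ} (t : ℝ) (hτ : 0 < τ) : fτ τ t ≤ 1 / τ ^ 2 := by
  have hp := exp_pos t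
  unfold fτ
  rw [div_le_div_iff₀ (by positivity) (by positivity)]
  have h1 : exp t * (1 - exp t) * τ ^ 2 ≤ exp t * τ ^ 2 := by nlinarith [mul_pos hp (mul_pos hp (pow_pos hτ 2))]
  have h2 : exp t * τ ^ 2 ≤ (τ + exp t) * (τ + exp t) ^ 2 := by
    apply mul_le_mul (by linarith) _ (by positivity) (by positivity)
    gcongr; linarith
  nlinarith

lemma abs_fτ_le {τ : ℝ} (t : ℝ) (hτ : 0 < τ) : |fτ τ t| ≤ (1 + τ) / τ ^ 2 := by
  have hp := exp_pos t
  unfold fτ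
  rw [abs_div, abs_of_pos (show 0 < (τ + exp t) ^ 3 by positivity), abs_mul, abs_of_pos hp,
    div_le_div_iff₀ (by positivity) (by positivity)]
  have h1 : |1 - exp t| ≤ 1 + exp t := by rw [abs_le]; constructor <;> linarith
  have h2 : τ * (1 + exp t) ≤ (1 + τ) * (τ + exp t) := by nlinarith
  have h3 : exp t * τ ≤ (τ + exp t) ^ 2 := by nlinarith
  calc exp t * |1 - exp t| * τ ^ 2 ≤ exp t * (1 + exp t) * τ ^ 2 := by gcongr
    _ = (exp t * τ) * (τ * (1 + exp t)) := by ring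
    _ ≤ (τ + exp t) ^ 2 * ((1 + τ) * (τ + exp t)) := by gcongr
    _ = _ := by ring

def cfl (τ : ℝ) : ℝ := (1 - exp (-1)) / (τ + 1) ^ 3

lemma cfl_pos {τ : ℝ} (hτ : 0 < τ) : 0 < cfl τ := by
  unfold cfl
  have : exp (-1) < 1 := by rw [exp_lt_one_iff]; norm_num
  apply div_pos (by linarith) (by positivity)

lemma fτ_lower {τ t : ℝ} (hτ : 0 < τ) (ht : t ≤ -1) : cfl τ * exp t ≤ fτ τ t := by
  have hp := exp_pos t
  have h1 : exp t ≤ exp (-1) := exp_le_exp.2 ht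
  have h2 : exp (-1) < 1 := by rw [exp_lt_one_iff]; norm_num
  unfold cfl fτ
  rw [div_mul_eq_mul_div]
  apply div_le_div₀
  · exact mul_nonneg hp.le (by linarith)
  · nlinarith
  · positivity
  · gcongr; linarith

/-! ### Solutions on the cylinder -/

structure CylSol (τ m E T Λ : ℝ) (cf : ℝ → ℝ) (U : ℝ × ℝ → ℝ) : Prop where
  sm : Sm T U
  per : PerH U
  pde : ∀ z : ℝ × ℝ, z.1 < T → Dt (Dt U) z + Dh (Dh U) z = - (E * exp (2 * z.1) * fτ τ (U z))
  asy : ∀ δ > 0, ∃ a0, ∀ z : ℝ × ℝ, z.1 ≤ a0 →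
    |Dt U z + 2 * m| ≤ δ ∧ |Dh U z| ≤ δ ∧ |Dt (Dt U) z| ≤ δ
  asy0 : ∃ C a0, ∀ z : ℝ × ℝ, z.1 ≤ a0 → |U z + 2 * m * z.1| ≤ C
  mass : ∀ a b, a ≤ b → b < T →
    ∫ t in a..b, cI (fun z => E * exp (2 * z.1) * |fτ τ (U z)|) t ≤ Λ
  energy : ∀ c a b, a ≤ b → b < T →
    ∫ t in a..b, cI (fun z => (Dt U z ^ 2 + Dh U z ^ 2) / (1 + (U z - c) ^ 2)) t ≤ Λ
  outer : ∀ t0, ∀ z : ℝ × ℝ, t0 ≤ z.1 → z.1 < T → U z ≤ cf t0 - log E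

def avg (U : ℝ × ℝ → ℝ) (t : ℝ) : ℝ := cI U t / (2 * π)

/-- derivative of the average -/
def avg' (U : ℝ × ℝ → ℝ) (t : ℝ) : ℝ := cI (Dt U) t / (2 * π)

lemma avg_hasDerivAt {T : ℝ} {U : ℝ × ℝ → ℝ} (h : Sm T U) {t : ℝ} (ht : t < T) :
    HasDerivAt (avg U) (avg' U t) t := (cI_hasDerivAt h ht).div_const _

lemma avg_contOn {T : ℝ} {U : ℝ × ℝ → ℝ} (h : Sm T U) : ContinuousOn (avg U) (Iio T) :=
  fun _ ht => (avg_hasDerivAt h ht).continuousAt.continuousWithinAt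

section
variable {τ m E T Λ : ℝ} {cf : ℝ → ℝ} {U : ℝ × ℝ → ℝ}

lemma Sm.g (hτ : 0 < τ) (h : Sm T U) : Sm T (fun z => E * exp (2 * z.1) * fτ τ (U z)) := by
  apply Sm.mul
  · exact Sm.of_t T (F := fun t => E * exp (2 * t)) (by fun_prop)
  · exact h.comp (fτ_contDiff hτ)

lemma contOn_absg (hτ : 0 < τ) (h : Sm T U) :
    ContinuousOn (fun z => E * exp (2 * z.1) * |fτ τ (U z)|) (strip T) := by
  have h1 : ContinuousOn (fun z => |fτ τ (U z)|) (strip T) := (h.comp (fτ_contDiff hτ)).contOn.abs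
  have h2 : ContinuousOn (fun z : ℝ × ℝ => E * exp (2 * z.1)) (strip T) := by fun_prop
  exact h2.mul h1

lemma cI_dt_hasDerivAt (hτ : 0 < τ) (h : CylSol τ m E T Λ cf U) {t : ℝ} (ht : t < T) :
    HasDerivAt (cI (Dt U)) (- cI (fun z => E * exp (2 * z.1) * fτ τ (U z)) t) t := by
  have h1 := cI_hasDerivAt h.sm.dt ht
  refine h1.congr_deriv ?_
  have h2 : cI (Dt (Dt U)) t = cI (fun z => (-1) * (E * exp (2 * z.1) * fτ τ (U z)) - Dh (Dh U) z) t := by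
    apply cI_congr; intro θ
    have := h.pde (t, θ) ht
    linarith
  rw [h2, cI_sub (T := T) (((Sm.const T (-1)).mul (h.sm.g hτ)).contOn) h.sm.dh.dh.contOn ht,
    cI_dh h.sm.dh h.per.dh ht, cI_cmul]
  ring

lemma S1 (hτ : 0 < τ) (hE : 0 < E) (h : CylSol τ m E T Λ cf U) {t : ℝ} (ht : t < T) :
    |cI (Dt U) t + 4 * π * m| ≤ Λ := by
  apply le_of_forall_pos_le_add
  intro δ hδ
  obtain ⟨a0, ha0⟩ := h.asy (δ / (2 * π)) (by positivity)
  set a := min a0 t with ha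
  have hat : a ≤ t := min_le_right _ _
  have haT : a < T := lt_of_le_of_lt hat ht
  have hI := ftc (F := cI (Dt U)) (fun t ht => cI_dt_hasDerivAt hτ h ht)
    (ContinuousOn.neg (cI_contOn (h.sm.g hτ).contOn)) hat ht
  have hA : |cI (fun z => Dt U z + 2 * m) a| ≤ 2 * π * (δ / (2 * π)) :=
    cI_abs (T := T) ((h.sm.dt.add (Sm.const T (2 * m))).contOn) haT
      (fun θ => (ha0 (a, θ) (min_le_left _ _)).1)
  rw [cI_add (T := T) h.sm.dt.contOn continuousOn_const haT, cI_const] at hA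
  have e : 2 * π * (δ / (2 * π)) = δ := by field_simp
  rw [e] at hA
  have hG : |∫ s in a..t, - cI (fun z => E * exp (2 * z.1) * fτ τ (U z)) s| ≤ Λ := by
    refine le_trans ?_ (h.mass a t hat ht)
    rw [← Real.norm_eq_abs]
    apply intervalIntegral.norm_integral_le_of_norm_le hat
    · refine Eventually.of_forall fun s hs => ?_
      rw [norm_neg]
      have hsT : s < T := lt_of_le_of_lt hs.2 ht
      rw [Real.norm_eq_abs, abs_le]
      have hpos : ∀ θ : ℝ, 0 < E * exp (2 * s) := fun _ => by positivity
      constructor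
      · have h3 := cI_nonneg (t := s) (Φ := fun z => E * exp (2 * z.1) * fτ τ (U z) + E * exp (2 * z.1) * |fτ τ (U z)|)
          (fun θ => by
            have := neg_abs_le (fτ τ (U (s, θ)))
            have := mul_nonneg (hpos θ).le (show 0 ≤ fτ τ (U (s, θ)) + |fτ τ (U (s, θ))| by linarith)
            simp only; linarith)
        rw [cI_add (h.sm.g hτ).contOn (contOn_absg hτ h.sm) hsT] at h3
        linarith
      · apply cI_mono (h.sm.g hτ).contOn (contOn_absg hτ h.sm) hsT
        intro θ
        exact mul_le_mul_of_nonneg_left (le_abs_self _) (hpos θ).le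
    · exact sm_int_t (cI_contOn (contOn_absg hτ h.sm)) hat ht
  rw [hI] at hG
  rw [abs_le] at *
  constructor <;> linarith [hG.1, hG.2, hA.1, hA.2]

def Lc (m Λ : ℝ) : ℝ := 2 * m + Λ

lemma Λ_nonneg (h : CylSol τ m E T Λ cf U) : 0 ≤ Λ := by
  have := h.mass (T - 1) (T - 1) le_rfl (by linarith)
  simpa using this

lemma S1' (hτ : 0 < τ) (hE : 0 < E) (hm : 0 ≤ m) (h : CylSol τ m E T Λ cf U) {t : ℝ} (ht : t < T) :
    |avg' U t| ≤ Lc m Λ := by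
  have h1 := S1 hτ hE h ht
  have hΛ := Λ_nonneg h
  have hpi := pi_gt_three
  unfold avg' Lc
  rw [abs_div, abs_of_pos (show 0 < 2 * π by positivity), div_le_iff₀ (by positivity)]
  rw [abs_le] at *
  constructor <;> nlinarith [h1.1, h1.2, mul_nonneg hΛ pi_pos.le, mul_nonneg hm pi_pos.le]

lemma avg_lip (hτ : 0 < τ) (hE : 0 < E) (hm : 0 ≤ m) (h : CylSol τ m E T Λ cf U) {s t : ℝ}
    (hs : s < T) (ht : t < T) : |avg U t - avg U s| ≤ Lc m Λ * |t - s| := by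
  have := (convex_Iio T).norm_image_sub_le_of_norm_hasDerivWithin_le (f := avg U) (f' := avg' U)
    (C := Lc m Λ) (x := s) (y := t)
    (fun x hx => (avg_hasDerivAt h.sm hx).hasDerivWithinAt)
    (fun x hx => S1' hτ hE hm h hx) hs ht
  simpa using this

/-! good circles -/
def Good (U : ℝ × ℝ → ℝ) (C t : ℝ) : Prop := ∀ θ, |U (t, θ) - avg U t| ≤ C

def C1 (m Λ : ℝ) : ℝ := sinh (arsinh (Lc m Λ) + (π + Λ)) + Lc m Λ

def Jd (U : ℝ × ℝ → ℝ) (c : ℝ) : ℝ × ℝ → ℝ :=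
  fun z => (Dt U z ^ 2 + Dh U z ^ 2) / (1 + (U z - c) ^ 2)

lemma Jd_cont (h : Sm T U) (c : ℝ) : ContinuousOn (Jd U c) (strip T) := by
  unfold Jd
  apply ContinuousOn.div
  · exact ((h.dt.pow 2).add (h.dh.pow 2)).contOn
  · exact ((Sm.const T 1).add ((h.sub (Sm.const T c)).pow 2)).contOn
  · intro z _; positivity

lemma exists_le_avg (h : Sm T U) (t : ℝ) (ht : t < T) :
    (∃ θ ∈ Icc 0 (2 * π), U (t, θ) ≤ avg U t) ∧ ∃ θ ∈ Icc 0 (2 * π), avg U t ≤ U (t, θ) := by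
  have hpi : (0:ℝ) < 2 * π := by positivity
  have hc := contOn_circle h.contOn ht
  have hav : cI U t = 2 * π * avg U t := by unfold avg; field_simp
  constructor
  · by_contra hcon
    push Not at hcon
    have : cI (fun _ => avg U t) t < cI U t := by
      apply intervalIntegral.integral_lt_integral_of_continuousOn_of_le_of_exists_lt hpi
        continuousOn_const hc.continuousOn
      · intro x hx; exact (hcon x ⟨hx.1.le, hx.2⟩).le
      · exact ⟨0, ⟨le_rfl, hpi.le⟩, hcon 0 ⟨le_rfl, hpi.le⟩⟩
    rw [cI_const] at this; linarith
  · by_contra hcon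
    push Not at hcon
    have : cI U t < cI (fun _ => avg U t) t := by
      apply intervalIntegral.integral_lt_integral_of_continuousOn_of_le_of_exists_lt hpi
         hc.continuousOn continuousOn_const
      · intro x hx; exact (hcon x ⟨hx.1.le, hx.2⟩).le
      · exact ⟨0, ⟨le_rfl, hpi.le⟩, hcon 0 ⟨le_rfl, hpi.le⟩⟩
    rw [cI_const] at this; linarith

lemma circle_var (h : Sm T U) {t : ℝ} (ht : t < T) (c : ℝ) {θ1 θ2 : ℝ}
    (h1 : θ1 ∈ Icc 0 (2 * π)) (h2 : θ2 ∈ Icc 0 (2 * π)) :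
    |arsinh (U (t, θ1) - c) - arsinh (U (t, θ2) - c)| ≤ π + cI (Jd U c) t / 2 := by
  have hpi : (0:ℝ) < 2 * π := by positivity
  wlog hle : θ2 ≤ θ1 generalizing θ1 θ2
  · rw [abs_sub_comm]; exact this h2 h1 (le_of_not_ge hle)
  set D : ℝ → ℝ := fun θ => (√(1 + (U (t, θ) - c) ^ 2))⁻¹ * Dh U (t, θ) with hD
  have hder : ∀ θ, HasDerivAt (fun θ => arsinh (U (t, θ) - c)) (D θ) θ := by
    intro θ
    have := ((hasDerivAt_h (h.diffAt (z := (t, θ)) ht)).sub_const c).arsinh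
    simpa [hD, smul_eq_mul] using this
  have hcU := contOn_circle h.contOn ht
  have hcD : Continuous D := by
    apply Continuous.mul
    · apply Continuous.inv₀
        (Real.continuous_sqrt.comp (continuous_const.add ((hcU.sub continuous_const).pow 2)))
      intro x; exact (Real.sqrt_pos.2 (add_pos_of_pos_of_nonneg one_pos (sq_nonneg _))).ne'
    · exact contOn_circle h.dh.contOn ht
  have hftc := intervalIntegral.integral_eq_sub_of_hasDerivAt (a := θ2) (b := θ1)
    (fun θ _ => hder θ) (hcD.intervalIntegrable _ _)
  rw [← hftc, ← Real.norm_eq_abs]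
  have hJc := contOn_circle (Jd_cont h c) ht
  have hB : ∀ θ, ‖D θ‖ ≤ 1 / 2 + Jd U c (t, θ) / 2 := by
    intro θ
    have hs : 0 < 1 + (U (t, θ) - c) ^ 2 := by positivity
    have e1 : D θ ^ 2 = Dh U (t, θ) ^ 2 / (1 + (U (t, θ) - c) ^ 2) := by
      simp only [hD, mul_pow, inv_pow, Real.sq_sqrt hs.le]; field_simp
    have e2 : D θ ^ 2 ≤ Jd U c (t, θ) := by
      rw [e1]; unfold Jd; gcongr; nlinarith [sq_nonneg (Dt U (t, θ))]
    rw [Real.norm_eq_abs]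
    nlinarith [sq_nonneg (|D θ| - 1), sq_abs (D θ)]
  have hb : Continuous (fun θ => 1 / 2 + Jd U c (t, θ) / 2) := by fun_prop
  refine (intervalIntegral.norm_integral_le_of_norm_le hle
    (Eventually.of_forall fun θ _ => hB θ) (hb.intervalIntegrable _ _)).trans ?_
  have h3 : ∫ θ in θ2..θ1, (1 / 2 + Jd U c (t, θ) / 2) ≤ ∫ θ in (0:ℝ)..(2 * π), (1 / 2 + Jd U c (t, θ) / 2) := by
    apply intervalIntegral.integral_mono_interval h2.1 hle h1.2
    · refine Eventually.of_forall fun θ => ?_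
      have : 0 ≤ Jd U c (t, θ) := by unfold Jd; positivity
      simp only [Pi.zero_apply]; positivity
    · exact hb.intervalIntegrable _ _
  refine h3.trans (le_of_eq ?_)
  rw [intervalIntegral.integral_add (by simp) ((hJc.div_const 2).intervalIntegrable _ _),
    intervalIntegral.integral_div]
  simp [cI]

lemma S2_point (hτ : 0 < τ) (hE : 0 < E) (hm : 0 ≤ m) (h : CylSol τ m E T Λ cf U) {a t : ℝ}
    (hat : a ≤ t) (hat1 : t ≤ a + 1) (ht : t < T) (hJ : cI (Jd U (avg U a)) t ≤ 2 * Λ) :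
    Good U (C1 m Λ) t := by
  have hpi : (0:ℝ) < 2 * π := by positivity
  set c := avg U a with hc
  set L := Lc m Λ with hL
  have hLn : 0 ≤ L := (abs_nonneg _).trans (S1' hτ hE hm h ht)
  have hlip : |avg U t - c| ≤ L := by
    have := avg_lip hτ hE hm h (lt_of_le_of_lt hat ht) ht
    refine this.trans ?_
    have : |t - a| ≤ 1 := by rw [abs_le]; constructor <;> linarith
    nlinarith
  have hlip' := abs_le.1 hlip
  obtain ⟨⟨θa, hθa, ha1⟩, θb, hθb, hb1⟩ := exists_le_avg h.sm t ht
  intro θ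
  obtain ⟨θ', hθ', he⟩ := per_reduce h.per t θ
  rw [he]
  have hθ'' : θ' ∈ Icc 0 (2 * π) := ⟨hθ'.1, hθ'.2.le⟩
  have v1 := abs_le.1 ((circle_var h.sm ht c hθ'' hθa).trans (by linarith : _ ≤ π + Λ))
  have v2 := abs_le.1 ((circle_var h.sm ht c hθ'' hθb).trans (by linarith : _ ≤ π + Λ))
  have u1 : arsinh (U (t, θa) - c) ≤ arsinh L := arsinh_le_arsinh.2 (by linarith)
  have u2 : -arsinh L ≤ arsinh (U (t, θb) - c) := by
    rw [← arsinh_neg]; exact arsinh_le_arsinh.2 (by linarith)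
  have w1 : U (t, θ') - c ≤ sinh (arsinh L + (π + Λ)) := by
    rw [← sinh_arsinh (U (t, θ') - c)]; exact sinh_le_sinh.2 (by linarith)
  have w2 : -sinh (arsinh L + (π + Λ)) ≤ U (t, θ') - c := by
    rw [← sinh_arsinh (U (t, θ') - c), ← sinh_neg]; exact sinh_le_sinh.2 (by linarith)
  unfold C1
  rw [abs_le]; constructor <;> linarith

lemma C1_nonneg (hm : 0 ≤ m) (hΛ : 0 ≤ Λ) : 0 ≤ C1 m Λ := by
  unfold C1 Lc
  have : 0 ≤ arsinh (2 * m + Λ) := arsinh_nonneg_iff.2 (by positivity)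
  have : 0 ≤ sinh (arsinh (2 * m + Λ) + (π + Λ)) := sinh_nonneg_iff.2 (by positivity)
  positivity

lemma S2 (hτ : 0 < τ) (hE : 0 < E) (hm : 0 ≤ m) (hΛ : 0 < Λ) (h : CylSol τ m E T Λ cf U) {a : ℝ}
    (ha : a + 1 < T) {q : ℝ → ℝ} (hq : ContinuousOn q (Iio T)) {c0 : ℝ} (hc0 : 0 ≤ c0)
    (hq0 : ∀ t ∈ Icc a (a + 1), 0 ≤ q t)
    (hq1 : ∀ t ∈ Icc a (a + 1), Good U (C1 m Λ) t → c0 ≤ q t) :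
    c0 / 2 ≤ ∫ t in a..(a + 1), q t := by
  have hJc := cI_contOn (Jd_cont h.sm (avg U a))
  have hen := h.energy (avg U a) a (a + 1) (by linarith) ha
  change ∫ t in a..(a + 1), cI (Jd U (avg U a)) t ≤ Λ at hen
  have h1 : ∫ t in a..(a + 1), (c0 - c0 / (2 * Λ) * cI (Jd U (avg U a)) t) ≤ ∫ t in a..(a + 1), q t := by
    apply intervalIntegral.integral_mono_on (by linarith)
    · apply sm_int_t _ (by linarith) ha; fun_prop
    · exact sm_int_t hq (by linarith) ha
    · intro t ht
      have hJ0 : 0 ≤ cI (Jd U (avg U a)) t := cI_nonneg fun θ => by unfold Jd; positivity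
      by_cases hJ : cI (Jd U (avg U a)) t ≤ 2 * Λ
      · have := hq1 t ht (S2_point hτ hE hm h ht.1 ht.2 (lt_of_le_of_lt ht.2 ha) hJ)
        have : 0 ≤ c0 / (2 * Λ) * cI (Jd U (avg U a)) t := by positivity
        linarith
      · push Not at hJ
        have := hq0 t ht
        have h2 : c0 / (2 * Λ) * (2 * Λ) ≤ c0 / (2 * Λ) * cI (Jd U (avg U a)) t := by
          gcongr
        have h3 : c0 / (2 * Λ) * (2 * Λ) = c0 := by field_simp
        linarith
  have hii := sm_int_t hJc (show a ≤ a + 1 by linarith) ha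
  rw [intervalIntegral.integral_sub (by simp) (hii.const_mul _),
    intervalIntegral.integral_const_mul] at h1
  simp at h1
  have h2 : c0 / (2 * Λ) * ∫ t in a..(a + 1), cI (Jd U (avg U a)) t ≤ c0 / (2 * Λ) * Λ := by gcongr
  have h3 : c0 / (2 * Λ) * Λ = c0 / 2 := by field_simp
  linarith

lemma S2_exists (hτ : 0 < τ) (hE : 0 < E) (hm : 0 ≤ m) (hΛ : 0 < Λ) (h : CylSol τ m E T Λ cf U)
    {a : ℝ} (ha : a + 1 < T) : ∃ t ∈ Icc a (a + 1), Good U (C1 m Λ) t := by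
  by_contra hcon
  push Not at hcon
  have := S2 hτ hE hm hΛ h ha (q := fun _ => 0) continuousOn_const (c0 := 1) zero_le_one
    (fun _ _ => le_rfl) (fun t ht hg => absurd hg (hcon t ht))
  simp at this
  linarith

/-- N unit intervals -/
lemma S2_N (hτ : 0 < τ) (hE : 0 < E) (hm : 0 ≤ m) (hΛ : 0 < Λ) (h : CylSol τ m E T Λ cf U) {a : ℝ}
    {N : ℕ} (ha : a + N < T) {q : ℝ → ℝ} (hq : ContinuousOn q (Iio T)) {c0 : ℝ} (hc0 : 0 ≤ c0)
    (hq0 : ∀ t ∈ Icc a (a + N), 0 ≤ q t)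
    (hq1 : ∀ t ∈ Icc a (a + N), Good U (C1 m Λ) t → c0 ≤ q t) :
    N * (c0 / 2) ≤ ∫ t in a..(a + N), q t := by
  induction N with
  | zero => simp
  | succ k ih =>
    push_cast at *
    have i1 := ih (by linarith) (fun t ht => hq0 t ⟨ht.1, by linarith [ht.2]⟩)
      (fun t ht => hq1 t ⟨ht.1, by linarith [ht.2]⟩)
    have hk : (0:ℝ) ≤ k := Nat.cast_nonneg k
    have i2 := S2 hτ hE hm hΛ h (a := a + k) (by linarith) hq hc0
      (fun t ht => hq0 t ⟨by linarith [ht.1], by linarith [ht.2]⟩)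
      (fun t ht => hq1 t ⟨by linarith [ht.1], by linarith [ht.2]⟩)
    rw [show a + (k + 1 : ℝ) = a + k + 1 by ring,
      ← intervalIntegral.integral_add_adjacent_intervals (b := a + k)
        (sm_int_t hq (by linarith) (by linarith)) (sm_int_t hq (by linarith) (by linarith))]
    linarith

/-- mass version: if `E e^{2t} e^{U} ≥ κ`, `U ≤ -1` on good circles then mass is big. -/
lemma mass_N (hτ : 0 < τ) (hE : 0 < E) (hm : 0 ≤ m) (hΛ : 0 < Λ) (h : CylSol τ m E T Λ cf U) {a : ℝ}
    {N : ℕ} (ha : a + N < T) {κ : ℝ} (hκ : 0 ≤ κ)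
    (hq1 : ∀ t ∈ Icc a (a + N), Good U (C1 m Λ) t → ∀ θ, U (t, θ) ≤ -1 ∧
      κ ≤ E * exp (2 * t) * exp (U (t, θ))) :
    N * (π * cfl τ * κ) ≤ Λ := by
  have hN : (0:ℝ) ≤ N := Nat.cast_nonneg N
  have hc := cfl_pos hτ
  refine le_trans ?_ (h.mass a (a + N) (by linarith) ha)
  have := S2_N hτ hE hm hΛ h ha (c0 := 2 * π * (cfl τ * κ))
    (cI_contOn (contOn_absg (E := E) hτ h.sm)) (by positivity)
    (fun t _ => cI_nonneg fun θ => by positivity) (fun t ht hg => ?_)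
  · refine le_trans (le_of_eq ?_) this; ring
  · apply le_cI (contOn_absg hτ h.sm) (lt_of_le_of_lt ht.2 ha)
    intro θ
    obtain ⟨h1, h2⟩ := hq1 t ht hg θ
    have h3 := (fτ_lower hτ h1).trans (le_abs_self _)
    calc cfl τ * κ ≤ cfl τ * (E * exp (2 * t) * exp (U (t, θ))) := by gcongr
      _ = E * exp (2 * t) * (cfl τ * exp (U (t, θ))) := by ring
      _ ≤ _ := by gcongr
end

section
variable {τ m E T Λ : ℝ} {cf : ℝ → ℝ} {U : ℝ × ℝ → ℝ}

def D1 (m Λ : ℝ) : ℝ := C1 m Λ + 1 + Lc m Λ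

def K3 (τ m Λ : ℝ) : ℝ := Λ / (π * cfl τ * exp (-(D1 m Λ + Lc m Λ + C1 m Λ)))

lemma K3_pos (hτ : 0 < τ) (hΛ : 0 < Λ) : 0 < K3 τ m Λ := by
  have := cfl_pos hτ
  unfold K3; positivity

lemma S3 (hτ : 0 < τ) (hE : 0 < E) (hm : 0 ≤ m) (hΛ : 0 < Λ) (h : CylSol τ m E T Λ cf U) {s : ℝ}
    (hs : s + 1 < T) (hav : avg U s = - D1 m Λ) : E * exp (2 * s) ≤ K3 τ m Λ := by
  have hc := cfl_pos hτ
  have hL : 0 ≤ Lc m Λ := by unfold Lc; positivity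
  have key := mass_N hτ hE hm hΛ h (a := s) (N := 1) (by simpa using hs)
    (κ := E * exp (2 * s) * exp (-(D1 m Λ + Lc m Λ + C1 m Λ))) (by positivity) (by
      intro t ht hg θ
      simp only [Nat.cast_one, mem_Icc] at ht
      have hlip := avg_lip hτ hE hm h (s := s) (t := t) (by linarith) (by linarith)
      have h1 : |t - s| ≤ 1 := by rw [abs_le]; constructor <;> linarith
      have hlip2 := abs_le.1 (hlip.trans (mul_le_of_le_one_right hL h1))
      have h2 := abs_le.1 (hg θ)
      constructor
      · rw [hav] at hlip2; unfold D1 at hlip2; linarith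
      · gcongr
        · linarith
        · linarith)
  unfold K3
  rw [le_div_iff₀ (by positivity)]
  refine le_trans (le_of_eq ?_) key
  push_cast; ring

lemma avg_le_of (h : CylSol τ m E T Λ cf U) {t c : ℝ} (ht : t < T)
    (hc : ∀ θ, U (t, θ) ≤ c) : avg U t ≤ c := by
  have := cI_le h.sm.contOn ht hc
  unfold avg; rw [div_le_iff₀ (by positivity)]; linarith

lemma S3' (hτ : 0 < τ) (hE : 0 < E) (hm : 0 ≤ m) (hΛ : 0 < Λ) (h : CylSol τ m E T Λ cf U)
    (hout : cf (T - 2) - log E < - D1 m Λ) {t : ℝ} (ht : t < T) (hK : K3 τ m Λ < E * exp (2 * t)) :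
    avg U t < - D1 m Λ := by
  by_cases ht2 : T - 2 ≤ t
  · exact lt_of_le_of_lt (avg_le_of h ht fun θ => h.outer (T - 2) (t, θ) ht2 ht) hout
  push Not at ht2
  by_contra hcon
  push Not at hcon
  have hend : avg U (T - 2) ≤ - D1 m Λ :=
    (avg_le_of h (by linarith) fun θ => h.outer (T - 2) (T - 2, θ) le_rfl (by simp)).trans hout.le
  have hivt := intermediate_value_Icc' ht2.le
    ((avg_contOn h.sm).mono (fun x hx => lt_of_le_of_lt hx.2 (by linarith)))
  obtain ⟨s, hs, hs2⟩ := hivt ⟨hend, hcon⟩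
  have := S3 hτ hE hm hΛ h (by linarith [hs.2]) hs2
  have h2 : E * exp (2 * t) ≤ E * exp (2 * s) := by gcongr; exact hs.1
  linarith

lemma S4 (hτ : 0 < τ) (hE : 0 < E) (h : CylSol τ m E T Λ cf U) {tb b : ℝ} (htb : tb < T)
    (hb : ∀ θ, U (tb, θ) ≤ b) {t : ℝ} (ht : t ≤ tb) (θ : ℝ) :
    U (t, θ) ≤ b + 2 * m * (tb - t) + E / (4 * τ ^ 2) * exp (2 * tb) := by
  obtain ⟨C, a0, hC⟩ := h.asy0
  have main : ∀ δ > 0, U (t, θ) ≤ (b + 2 * m * (tb - t) + E / (4 * τ ^ 2) * exp (2 * tb)) + δ * (tb - t) := by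
    intro δ hδ
    set a := min (min a0 t) (tb - |C - b - 2 * m * tb| / δ) with ha
    have haa0 : a ≤ a0 := (min_le_left _ _).trans (min_le_left _ _)
    have hat : a ≤ t := (min_le_left _ _).trans (min_le_right _ _)
    have hac : a ≤ tb - |C - b - 2 * m * tb| / δ := min_le_right _ _
    have hmp := max_principle (a := a) (b := tb) h.sm h.per htb
      (α := fun t => b + (2 * m + δ) * (tb - t) + E / (4 * τ ^ 2) * (exp (2 * tb) - exp (2 * t)))
      (α1 := fun t => - (2 * m + δ) - E / (2 * τ ^ 2) * exp (2 * t))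
      (α2 := fun t => - (E / τ ^ 2 * exp (2 * t)))
      (by
        intro s
        have h1 : HasDerivAt (fun t : ℝ => exp (2 * t)) (exp (2 * s) * (2 * 1)) s :=
          ((hasDerivAt_id s).const_mul 2).exp
        have := ((((hasDerivAt_id s).const_sub tb).const_mul (2 * m + δ)).const_add b).add
          ((h1.const_sub (exp (2 * tb))).const_mul (E / (4 * τ ^ 2)))
        exact this.congr_deriv (by field_simp; ring))
      (by
        intro s
        have h1 : HasDerivAt (fun t : ℝ => exp (2 * t)) (exp (2 * s) * (2 * 1)) s :=
          ((hasDerivAt_id s).const_mul 2).exp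
        have := (h1.const_mul (E / (2 * τ ^ 2))).const_sub (- (2 * m + δ))
        exact this.congr_deriv (by field_simp))
      (by
        intro s θ' hs1 hs2 _
        rw [h.pde (s, θ') (hs2.trans htb)]
        simp only
        have := fτ_le_const (U (s, θ')) hτ
        have h2 : E * exp (2 * s) * fτ τ (U (s, θ')) ≤ E * exp (2 * s) * (1 / τ ^ 2) := by gcongr
        have h3 : E * exp (2 * s) * (1 / τ ^ 2) = E / τ ^ 2 * exp (2 * s) := by ring
        linarith)
      (by
        intro θ'
        have h1 := (abs_le.1 (hC (a, θ') haa0)).2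
        simp only at h1
        have h2 : |C - b - 2 * m * tb| ≤ δ * (tb - a) := by
          have : |C - b - 2 * m * tb| / δ ≤ tb - a := by linarith
          rw [div_le_iff₀ hδ] at this; linarith
        have h3 := le_abs_self (C - b - 2 * m * tb)
        have h4 : exp (2 * a) ≤ exp (2 * tb) := by
          apply exp_le_exp.2; linarith
        have h5 : 0 ≤ E / (4 * τ ^ 2) * (exp (2 * tb) - exp (2 * a)) :=
          mul_nonneg (by positivity) (by linarith)
        nlinarith)
      (by intro θ'; simpa using hb θ')
      t θ hat ht
    have h5 : E / (4 * τ ^ 2) * (exp (2 * tb) - exp (2 * t)) ≤ E / (4 * τ ^ 2) * exp (2 * tb) := by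
      gcongr; linarith [exp_pos (2 * t)]
    nlinarith
  by_contra hcon
  push Not at hcon
  set X := U (t, θ) - (b + 2 * m * (tb - t) + E / (4 * τ ^ 2) * exp (2 * tb)) with hX
  have hXp : 0 < X := by linarith
  have hd : 0 ≤ tb - t := by linarith
  have := main (X / (2 * (tb - t + 1))) (by positivity)
  have h2 : X / (2 * (tb - t + 1)) * (tb - t) ≤ X / 2 := by
    rw [div_mul_eq_mul_div, div_le_div_iff₀ (by positivity) (by positivity)]
    nlinarith
  linarith

structure Bub (m E T Λ C4 κ0 : ℝ) (U : ℝ × ℝ → ℝ) (tb : ℝ) : Prop where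
  le : tb ≤ κ0 - log E / 2
  one : 1 ≤ E * exp (2 * tb)
  low : -C4 ≤ avg U tb
  nonpos : ∀ z : ℝ × ℝ, tb ≤ z.1 → z.1 < T → U z ≤ 0
  avg_le : ∀ t, tb ≤ t → t < T → avg U t ≤ - D1 m Λ

lemma exists_bub (hτ : 0 < τ) (hm : 0 ≤ m) (hΛ : 0 < Λ) (T : ℝ) (cf : ℝ → ℝ) {η : ℝ} (hη : 0 < η)
    (C0 : ℝ) : ∃ C4 κ0, ∀ᶠ E in atTop, ∀ U, CylSol τ m E T Λ cf U → ∀ θ0,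
      -C0 ≤ U (log η - log E / 2, θ0) → ∃ tb, Bub m E T Λ C4 κ0 U tb := by
  set K := max (K3 τ m Λ) (η ^ 2) + 1 with hK
  have hK3 := K3_pos (m := m) hτ hΛ
  have hK1 : 1 ≤ K := by
    have : 0 ≤ max (K3 τ m Λ) (η ^ 2) := hK3.le.trans (le_max_left _ _)
    linarith
  set κ0 := log K / 2 + 1 with hκ0
  set C4 := C0 + C1 m Λ + 2 * m * (κ0 - log η) + 1 / (4 * τ ^ 2) * exp (2 * κ0) with hC4
  have hηK : log η ≤ log K / 2 := by
    have : log (η ^ 2) ≤ log K := log_le_log (by positivity) (by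
      have := le_max_right (K3 τ m Λ) (η ^ 2); linarith)
    rw [log_pow] at this; push_cast at this; linarith
  refine ⟨C4, κ0, ?_⟩
  filter_upwards [tendsto_log_atTop.eventually_gt_atTop (cf (T - 2) + |D1 m Λ|),
    tendsto_log_atTop.eventually_gt_atTop (2 * (κ0 - (T - 2))), eventually_gt_atTop 0]
    with E hE1 hE2 hE U h θ0 hbad
  have hout : cf (T - 2) - log E < - D1 m Λ := by linarith [le_abs_self (D1 m Λ)]
  have hout0 : cf (T - 2) - log E ≤ 0 := by linarith [abs_nonneg (D1 m Λ)]
  set x := log K / 2 - log E / 2 with hx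
  have hxT : x + 1 < T - 2 := by linarith
  obtain ⟨tb, htb, hgood⟩ := S2_exists hτ hE hm hΛ h (a := x) (by linarith)
  have hKpos : 0 < K := by linarith
  have hexp : E * exp (2 * x) = K := by
    rw [hx, show 2 * (log K / 2 - log E / 2) = log K - log E by ring, exp_sub, exp_log hKpos,
      exp_log hE]
    field_simp
  have hmono : ∀ t, tb ≤ t → K ≤ E * exp (2 * t) := by
    intro t ht
    rw [← hexp]; gcongr; linarith [htb.1]
  have havg : ∀ t, tb ≤ t → t < T → avg U t < - D1 m Λ := by
    intro t ht htT
    apply S3' hτ hE hm hΛ h hout htT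
    have := hmono t ht
    have := le_max_left (K3 τ m Λ) (η ^ 2); linarith
  have hL : 0 ≤ Lc m Λ := by unfold Lc; positivity
  have htbT : tb < T - 2 := by linarith [htb.2]
  refine ⟨tb, ⟨by linarith [htb.2], hK1.trans (hmono tb le_rfl), ?_, ?_, fun t h1 h2 => (havg t h1 h2).le⟩⟩
  · have hs4 := S4 hτ hE h (by linarith : tb < T) (b := avg U tb + C1 m Λ)
      (fun θ => by linarith [(abs_le.1 (hgood θ)).2]) (t := log η - log E / 2)
      (by linarith [htb.1]) θ0
    have e1 : E * exp (2 * tb) ≤ exp (2 * κ0) := by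
      have : exp (2 * tb) ≤ exp (2 * κ0 - log E) := exp_le_exp.2 (by linarith [htb.2])
      rw [exp_sub, exp_log hE] at this
      rw [le_div_iff₀ hE] at this; linarith
    have e2 : E / (4 * τ ^ 2) * exp (2 * tb) ≤ 1 / (4 * τ ^ 2) * exp (2 * κ0) := by
      have : E / (4 * τ ^ 2) * exp (2 * tb) = 1 / (4 * τ ^ 2) * (E * exp (2 * tb)) := by ring
      rw [this]; gcongr
    have e3 : 2 * m * (tb - (log η - log E / 2)) ≤ 2 * m * (κ0 - log η) := by
      apply mul_le_mul_of_nonneg_left _ (by positivity); linarith [htb.2]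
    linarith
  · rintro ⟨t, θ⟩ h1 h2
    simp only at h1 h2
    by_cases ht2 : T - 2 ≤ t
    · exact (h.outer (T - 2) (t, θ) ht2 h2).trans hout0
    push Not at ht2
    refine max_principle (a := tb) (b := T - 2) h.sm h.per (by linarith)
      (α := fun _ => 0) (α1 := fun _ => 0) (α2 := fun _ => 0)
      (fun t => hasDerivAt_const t 0) (fun t => hasDerivAt_const t 0) ?_ ?_ ?_ t θ h1 ht2.le
    · intro s θ' hs1 hs2 hpos
      rw [h.pde (s, θ') (by simp only; linarith)]
      have := fτ_nonpos hτ hpos.le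
      have : E * exp (2 * s) * fτ τ (U (s, θ')) ≤ 0 :=
        mul_nonpos_of_nonneg_of_nonpos (by positivity) this
      simp only; linarith
    · intro θ'
      have h1 := (abs_le.1 (hgood θ')).2
      have h2 := havg tb le_rfl (by linarith)
      unfold D1 at h2
      linarith
    · intro θ'
      exact (h.outer (T - 2) (T - 2, θ') le_rfl (by simp)).trans hout0

variable {C4 κ0 tb : ℝ}

lemma avg'_contOn (h : Sm T U) : ContinuousOn (avg' U) (Iio T) :=
  (cI_contOn h.dt.contOn).div_const _

lemma avg'_anti (hτ : 0 < τ) (hE : 0 < E) (h : CylSol τ m E T Λ cf U) (hB : Bub m E T Λ C4 κ0 U tb)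
    {s t : ℝ} (hs : tb ≤ s) (hst : s ≤ t) (ht : t < T) : avg' U t ≤ avg' U s := by
  have hI := ftc (F := cI (Dt U)) (fun t ht => cI_dt_hasDerivAt hτ h ht)
    (ContinuousOn.neg (cI_contOn (h.sm.g hτ).contOn)) hst ht
  have : ∫ r in s..t, - cI (fun z => E * exp (2 * z.1) * fτ τ (U z)) r ≤ 0 := by
    rw [intervalIntegral.integral_neg]
    have := intervalIntegral.integral_nonneg (μ := volume) (f := fun r => cI (fun z => E * exp (2 * z.1) * fτ τ (U z)) r)
      hst (fun r hr => cI_nonneg fun θ => by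
        have := fτ_nonneg hτ (hB.nonpos (r, θ) (hs.trans hr.1) (lt_of_le_of_lt hr.2 ht))
        positivity)
    linarith
  unfold avg'
  gcongr
  linarith

lemma avg_ge (hτ : 0 < τ) (hE : 0 < E) (h : CylSol τ m E T Λ cf U) (hB : Bub m E T Λ C4 κ0 U tb)
    {s t r : ℝ} (hs : tb ≤ s) (hst : s ≤ t) (htr : t ≤ r) (hr : r < T) :
    avg' U r * (t - s) ≤ avg U t - avg U s := by
  have ht : t < T := by linarith
  rw [← ftc (F := avg U) (fun t ht => avg_hasDerivAt h.sm ht) (avg'_contOn h.sm) hst ht]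
  have := intervalIntegral.integral_mono_on (μ := volume) hst (f := fun _ => avg' U r) (g := avg' U) (by simp)
    (sm_int_t (avg'_contOn h.sm) hst ht)
    (fun x hx => avg'_anti hτ hE h hB (hs.trans hx.1) (hx.2.trans htr) hr)
  simp at this
  linarith

lemma avg_le' (hτ : 0 < τ) (hE : 0 < E) (h : CylSol τ m E T Λ cf U) (hB : Bub m E T Λ C4 κ0 U tb)
    {s t r : ℝ} (hr : tb ≤ r) (hrs : r ≤ s) (hst : s ≤ t) (ht : t < T) :
    avg U t - avg U s ≤ avg' U r * (t - s) := by
  rw [← ftc (F := avg U) (fun t ht => avg_hasDerivAt h.sm ht) (avg'_contOn h.sm) hst ht]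
  have := intervalIntegral.integral_mono_on (μ := volume) hst (g := fun _ => avg' U r) (f := avg' U)
    (sm_int_t (avg'_contOn h.sm) hst ht) (by simp)
    (fun x hx => avg'_anti hτ hE h hB hr (hrs.trans hx.1) (lt_of_le_of_lt hx.2 ht))
  simp at this
  linarith

lemma good_le (hm : 0 ≤ m) (hΛ : 0 < Λ) (hB : Bub m E T Λ C4 κ0 U tb) {t : ℝ} (h1 : tb ≤ t) (h2 : t < T)
    (hg : Good U (C1 m Λ) t) (θ : ℝ) : U (t, θ) ≤ -1 := by
  have := hB.avg_le t h1 h2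
  have := (abs_le.1 (hg θ)).2
  have hL : 0 ≤ Lc m Λ := by unfold Lc; positivity
  unfold D1 at *
  linarith

lemma S6 (hτ : 0 < τ) (hm : 0 ≤ m) (hΛ : 0 < Λ) (C4 : ℝ) : ∃ N : ℕ, 0 < N ∧
    ∀ E T cf U κ0 tb ts, 0 < E → CylSol τ m E T Λ cf U → Bub m E T Λ C4 κ0 U tb →
      tb + N ≤ ts → ts < T → - avg' U ts ≤ 2 + 1 / N → False := by
  have hc := cfl_pos hτ
  set κ := exp (-C4 - C1 m Λ - 1) with hκ
  have hpos : 0 < π * cfl τ * κ := by positivity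
  obtain ⟨N, hN⟩ := exists_nat_gt (Λ / (π * cfl τ * κ))
  have hN0 : (0:ℝ) < N := lt_trans (by positivity) hN
  refine ⟨N, by exact_mod_cast hN0, ?_⟩
  intro E T cf U κ0 tb ts hE h hB hts hT hγ
  have := mass_N hτ hE hm hΛ h (a := tb) (N := N) (by linarith) (κ := κ) (by positivity) (by
    intro t ht hg θ
    have htT : t < T := by linarith [ht.2]
    refine ⟨good_le hm hΛ hB ht.1 htT hg θ, ?_⟩
    have h1 := avg_ge hτ hE h hB le_rfl ht.1 (by linarith [ht.2] : t ≤ ts) hT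
    have h2 := hB.low
    have h3 := (abs_le.1 (hg θ)).1
    set s := t - tb with hs
    have hs0 : 0 ≤ s := by linarith [ht.1]
    have hsN : s ≤ N := by linarith [ht.2]
    have h4 : -(2 + 1 / N) * s ≤ avg' U ts * s := by
      apply mul_le_mul_of_nonneg_right _ hs0; linarith
    have h5 : 1 / N * s ≤ 1 := by
      rw [div_mul_eq_mul_div, div_le_one hN0]; linarith
    have h6 : exp (-C4 - C1 m Λ - 1) ≤ exp (2 * s) * exp (U (t, θ)) := by
      rw [← exp_add]; apply exp_le_exp.2; linarith
    have h7 : exp (2 * t) = exp (2 * tb) * exp (2 * s) := by rw [← exp_add]; congr 1; rw [hs]; ring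
    rw [h7]
    calc κ ≤ 1 * (exp (2 * s) * exp (U (t, θ))) := by rw [one_mul]; exact h6
      _ ≤ (E * exp (2 * tb)) * (exp (2 * s) * exp (U (t, θ))) := by gcongr; exact hB.one
      _ = _ := by ring)
  rw [div_lt_iff₀ hpos] at hN
  linarith

theorem lemmaA (hτ : 0 < τ) (hm : 0 ≤ m) (hΛ : 0 < Λ) (T : ℝ) (cf : ℝ → ℝ) {η : ℝ} (hη : 0 < η)
    (C0 M : ℝ) : ∀ᶠ E in atTop, ∀ U, CylSol τ m E T Λ cf U →
      - log E - M ≤ avg U (T - 2) → ∀ θ0, U (log η - log E / 2, θ0) < -C0 := by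
  have hc := cfl_pos hτ
  obtain ⟨C4, κ0, hbub⟩ := exists_bub hτ hm hΛ T cf hη C0
  obtain ⟨N, hN0, hfin⟩ := S6 hτ hm hΛ C4
  set κ := exp (2 * (T - 2) - M - C1 m Λ) with hκ
  have hpos : 0 < π * cfl τ * κ := by positivity
  obtain ⟨N', hN'⟩ := exists_nat_gt (Λ / (π * cfl τ * κ))
  filter_upwards [hbub, eventually_gt_atTop 0,
    tendsto_log_atTop.eventually_gt_atTop (2 * (κ0 + N + N' - (T - 2)))] with E hb hE hE2 U h hM θ0
  by_contra hcon
  push Not at hcon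
  obtain ⟨tb, hB⟩ := hb U h θ0 hcon
  have hle := hB.le
  have hNr : (0:ℝ) ≤ N := Nat.cast_nonneg N
  have hNr' : (0:ℝ) ≤ N' := Nat.cast_nonneg N'
  have hN1 : (0:ℝ) < 1 / (N:ℝ) := by
    have : (0:ℝ) < N := by exact_mod_cast hN0
    positivity
  by_cases hγ : - avg' U (T - 2 - N') ≤ 2
  · exact hfin E T cf U κ0 tb (T - 2 - N') hE h hB (by linarith) (by linarith) (by linarith)
  push Not at hγ
  have := mass_N hτ hE hm hΛ h (a := T - 2 - N') (N := N') (by linarith) (κ := κ) (by positivity) (by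
    intro t ht hg θ
    have htT : t < T := by linarith [ht.2]
    have htb : tb ≤ T - 2 - N' := by linarith
    refine ⟨good_le hm hΛ hB (htb.trans ht.1) htT hg θ, ?_⟩
    have h1 := avg_le' hτ hE h hB htb ht.1 (by linarith [ht.2] : t ≤ T - 2) (by linarith)
    have h3 := (abs_le.1 (hg θ)).1
    have h4 : avg' U (T - 2 - N') * (T - 2 - t) ≤ -2 * (T - 2 - t) := by
      apply mul_le_mul_of_nonneg_right
      · linarith
      · linarith [ht.2]
    have h6 : exp (2 * (T - 2) - M - C1 m Λ - log E) ≤ exp (2 * t) * exp (U (t, θ)) := by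
      rw [← exp_add]; apply exp_le_exp.2; linarith
    rw [exp_sub, exp_log hE, div_le_iff₀ hE] at h6
    linarith)
  rw [div_lt_iff₀ hpos] at hN'
  linarith
end

lemma cI_hasDerivAt' {T : ℝ} {Φ Ψ : ℝ × ℝ → ℝ} (h : Sm T Φ) {t : ℝ} (ht : t < T)
    (hΨ : ∀ θ, HasDerivAt (fun s => Φ (s, θ)) (Ψ (t, θ)) t) :
    HasDerivAt (cI Φ) (cI Ψ t) t := by
  refine (cI_hasDerivAt h ht).congr_deriv (cI_congr fun θ => ?_)
  exact Dt_eq (h.diffAt (z := (t, θ)) ht) (hΨ θ)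

lemma cI_dh' {T : ℝ} {Φ Ψ : ℝ × ℝ → ℝ} (h : Sm T Φ) (hp : PerH Φ) {t : ℝ} (ht : t < T)
    (hΨ : ∀ θ, HasDerivAt (fun s => Φ (t, s)) (Ψ (t, θ)) θ) : cI Ψ t = 0 := by
  rw [← cI_dh h hp ht]
  exact cI_congr fun θ => (Dh_eq (h.diffAt (z := (t, θ)) ht) (hΨ θ)).symm

section
variable {τ m E T Λ : ℝ} {cf : ℝ → ℝ} {U : ℝ × ℝ → ℝ}

lemma Sm.ht {Φ : ℝ × ℝ → ℝ} (h : Sm T Φ) {t : ℝ} (ht : t < T) (θ : ℝ) :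
    HasDerivAt (fun s => Φ (s, θ)) (Dt Φ (t, θ)) t := hasDerivAt_t (h.diffAt (z := (t, θ)) ht)
lemma Sm.hh {Φ : ℝ × ℝ → ℝ} (h : Sm T Φ) {t : ℝ} (ht : t < T) (θ : ℝ) :
    HasDerivAt (fun s => Φ (t, s)) (Dh Φ (t, θ)) θ := hasDerivAt_h (h.diffAt (z := (t, θ)) ht)

/-- differentiated equation -/
lemma pde_t (hτ : 0 < τ) (h : CylSol τ m E T Λ cf U) {t : ℝ} (ht : t < T) (θ : ℝ) :
    Dt (Dt (Dt U)) (t, θ) + Dh (Dh (Dt U)) (t, θ) =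
      - (2 * (E * exp (2 * t) * fτ τ (U (t, θ)))) -
        E * exp (2 * t) * fτ' τ (U (t, θ)) * Dt U (t, θ) := by
  have e1 : Dh (Dh (Dt U)) (t, θ) = Dt (Dh (Dh U)) (t, θ) := by
    rw [Dt_Dh_comm h.sm.dh (z := (t, θ)) ht]
    exact Dh_congr (T := T) (fun z hz => (Dt_Dh_comm h.sm hz).symm) ht
  rw [e1]
  have h1 := (h.sm.dt.dt.ht ht θ).add (h.sm.dh.dh.ht ht θ)
  have h2 : HasDerivAt (fun s => - (E * exp (2 * s) * fτ τ (U (s, θ))))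
      (-((E * (exp (2 * t) * (2 * 1))) * fτ τ (U (t, θ)) +
        E * exp (2 * t) * (fτ' τ (U (t, θ)) * Dt U (t, θ)))) t := by
    have g1 : HasDerivAt (fun t : ℝ => exp (2 * t)) (exp (2 * t) * (2 * 1)) t :=
      ((hasDerivAt_id t).const_mul 2).exp
    have g2 := (fτ_hasDerivAt hτ (U (t, θ))).comp t (h.sm.ht ht θ)
    exact ((g1.const_mul E).mul g2).neg
  have h3 : (fun s => Dt (Dt U) (s, θ) + Dh (Dh U) (s, θ)) =ᶠ[𝓝 t]
      (fun s => - (E * exp (2 * s) * fτ τ (U (s, θ)))) := by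
    filter_upwards [Iio_mem_nhds ht] with s hs using h.pde (s, θ) hs
  have := h1.unique (h2.congr_of_eventuallyEq h3)
  rw [this]; ring

def qA (U : ℝ × ℝ → ℝ) : ℝ → ℝ := cI (fun z => Dt U z ^ 2)
def qB (U : ℝ × ℝ → ℝ) : ℝ → ℝ := cI (fun z => Dh U z ^ 2)
def qVV (U : ℝ × ℝ → ℝ) : ℝ → ℝ := cI (fun z => Dt U z * Dt (Dt U) z)
def qVV' (U : ℝ × ℝ → ℝ) : ℝ → ℝ := cI (fun z => Dt (Dt U) z ^ 2 + Dt U z * Dt (Dt (Dt U)) z)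
def qgV (τ E : ℝ) (U : ℝ × ℝ → ℝ) : ℝ → ℝ := cI (fun z => (E * exp (2 * z.1) * fτ τ (U z)) * Dt U z)

lemma qVV_hasDerivAt (h : Sm T U) {t : ℝ} (ht : t < T) :
    HasDerivAt (qVV U) (qVV' U t) t := by
  apply cI_hasDerivAt' (h.dt.mul h.dt.dt) ht
  intro θ
  exact ((h.dt.ht ht θ).mul (h.dt.dt.ht ht θ)).congr_deriv (by ring)

lemma qP_hasDerivAt (hτ : 0 < τ) (h : CylSol τ m E T Λ cf U) {t : ℝ} (ht : t < T) :
    HasDerivAt (fun t => qA U t - qB U t) (-2 * qgV τ E U t) t := by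
  have h1 : HasDerivAt (cI (fun z => Dt U z ^ 2 - Dh U z ^ 2))
      (cI (fun z => 2 * Dt U z * Dt (Dt U) z - 2 * Dh U z * Dt (Dh U) z) t) t := by
    apply cI_hasDerivAt' ((h.sm.dt.pow 2).sub (h.sm.dh.pow 2)) ht
    intro θ
    exact (((h.sm.dt.ht ht θ).pow 2).sub ((h.sm.dh.ht ht θ).pow 2)).congr_deriv (by ring)
  have e : cI (fun z => 2 * Dt U z * Dt (Dt U) z - 2 * Dh U z * Dt (Dh U) z) t
      = -2 * qgV τ E U t := by
    have e0 : cI (fun z => Dt U z * Dh (Dh U) z + Dh (Dt U) z * Dh U z) t = 0 := by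
      apply cI_dh' (h.sm.dt.mul h.sm.dh) (Φ := fun z => Dt U z * Dh U z)
        (fun a b => by simp only [h.per.dt a b, h.per.dh a b]) ht
      intro θ
      exact ((h.sm.dt.hh ht θ).mul (h.sm.dh.hh ht θ)).congr_deriv (by ring)
    have e1 : cI (fun z => 2 * Dt U z * Dt (Dt U) z - 2 * Dh U z * Dt (Dh U) z) t
      = cI (fun z => (-2) * ((E * exp (2 * z.1) * fτ τ (U z)) * Dt U z) - 2 * (Dt U z * Dh (Dh U) z + Dh (Dt U) z * Dh U z)) t := by
      apply cI_congr
      intro θ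
      have := h.pde (t, θ) ht
      have hc := Dt_Dh_comm h.sm (z := (t, θ)) ht
      have hv : Dt (Dt U) (t, θ) = - (E * exp (2 * t) * fτ τ (U (t, θ))) - Dh (Dh U) (t, θ) := by
        linarith
      simp only [hc, hv]
      ring
    rw [e1, cI_sub (T := T) _ _ ht, cI_cmul, cI_cmul, e0]
    · unfold qgV; ring
    · exact ((Sm.const T (-2)).mul ((h.sm.g hτ).mul h.sm.dt)).contOn
    · exact ((Sm.const T 2).mul ((h.sm.dt.mul h.sm.dh.dh).add (h.sm.dt.dh.mul h.sm.dh))).contOn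
  rw [e] at h1
  refine h1.congr_of_eventuallyEq ?_
  filter_upwards [Iio_mem_nhds ht] with s hs
  rw [cI_sub (T := T) (h.sm.dt.pow 2).contOn (h.sm.dh.pow 2).contOn hs]
  rfl

def dens (τ E : ℝ) (χ : ℝ → ℝ) (U : ℝ × ℝ → ℝ) : ℝ × ℝ → ℝ := fun z =>
  Dt (fun z => χ z.1 * Dt U z) z ^ 2 + Dh (fun z => χ z.1 * Dt U z) z ^ 2 -
    E * exp (2 * z.1) * fτ' τ (U z) * (χ z.1 * Dt U z) ^ 2

lemma cI_dens (hτ : 0 < τ) (h : CylSol τ m E T Λ cf U) {χ : ℝ → ℝ} (hχ : ContDiff ℝ (⊤ : ℕ∞) χ)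
    {t : ℝ} (ht : t < T) :
    cI (dens τ E χ U) t = deriv χ t ^ 2 * qA U t + (2 * χ t * deriv χ t) * qVV U t
      + χ t ^ 2 * qVV' U t + 2 * χ t ^ 2 * qgV τ E U t := by
  have hφ : Sm T (fun z => χ z.1 * Dt U z) := (Sm.of_t T hχ).mul h.sm.dt
  have hχd : ∀ t, HasDerivAt χ (deriv χ t) t := fun t =>
    ((hχ.differentiable (by simp)) t).hasDerivAt
  have e0 : cI (fun z => Dh (Dt U) z ^ 2 + Dt U z * Dh (Dh (Dt U)) z) t = 0 := by
    apply cI_dh' (h.sm.dt.mul h.sm.dt.dh) (Φ := fun z => Dt U z * Dh (Dt U) z)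
      (fun a b => by simp only [h.per.dt a b, h.per.dt.dh a b]) ht
    intro θ
    exact ((h.sm.dt.hh ht θ).mul (h.sm.dt.dh.hh ht θ)).congr_deriv (by ring)
  have e1 : cI (dens τ E χ U) t = cI (fun z => (deriv χ t ^ 2 * (Dt U z ^ 2)
      + (2 * χ t * deriv χ t) * (Dt U z * Dt (Dt U) z))
      + (χ t ^ 2 * (Dt (Dt U) z ^ 2 + Dt U z * Dt (Dt (Dt U)) z)
      + (2 * χ t ^ 2 * ((E * exp (2 * z.1) * fτ τ (U z)) * Dt U z)
      + χ t ^ 2 * (Dh (Dt U) z ^ 2 + Dt U z * Dh (Dh (Dt U)) z)))) t := by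
    apply cI_congr
    intro θ
    have d1 : Dt (fun z => χ z.1 * Dt U z) (t, θ) = deriv χ t * Dt U (t, θ) + χ t * Dt (Dt U) (t, θ) :=
      Dt_eq (hφ.diffAt (z := (t, θ)) ht) ((hχd t).mul (h.sm.dt.ht ht θ))
    have d2 : Dh (fun z => χ z.1 * Dt U z) (t, θ) = χ t * Dh (Dt U) (t, θ) :=
      Dh_eq (hφ.diffAt (z := (t, θ)) ht) ((h.sm.dt.hh ht θ).const_mul (χ t))
    have d3 := pde_t hτ h ht θ
    have d4 : Dt (Dt (Dt U)) (t, θ) = - (2 * (E * exp (2 * t) * fτ τ (U (t, θ)))) -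
        E * exp (2 * t) * fτ' τ (U (t, θ)) * Dt U (t, θ) - Dh (Dh (Dt U)) (t, θ) := by linarith
    simp only [dens, d1, d2, d4]
    ring
  have s1 := (h.sm.dt.pow 2)
  have s2 := h.sm.dt.mul h.sm.dt.dt
  have s3 := (h.sm.dt.dt.pow 2).add (h.sm.dt.mul h.sm.dt.dt.dt)
  have s4 := (h.sm.g (E := E) hτ).mul h.sm.dt
  have s5 := (h.sm.dt.dh.pow 2).add (h.sm.dt.mul h.sm.dt.dh.dh)
  have k := fun c => Sm.const T c
  rw [e1, cI_add (T := T) (((k _).mul s1).add ((k _).mul s2)).contOn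
      (((k _).mul s3).add (((k _).mul s4).add ((k _).mul s5))).contOn ht,
    cI_add (T := T) ((k _).mul s1).contOn ((k _).mul s2).contOn ht,
    cI_add (T := T) ((k _).mul s3).contOn (((k _).mul s4).add ((k _).mul s5)).contOn ht,
    cI_add (T := T) ((k _).mul s4).contOn ((k _).mul s5).contOn ht,
    cI_cmul, cI_cmul, cI_cmul, cI_cmul, cI_cmul, e0]
  unfold qA qVV qVV' qgV
  ring

/-- stability along the test functions `χ U_t`. -/
def StabC (τ E T : ℝ) (U : ℝ × ℝ → ℝ) : Prop :=
  ∀ χ : ℝ → ℝ, ∀ m1 m2 : ℝ, ContDiff ℝ (⊤ : ℕ∞) χ → m1 < m2 → m2 < T → (∀ t ≤ m1, χ t = 1) →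
    (∀ t ≥ m2, χ t = 0) → ∀ δ > 0, ∃ a0, ∀ a ≤ a0, a ≤ m2 →
      -δ ≤ ∫ t in a..m2, cI (dens τ E χ U) t

lemma deriv_zero_of {χ : ℝ → ℝ} (hχ : ContDiff ℝ (⊤ : ℕ∞) χ) {m1 : ℝ} (h1 : ∀ t ≤ m1, χ t = 1)
    {t : ℝ} (ht : t ≤ m1) : deriv χ t = 0 := by
  have hd : HasDerivAt χ (deriv χ t) t := ((hχ.differentiable (by simp)) t).hasDerivAt
  have h2 : HasDerivWithinAt χ 0 (Iic m1) t :=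
    (hasDerivWithinAt_const t (Iic m1) (1:ℝ)).congr (fun x hx => h1 x hx) (h1 t ht)
  exact ((uniqueDiffOn_Iic m1) t ht).eq_deriv _ hd.hasDerivWithinAt h2

lemma qVV_small (h : CylSol τ m E T Λ cf U) (hm : 0 ≤ m) {a δ : ℝ} (ha : a < T)
    (hδ : ∀ θ, |Dt U (a, θ) + 2 * m| ≤ δ ∧ |Dh U (a, θ)| ≤ δ ∧ |Dt (Dt U) (a, θ)| ≤ δ) :
    |qVV U a| ≤ 2 * π * ((2 * m + δ) * δ) ∧ qA U a ≤ 2 * π * (2 * m + δ) ^ 2 := by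
  have hb : ∀ θ, |Dt U (a, θ)| ≤ 2 * m + δ := by
    intro θ
    have := abs_le.1 (hδ θ).1
    rw [abs_le]; constructor <;> linarith
  constructor
  · apply cI_abs (h.sm.dt.mul h.sm.dt.dt).contOn ha
    intro θ
    rw [abs_mul]
    exact mul_le_mul (hb θ) (hδ θ).2.2 (abs_nonneg _) ((abs_nonneg _).trans (hb θ))
  · apply cI_le (h.sm.dt.pow 2).contOn ha
    intro θ
    rw [← sq_abs]
    gcongr
    exact hb θ

lemma cont_q (hτ : 0 < τ) (h : CylSol τ m E T Λ cf U) : ContinuousOn (qA U) (Iio T) ∧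
    ContinuousOn (qB U) (Iio T) ∧ ContinuousOn (qVV U) (Iio T) ∧ ContinuousOn (qVV' U) (Iio T) ∧
    ContinuousOn (qgV τ E U) (Iio T) :=
  ⟨cI_contOn (h.sm.dt.pow 2).contOn, cI_contOn (h.sm.dh.pow 2).contOn,
    cI_contOn (h.sm.dt.mul h.sm.dt.dt).contOn,
    cI_contOn ((h.sm.dt.dt.pow 2).add (h.sm.dt.mul h.sm.dt.dt.dt)).contOn,
    cI_contOn ((h.sm.g hτ).mul h.sm.dt).contOn⟩

lemma cont_dens (hτ : 0 < τ) (h : CylSol τ m E T Λ cf U) {χ : ℝ → ℝ} (hχ : ContDiff ℝ (⊤ : ℕ∞) χ) :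
    ContinuousOn (cI (dens τ E χ U)) (Iio T) := by
  obtain ⟨c1, c2, c3, c4, c5⟩ := cont_q hτ h
  have hχc := hχ.continuous.continuousOn (s := Iio T)
  have hχ' : ContinuousOn (deriv χ) (Iio T) := (hχ.continuous_deriv (by simp)).continuousOn
  refine ContinuousOn.congr (f := fun t => deriv χ t ^ 2 * qA U t + (2 * χ t * deriv χ t) * qVV U t
      + χ t ^ 2 * qVV' U t + 2 * χ t ^ 2 * qgV τ E U t) (by fun_prop) (fun t ht => cI_dens hτ h hχ ht)

lemma stab1 (hτ : 0 < τ) (hm : 0 ≤ m) (h : CylSol τ m E T Λ cf U) (hS : StabC τ E T U)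
    {χ : ℝ → ℝ} (hχ : ContDiff ℝ (⊤ : ℕ∞) χ) {m1 m2 : ℝ} (h12 : m1 < m2) (h2T : m2 < T)
    (hχ1 : ∀ t ≤ m1, χ t = 1) (hχ2 : ∀ t ≥ m2, χ t = 0) :
    0 ≤ 8 * π * m ^ 2 + ∫ t in m1..m2, (deriv χ t ^ 2 * qA U t +
      2 * χ t * deriv χ t * (qA U t - qB U t)) := by
  set X := ∫ t in m1..m2, (deriv χ t ^ 2 * qA U t + 2 * χ t * deriv χ t * (qA U t - qB U t)) with hX
  obtain ⟨c1, c2, c3, c4, c5⟩ := cont_q hτ h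
  have hχc := hχ.continuous.continuousOn (s := Iio T)
  have hχ' : ContinuousOn (deriv χ) (Iio T) := (hχ.continuous_deriv (by simp)).continuousOn
  have hχd : ∀ t, HasDerivAt χ (deriv χ t) t := fun t =>
    ((hχ.differentiable (by simp)) t).hasDerivAt
  have key : ∀ δ > 0, -δ ≤ X + 2 * π * (2 * m + δ) ^ 2 + 2 * π * ((2 * m + δ) * δ) := by
    intro δ hδ
    obtain ⟨a1, ha1⟩ := h.asy δ hδ
    obtain ⟨a2, ha2⟩ := hS χ m1 m2 hχ h12 h2T hχ1 hχ2 δ hδ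
    set a := min (min a1 a2) m1 with ha
    have haa1 : a ≤ a1 := (min_le_left _ _).trans (min_le_left _ _)
    have haa2 : a ≤ a2 := (min_le_left _ _).trans (min_le_right _ _)
    have ham1 : a ≤ m1 := min_le_right _ _
    have haT : a < T := by linarith
    have hst := ha2 a haa2 (by linarith)
    have hQ : ∀ t < T, HasDerivAt (fun t => χ t ^ 2 * (qVV U t - (qA U t - qB U t)))
        (cI (dens τ E χ U) t - (deriv χ t ^ 2 * qA U t + 2 * χ t * deriv χ t * (qA U t - qB U t))) t := by
      intro t ht
      have := ((hχd t).pow 2).mul ((qVV_hasDerivAt h.sm ht).sub (qP_hasDerivAt hτ h ht))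
      refine this.congr_deriv ?_
      rw [cI_dens hτ h hχ ht]
      simp only [Pi.sub_apply, Pi.pow_apply]
      push_cast
      ring
    have hcd := cont_dens hτ h hχ
    have hcX : ContinuousOn (fun t => deriv χ t ^ 2 * qA U t +
      2 * χ t * deriv χ t * (qA U t - qB U t)) (Iio T) := by fun_prop
    have hI := ftc hQ (hcd.sub hcX) (by linarith : a ≤ m2) h2T
    rw [intervalIntegral.integral_sub (sm_int_t hcd (by linarith) h2T)
      (sm_int_t hcX (by linarith) h2T),
      ← intervalIntegral.integral_add_adjacent_intervals (b := m1)
        (sm_int_t hcX ham1 (by linarith)) (sm_int_t hcX h12.le h2T)] at hI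
    have hz : ∫ t in a..m1, (deriv χ t ^ 2 * qA U t +
      2 * χ t * deriv χ t * (qA U t - qB U t)) = 0 := by
      rw [intervalIntegral.integral_congr (g := fun _ => 0)]
      · simp
      · intro t ht
        rw [uIcc_of_le ham1] at ht
        simp [deriv_zero_of hχ hχ1 ht.2]
    rw [hz, hχ2 m2 le_rfl, hχ1 a ham1] at hI
    obtain ⟨b1, b2⟩ := qVV_small h hm haT (fun θ => ha1 (a, θ) haa1)
    have b3 : 0 ≤ qB U a := cI_nonneg fun θ => sq_nonneg _
    have b4 := abs_le.1 b1
    linarith [b4.1, b4.2]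
  have hlim : Tendsto (fun δ : ℝ => X + 2 * π * (2 * m + δ) ^ 2 + 2 * π * ((2 * m + δ) * δ) + δ)
      (𝓝[>] 0) (𝓝 (X + 2 * π * (2 * m + 0) ^ 2 + 2 * π * ((2 * m + 0) * 0) + 0)) := by
    apply Tendsto.mono_left _ nhdsWithin_le_nhds
    apply Continuous.tendsto (f := fun δ : ℝ => X + 2 * π * (2 * m + δ) ^ 2 + 2 * π * ((2 * m + δ) * δ) + δ)
    fun_prop
  have := ge_of_tendsto hlim (b := 0) (by
    filter_upwards [self_mem_nhdsWithin] with δ hδ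
    linarith [key δ hδ])
  linarith

def F1 (s : ℝ) : ℝ := exp s / (1 + exp s) ^ 2

lemma F1_contDiff : ContDiff ℝ (⊤ : ℕ∞) F1 := by
  unfold F1
  apply ContDiff.div
  · fun_prop
  · fun_prop
  · intro x; positivity

lemma F1_hasDerivAt (t : ℝ) : HasDerivAt F1 (fτ 1 t) t := by
  have h1 := Real.hasDerivAt_exp t
  have hne : (1 + exp t) ^ 2 ≠ 0 := by positivity
  have := h1.div ((h1.const_add 1).pow 2) hne
  refine this.congr_deriv ?_
  have hp : 0 < exp t := exp_pos t
  unfold fτ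
  simp only [Pi.pow_apply]
  generalize exp t = x at *
  have : 0 < 1 + x := by positivity
  field_simp
  ring

def qH (E : ℝ) (U : ℝ × ℝ → ℝ) (t : ℝ) : ℝ := E * exp (2 * t) * cI (fun z => F1 (U z)) t

lemma qH_hasDerivAt (h : Sm T U) {t : ℝ} (ht : t < T) :
    HasDerivAt (qH E U) (2 * qH E U t + qgV 1 E U t) t := by
  have h1 : HasDerivAt (cI (fun z => F1 (U z))) (cI (fun z => fτ 1 (U z) * Dt U z) t) t := by
    apply cI_hasDerivAt' (h.comp F1_contDiff) ht
    intro θ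
    exact (F1_hasDerivAt (U (t, θ))).comp t (h.ht ht θ)
  have g1 : HasDerivAt (fun t : ℝ => exp (2 * t)) (exp (2 * t) * (2 * 1)) t :=
      ((hasDerivAt_id t).const_mul 2).exp
  refine ((g1.const_mul E).mul h1).congr_deriv ?_
  have : qgV 1 E U t = E * exp (2 * t) * cI (fun z => fτ 1 (U z) * Dt U z) t := by
    unfold qgV
    rw [← cI_cmul]
    apply cI_congr; intro θ; simp only; ring
  rw [this]; unfold qH; ring

lemma qH_nonneg (hE : 0 < E) (t : ℝ) : 0 ≤ qH E U t := by
  unfold qH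
  have : 0 ≤ cI (fun z => F1 (U z)) t := cI_nonneg fun θ => by unfold F1; positivity
  positivity

lemma qH_cont (h : Sm T U) : ContinuousOn (qH E U) (Iio T) := by
  unfold qH
  have := cI_contOn (h.comp F1_contDiff).contOn
  fun_prop

lemma stab2 (hE : 0 < E) (hm : 0 ≤ m) (h : CylSol 1 m E T Λ cf U) (hS : StabC 1 E T U)
    {χ : ℝ → ℝ} (hχ : ContDiff ℝ (⊤ : ℕ∞) χ) {m1 m2 : ℝ} (h12 : m1 < m2) (h2T : m2 < T)
    (hχ1 : ∀ t ≤ m1, χ t = 1) (hχ2 : ∀ t ≥ m2, χ t = 0) {tb : ℝ} (htb : tb + 1 ≤ m1) :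
    4 * ∫ t in tb..(tb + 1), qH E U t ≤ ∫ t in m1..m2, (deriv χ t ^ 2 * qA U t -
      4 * χ t * deriv χ t * qH E U t) := by
  have hτ : (0:ℝ) < 1 := one_pos
  set X := ∫ t in m1..m2, (deriv χ t ^ 2 * qA U t - 4 * χ t * deriv χ t * qH E U t) with hX
  obtain ⟨c1, c2, c3, c4, c5⟩ := cont_q hτ h
  have c6 := qH_cont (E := E) h.sm
  have hχc := hχ.continuous.continuousOn (s := Iio T)
  have hχ' : ContinuousOn (deriv χ) (Iio T) := (hχ.continuous_deriv (by simp)).continuousOn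
  have hχd : ∀ t, HasDerivAt χ (deriv χ t) t := fun t =>
    ((hχ.differentiable (by simp)) t).hasDerivAt
  have key : ∀ δ > 0, -δ ≤ X - 4 * (∫ t in tb..(tb + 1), qH E U t) + 2 * π * ((2 * m + δ) * δ) := by
    intro δ hδ
    obtain ⟨a1, ha1⟩ := h.asy δ hδ
    obtain ⟨a2, ha2⟩ := hS χ m1 m2 hχ h12 h2T hχ1 hχ2 δ hδ
    set a := min (min a1 a2) tb with ha
    have haa1 : a ≤ a1 := (min_le_left _ _).trans (min_le_left _ _)
    have haa2 : a ≤ a2 := (min_le_left _ _).trans (min_le_right _ _)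
    have hatb : a ≤ tb := min_le_right _ _
    have ham1 : a ≤ m1 := by linarith
    have haT : a < T := by linarith
    have hst := ha2 a haa2 (by linarith)
    have hQ : ∀ t < T, HasDerivAt (fun t => χ t ^ 2 * (qVV U t + 2 * qH E U t))
        (cI (dens 1 E χ U) t - (deriv χ t ^ 2 * qA U t - 4 * χ t * deriv χ t * qH E U t)
          + 4 * (χ t ^ 2 * qH E U t)) t := by
      intro t ht
      have := ((hχd t).pow 2).mul ((qVV_hasDerivAt h.sm ht).add
        ((qH_hasDerivAt (E := E) h.sm ht).const_mul 2))
      refine this.congr_deriv ?_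
      rw [cI_dens hτ h hχ ht]
      simp only [Pi.add_apply, Pi.pow_apply]
      push_cast
      ring
    have hcd := cont_dens hτ h hχ
    have hcX : ContinuousOn (fun t => deriv χ t ^ 2 * qA U t -
      4 * χ t * deriv χ t * qH E U t) (Iio T) := by fun_prop
    have hcY : ContinuousOn (fun t => χ t ^ 2 * qH E U t) (Iio T) := by fun_prop
    have hI := ftc hQ ((hcd.sub hcX).add (continuousOn_const.mul hcY)) (by linarith : a ≤ m2) h2T
    have j1 := sm_int_t hcd (by linarith : a ≤ m2) h2T
    have j2 := sm_int_t hcX (by linarith : a ≤ m2) h2T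
    have j3 := sm_int_t hcY (by linarith : a ≤ m2) h2T
    rw [intervalIntegral.integral_add (j1.sub j2) (j3.const_mul 4),
      intervalIntegral.integral_sub j1 j2, intervalIntegral.integral_const_mul,
      ← intervalIntegral.integral_add_adjacent_intervals (b := m1)
        (sm_int_t hcX ham1 (by linarith)) (sm_int_t hcX h12.le h2T)] at hI
    have hz : ∫ t in a..m1, (deriv χ t ^ 2 * qA U t -
      4 * χ t * deriv χ t * qH E U t) = 0 := by
      rw [intervalIntegral.integral_congr (g := fun _ => 0)]
      · simp
      · intro t ht
        rw [uIcc_of_le ham1] at ht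
        simp [deriv_zero_of hχ hχ1 ht.2]
    have hmono : ∫ t in tb..(tb + 1), χ t ^ 2 * qH E U t ≤ ∫ t in a..m2, χ t ^ 2 * qH E U t := by
      apply intervalIntegral.integral_mono_interval hatb (by linarith) (by linarith) _ j3
      exact Eventually.of_forall fun t => mul_nonneg (sq_nonneg _) (qH_nonneg hE t)
    have heq : ∫ t in tb..(tb + 1), χ t ^ 2 * qH E U t = ∫ t in tb..(tb + 1), qH E U t := by
      apply intervalIntegral.integral_congr
      intro t ht
      rw [uIcc_of_le (by linarith)] at ht
      simp [hχ1 t (ht.2.trans htb)]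
    rw [hz, hχ2 m2 le_rfl, hχ1 a ham1] at hI
    obtain ⟨b1, b2⟩ := qVV_small h hm haT (fun θ => ha1 (a, θ) haa1)
    have b3 := qH_nonneg (U := U) hE a
    have b4 := abs_le.1 b1
    linarith [b4.1, b4.2]
  have hlim : Tendsto (fun δ : ℝ => X - 4 * (∫ t in tb..(tb + 1), qH E U t) + 2 * π * ((2 * m + δ) * δ) + δ)
      (𝓝[>] 0) (𝓝 (X - 4 * (∫ t in tb..(tb + 1), qH E U t) + 2 * π * ((2 * m + 0) * 0) + 0)) := by
    apply Tendsto.mono_left _ nhdsWithin_le_nhds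
    apply Continuous.tendsto (f := fun δ : ℝ => X - 4 * (∫ t in tb..(tb + 1), qH E U t) + 2 * π * ((2 * m + δ) * δ) + δ)
    fun_prop
  have := ge_of_tendsto hlim (b := 0) (by
    filter_upwards [self_mem_nhdsWithin] with δ hδ
    linarith [key δ hδ])
  linarith
end

section
variable {τ m E T Λ : ℝ} {cf : ℝ → ℝ} {U : ℝ × ℝ → ℝ}

lemma Dt_neg (U : ℝ × ℝ → ℝ) : Dt (fun z => - U z) = fun z => - Dt U z := by
  funext z; simp [Dt, fderiv_fun_neg]
lemma Dh_neg (U : ℝ × ℝ → ℝ) : Dh (fun z => - U z) = fun z => - Dh U z := by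
  funext z; simp [Dh, fderiv_fun_neg]

/-- interpolation slope -/
def slp (U : ℝ × ℝ → ℝ) (a b : ℝ) : ℝ := (avg U b - avg U a) / (b - a)
def linI (U : ℝ × ℝ → ℝ) (a b t : ℝ) : ℝ := avg U a + slp U a b * (t - a)

lemma linI_left (U : ℝ × ℝ → ℝ) (a b : ℝ) : linI U a b a = avg U a := by simp [linI]
lemma linI_right (U : ℝ × ℝ → ℝ) {a b : ℝ} (h : a < b) : linI U a b b = avg U b := by
  have : b - a ≠ 0 := by linarith
  unfold linI slp; field_simp; ring

lemma linI_hasDerivAt (U : ℝ × ℝ → ℝ) (a b t : ℝ) : HasDerivAt (linI U a b) (slp U a b) t := by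
  unfold linI
  exact ((((hasDerivAt_id t).sub_const a).const_mul (slp U a b)).const_add (avg U a)).congr_deriv (by simp)

lemma lin_lower (hE : 0 < E) (hτ : 0 < τ) (h : CylSol τ m E T Λ cf U) {a b C : ℝ} (hab : a < b) (hb : b < T)
    (ga : Good U C a) (gb : Good U C b) (hneg : ∀ z : ℝ × ℝ, a ≤ z.1 → z.1 < T → U z ≤ 0) :
    ∀ t θ, a ≤ t → t ≤ b → linI U a b t - C ≤ U (t, θ) := by
  intro t θ h1 h2
  have := max_principle (T := T) (a := a) (b := b) (U := fun z => - U z) h.sm.neg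
    (fun t θ => by simp only [h.per t θ]) hb (α := fun t => - (linI U a b t) + C)
    (α1 := fun _ => - slp U a b) (α2 := fun _ => 0)
    (fun t => ((linI_hasDerivAt U a b t).neg).add_const C) (fun t => hasDerivAt_const t _)
    (by
      intro t θ h1 h2 _
      simp only [Dt_neg, Dh_neg]
      have := h.pde (t, θ) (by simp; linarith)
      have h3 := fτ_nonneg hτ (hneg (t, θ) h1.le (by simp; linarith))
      have h4 : 0 ≤ E * exp (2 * t) * fτ τ (U (t, θ)) := by positivity
      simp only at this
      linarith)
    (fun θ => by
      have := (abs_le.1 (ga θ)).1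
      simp only [linI_left]; linarith)
    (fun θ => by
      have := (abs_le.1 (gb θ)).1
      simp only [linI_right U hab]; linarith) t θ h1 h2
  linarith

lemma lin_upper (h : CylSol τ m E T Λ cf U) {a b C δ : ℝ} (hab : a < b) (hb : b < T)
    (ga : Good U C a) (gb : Good U C b)
    (hg : ∀ t θ, a ≤ t → t ≤ b → E * exp (2 * t) * fτ τ (U (t, θ)) ≤ δ) :
    ∀ t θ, a ≤ t → t ≤ b → U (t, θ) ≤ linI U a b t + C + δ / 2 * ((t - a) * (b - t)) := by
  intro t θ h1 h2
  refine max_principle (T := T) (a := a) (b := b) h.sm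
    h.per hb (α := fun t => (linI U a b t + C) + δ / 2 * ((t - a) * (b - t)))
    (α1 := fun t => slp U a b + δ / 2 * (a + b - 2 * t)) (α2 := fun _ => -δ)
    (fun t => ?_) (fun t => ?_) ?_ ?_ ?_ t θ h1 h2
  · refine (((linI_hasDerivAt U a b t).add_const C).add
      ((((hasDerivAt_id t).sub_const a).mul ((hasDerivAt_id t).const_sub b)).const_mul (δ / 2))).congr_deriv ?_
    simp; left; ring
  · refine ((((hasDerivAt_id t).const_mul 2).const_sub (a + b)).const_mul (δ / 2)).const_add (slp U a b) |>.congr_deriv ?_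
    simp
  · intro t θ h1 h2 _
    have := h.pde (t, θ) (by simp; linarith)
    have := hg t θ h1.le h2.le
    simp only at *
    linarith
  · intro θ
    have := (abs_le.1 (ga θ)).2
    simp only [linI_left, sub_self, zero_mul, mul_zero, add_zero]; linarith
  · intro θ
    have := (abs_le.1 (gb θ)).2
    simp only [linI_right U hab, sub_self, mul_zero, add_zero]; linarith

lemma mid_energy (hE : 0 < E) (hτ : 0 < τ) (h : CylSol τ m E T Λ cf U) {a b C δ : ℝ} (hC : 0 ≤ C) (hab : a < b)
    (hb : b < T)
    (ga : Good U C a) (gb : Good U C b) (hneg : ∀ z : ℝ × ℝ, a ≤ z.1 → z.1 < T → U z ≤ 0)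
    (hg : ∀ t θ, a ≤ t → t ≤ b → E * exp (2 * t) * fτ τ (U (t, θ)) ≤ δ) (hδ : δ * (b - a) ^ 2 ≤ 1)
    (hD : ∀ t θ, a ≤ t → t ≤ b → |U (t, θ) - linI U a b t| ≤ C + 1) (hh : 1 ≤ b - a) :
    ∫ t in (a + (b - a) / 4)..(b - (b - a) / 4),
      (cI (fun z => (Dt U z - slp U a b) ^ 2) t + qB U t) ≤ (8 / 3) * (4 * π * C ^ 2 + π * (C + 1)) := by
  set s := slp U a b with hs
  set D : ℝ × ℝ → ℝ := fun z => U z - linI U a b z.1 with hDd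
  have hlin : ContDiff ℝ (⊤ : ℕ∞) (linI U a b) := by unfold linI; fun_prop
  have sD : Sm T D := h.sm.sub (Sm.of_t T hlin)
  have sV : Sm T (fun z => Dt U z - s) := h.sm.dt.sub (Sm.const T s)
  have dD : ∀ t < T, ∀ θ, HasDerivAt (fun r => D (r, θ)) (Dt U (t, θ) - s) t := fun t ht θ =>
    (h.sm.ht ht θ).sub (linI_hasDerivAt U a b t)
  have dDh : ∀ t < T, ∀ θ, HasDerivAt (fun r => D (t, r)) (Dh U (t, θ)) θ := fun t ht θ =>
    (h.sm.hh ht θ).sub_const (linI U a b t)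
  set y := cI (fun z => D z ^ 2) with hy
  set y1 := cI (fun z => 2 * D z * (Dt U z - s)) with hy1
  set y2 := cI (fun z => 2 * (Dt U z - s) ^ 2 + 2 * D z * Dt (Dt U) z) with hy2
  set Q : ℝ → ℝ := fun t => cI (fun z => (Dt U z - s) ^ 2) t + qB U t with hQ
  have k := fun c => Sm.const T c
  have sy1 : Sm T (fun z => 2 * D z * (Dt U z - s)) := ((k 2).mul sD).mul sV
  have sy2 : Sm T (fun z => 2 * (Dt U z - s) ^ 2 + 2 * D z * Dt (Dt U) z) :=
    ((k 2).mul (sV.pow 2)).add (((k 2).mul sD).mul h.sm.dt.dt)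
  have dy : ∀ t < T, HasDerivAt y (y1 t) t := by
    intro t ht
    apply cI_hasDerivAt' (sD.pow 2) ht
    intro θ
    exact ((dD t ht θ).pow 2).congr_deriv (by ring)
  have dy1 : ∀ t < T, HasDerivAt y1 (y2 t) t := by
    intro t ht
    apply cI_hasDerivAt' sy1 ht
    intro θ
    exact (((dD t ht θ).const_mul 2).mul ((h.sm.dt.ht ht θ).sub_const s)).congr_deriv (by ring)
  have cQ : ContinuousOn Q (Iio T) := (cI_contOn (sV.pow 2).contOn).add (cI_contOn (h.sm.dh.pow 2).contOn)
  have cy : ContinuousOn y (Iio T) := cI_contOn (sD.pow 2).contOn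
  have cy2 : ContinuousOn y2 (Iio T) := cI_contOn sy2.contOn
  have hQ0 : ∀ t, 0 ≤ Q t := fun t => add_nonneg (cI_nonneg fun θ => by positivity) (cI_nonneg fun θ => by positivity)
  have hy0 : ∀ t, 0 ≤ y t := fun t => cI_nonneg fun θ => by positivity
  have hy2l : ∀ t, a ≤ t → t ≤ b → 2 * Q t - 4 * π * (δ * (C + 1)) ≤ y2 t := by
    intro t h1 h2
    have ht : t < T := by linarith
    have e0 : cI (fun z => D z * Dh (Dh U) z + Dh U z ^ 2) t = 0 := by
      apply cI_dh' (sD.mul h.sm.dh) (Φ := fun z => D z * Dh U z)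
        (fun a b => by simp only [hDd, h.per a b, h.per.dh a b]) ht
      intro θ
      exact ((dDh t ht θ).mul (h.sm.dh.hh ht θ)).congr_deriv (by ring)
    have e1 : y2 t = cI (fun z => (2 * ((Dt U z - s) ^ 2) + 2 * (Dh U z ^ 2))
       - (2 * (E * exp (2 * z.1) * fτ τ (U z) * D z) + 2 * (D z * Dh (Dh U) z + Dh U z ^ 2))) t := by
      apply cI_congr
      intro θ
      have := h.pde (t, θ) ht
      have e : Dt (Dt U) (t, θ) = - (E * exp (2 * t) * fτ τ (U (t, θ))) - Dh (Dh U) (t, θ) := by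
        simp only at this; linarith
      simp only [e]; ring
    have sg := (h.sm.g (E := E) hτ).mul sD
    have s3 := (sD.mul h.sm.dh.dh).add (h.sm.dh.pow 2)
    rw [e1, cI_sub (T := T) (((k 2).mul (sV.pow 2)).add ((k 2).mul (h.sm.dh.pow 2))).contOn
      (((k 2).mul sg).add ((k 2).mul s3)).contOn ht,
      cI_add (T := T) ((k 2).mul (sV.pow 2)).contOn ((k 2).mul (h.sm.dh.pow 2)).contOn ht,
      cI_add (T := T) ((k 2).mul sg).contOn ((k 2).mul s3).contOn ht, cI_cmul, cI_cmul, cI_cmul, cI_cmul, e0]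
    have : cI (fun z => E * exp (2 * z.1) * fτ τ (U z) * D z) t ≤ 2 * π * (δ * (C + 1)) := by
      apply cI_le sg.contOn ht
      intro θ
      have g1 := hg t θ h1 h2
      have g0 := fτ_nonneg hτ (hneg (t, θ) h1 ht)
      have g2 : 0 ≤ E * exp (2 * t) * fτ τ (U (t, θ)) := by positivity
      have d1 := (abs_le.1 (hD t θ h1 h2)).2
      simp only [hDd]
      exact (mul_le_mul_of_nonneg_left d1 g2).trans (mul_le_mul_of_nonneg_right g1 (by linarith))
    simp only [hQ, qB]
    linarith
  have hΨ : ∀ t < T, HasDerivAt (fun t => (t - a) * (b - t) * y1 t - (a + b - 2 * t) * y t)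
      ((t - a) * (b - t) * y2 t + 2 * y t) t := by
    intro t ht
    refine (((((hasDerivAt_id t).sub_const a).mul ((hasDerivAt_id t).const_sub b)).mul (dy1 t ht)).sub
      ((((hasDerivAt_id t).const_mul 2).const_sub (a + b)).mul (dy t ht))).congr_deriv ?_
    simp; ring
  have hI := ftc hΨ (by fun_prop) hab.le hb
  have hya : ∀ t < T, (Good U C t) → linI U a b t = avg U t → y t ≤ 2 * π * C ^ 2 := by
    intro t ht hg e
    apply cI_le (sD.pow 2).contOn ht
    intro θ
    simp only [hDd, e]
    exact sq_le_sq' (by have := (abs_le.1 (hg θ)).1; linarith) (abs_le.1 (hg θ)).2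
  have ya := hya a (by linarith) ga (linI_left U a b)
  have yb := hya b hb gb (linI_right U hab)
  have hI2 : ∫ t in a..b, (2 * ((t - a) * (b - t)) * Q t - π * (C + 1)) ≤ (b - a) * (4 * π * C ^ 2) := by
    have := intervalIntegral.integral_mono_on (μ := volume) hab.le
      (f := fun t => 2 * ((t - a) * (b - t)) * Q t - π * (C + 1))
      (g := fun t => (t - a) * (b - t) * y2 t + 2 * y t)
      (sm_int_t (T := T) (by fun_prop) hab.le hb) (sm_int_t (T := T) (by fun_prop) hab.le hb) (by
        intro t ht
        have p0 : 0 ≤ (t - a) * (b - t) := mul_nonneg (by linarith [ht.1]) (by linarith [ht.2])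
        have p1 : (t - a) * (b - t) ≤ (b - a) ^ 2 / 4 := by nlinarith [sq_nonneg (a + b - 2 * t)]
        have hd0 : 0 ≤ δ := by
          have g0 := fτ_nonneg hτ (hneg (t, 0) ht.1 (by simp; linarith [ht.2]))
          have g2 : 0 ≤ E * exp (2 * t) * fτ τ (U (t, 0)) := by positivity
          exact g2.trans (hg t 0 ht.1 ht.2)
        have h1 := mul_le_mul_of_nonneg_left (hy2l t ht.1 ht.2) p0
        have h2 : (t - a) * (b - t) * (4 * π * (δ * (C + 1))) ≤ π * (C + 1) := by
          calc (t - a) * (b - t) * (4 * π * (δ * (C + 1))) ≤ (b - a) ^ 2 / 4 * (4 * π * (δ * (C + 1))) :=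
                mul_le_mul_of_nonneg_right p1 (by positivity)
            _ = π * (C + 1) * (δ * (b - a) ^ 2) := by ring
            _ ≤ π * (C + 1) * 1 := mul_le_mul_of_nonneg_left hδ (by positivity)
            _ = _ := by ring
        have := hy0 t
        nlinarith)
    rw [hI] at this
    refine this.trans ?_
    simp only [sub_self, zero_mul, mul_zero]
    nlinarith
  rw [intervalIntegral.integral_sub (sm_int_t (T := T) (by fun_prop) hab.le hb) (by simp)] at hI2
  simp only [intervalIntegral.integral_const, smul_eq_mul] at hI2
  set m1 := a + (b - a) / 4 with hm1
  set m2 := b - (b - a) / 4 with hm2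
  have h12 : m1 ≤ m2 := by simp only [hm1, hm2]; linarith
  have ham : a ≤ m1 := by simp only [hm1]; linarith
  have hmb : m2 ≤ b := by simp only [hm2]; linarith
  have hI3 : ∫ t in m1..m2, (3 / 8) * (b - a) ^ 2 * Q t ≤ ∫ t in a..b, 2 * ((t - a) * (b - t)) * Q t := by
    refine (intervalIntegral.integral_mono_on (μ := volume) h12 (g := fun t => 2 * ((t - a) * (b - t)) * Q t)
      (sm_int_t (T := T) (by fun_prop) h12 (by linarith))
      (sm_int_t (T := T) (by fun_prop) h12 (by linarith)) ?_).trans ?_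
    · intro t ht
      apply mul_le_mul_of_nonneg_right _ (hQ0 t)
      have h1 : 0 ≤ t - a - (b - a) / 4 := by have := ht.1; simp only [hm1] at this; linarith
      have h2 : 0 ≤ b - t - (b - a) / 4 := by have := ht.2; simp only [hm2] at this; linarith
      nlinarith [mul_nonneg h1 h2]
    · apply intervalIntegral.integral_mono_interval ham h12 hmb
      · refine (ae_restrict_iff' measurableSet_Ioc).2 (Eventually.of_forall fun t ht => ?_)
        have := hQ0 t
        have p0 : 0 ≤ (t - a) * (b - t) := mul_nonneg (by linarith [ht.1]) (by linarith [ht.2])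
        simp only [Pi.zero_apply]; positivity
      · exact sm_int_t (T := T) (by fun_prop) hab.le hb
  rw [intervalIntegral.integral_const_mul] at hI3
  have hI0 : 0 ≤ ∫ t in m1..m2, Q t := intervalIntegral.integral_nonneg h12 fun t _ => hQ0 t
  set X := ∫ t in m1..m2, Q t with hX
  have hX1 : (b - a) * ((3 / 8) * (b - a) * X) ≤ (b - a) * (4 * π * C ^ 2 + π * (C + 1)) := by nlinarith
  have hX2 := le_of_mul_le_mul_left hX1 (by linarith)
  have : X ≤ (b - a) * X := by nlinarith
  linarith

end

lemma exists_chi : ∃ K : ℝ, 0 < K ∧ ∀ m1 m2 : ℝ, m1 < m2 → ∃ χ : ℝ → ℝ, ContDiff ℝ (⊤ : ℕ∞) χ ∧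
    (∀ t ≤ m1, χ t = 1) ∧ (∀ t ≥ m2, χ t = 0) ∧ (∀ t, 0 ≤ χ t ∧ χ t ≤ 1) ∧ (∀ t, deriv χ t ≤ 0) ∧
    ∀ t, |deriv χ t| ≤ K / (m2 - m1) := by
  have hsm : ContDiff ℝ (⊤ : ℕ∞) smoothTransition := smoothTransition.contDiff
  have hd : ∀ x, HasDerivAt smoothTransition (deriv smoothTransition x) x := fun x =>
    ((hsm.differentiable (by simp)) x).hasDerivAt
  have hc : Continuous (deriv smoothTransition) := hsm.continuous_deriv (by simp)
  obtain ⟨C, hC⟩ := isCompact_Icc.exists_bound_of_continuousOn (s := Icc (0:ℝ) 1) hc.continuousOn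
  have hb : ∀ x, |deriv smoothTransition x| ≤ |C| + 1 := by
    intro x
    by_cases hx : x ∈ Icc (0:ℝ) 1
    · exact (hC x hx).trans (by linarith [le_abs_self C])
    · have : deriv smoothTransition x = 0 := by
        rcases not_and_or.1 hx with h | h
        · push Not at h
          have : smoothTransition =ᶠ[𝓝 x] fun _ => 0 := by
            filter_upwards [Iio_mem_nhds h] with y hy using smoothTransition.zero_of_nonpos (le_of_lt hy)
          rw [this.deriv_eq]; simp
        · push Not at h
          have : smoothTransition =ᶠ[𝓝 x] fun _ => 1 := by
            filter_upwards [Ioi_mem_nhds h] with y hy using smoothTransition.one_of_one_le (le_of_lt hy)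
          rw [this.deriv_eq]; simp
      rw [this]; simp; positivity
  refine ⟨|C| + 1, by positivity, ?_⟩
  intro m1 m2 h12
  have hp : 0 < m2 - m1 := by linarith
  have hder : ∀ t, HasDerivAt (fun t => smoothTransition ((m2 - t) / (m2 - m1)))
      (- deriv smoothTransition ((m2 - t) / (m2 - m1)) / (m2 - m1)) t := by
    intro t
    refine ((hd _).comp t (((hasDerivAt_id t).const_sub m2).div_const (m2 - m1))).congr_deriv ?_
    simp only [id]; ring
  refine ⟨fun t => smoothTransition ((m2 - t) / (m2 - m1)), ?_, ?_, ?_, ?_, ?_, ?_⟩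
  · exact hsm.comp (by fun_prop)
  · intro t ht
    exact smoothTransition.one_of_one_le (by rw [le_div_iff₀ hp]; linarith)
  · intro t ht
    exact smoothTransition.zero_of_nonpos (div_nonpos_of_nonpos_of_nonneg (by linarith) hp.le)
  · exact fun t => ⟨smoothTransition.nonneg _, smoothTransition.le_one _⟩
  · intro t
    rw [(hder t).deriv]
    have : 0 ≤ deriv smoothTransition ((m2 - t) / (m2 - m1)) := smoothTransition.monotone.deriv_nonneg
    exact div_nonpos_of_nonpos_of_nonneg (by linarith) hp.le
  · intro t
    rw [(hder t).deriv, abs_div, abs_neg, abs_of_pos hp]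
    exact div_le_div_of_nonneg_right (hb _) hp.le

section
variable {τ m E T Λ : ℝ} {cf : ℝ → ℝ} {U : ℝ × ℝ → ℝ}

lemma qA_le (h : Sm T U) {t s L : ℝ} (ht : t < T) (hs : |s| ≤ L) :
    qA U t ≤ 2 * cI (fun z => (Dt U z - s) ^ 2) t + 4 * π * L ^ 2 := by
  have sV : Sm T (fun z => Dt U z - s) := h.dt.sub (Sm.const T s)
  have : qA U t ≤ cI (fun z => 2 * (Dt U z - s) ^ 2 + 2 * L ^ 2) t := by
    apply cI_mono (h.dt.pow 2).contOn (((Sm.const T 2).mul (sV.pow 2)).add (Sm.const T (2 * L ^ 2))).contOn ht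
    intro θ
    have : s ^ 2 ≤ L ^ 2 := sq_le_sq' (by linarith [(abs_le.1 hs).1]) (abs_le.1 hs).2
    nlinarith [sq_nonneg (Dt U (t, θ) - 2 * s)]
  rw [cI_add (T := T) ((Sm.const T 2).mul (sV.pow 2)).contOn (Sm.const T (2 * L ^ 2)).contOn ht, cI_cmul,
    cI_const] at this
  linarith

lemma chi_qA (hτ : 0 < τ) (h : CylSol τ m E T Λ cf U) {m1 m2 s L Cm K : ℝ} {χ : ℝ → ℝ}
    (hχ : ContDiff ℝ (⊤ : ℕ∞) χ) (h12 : 1 ≤ m2 - m1) (h2T : m2 < T) (hs : |s| ≤ L) (hK : 0 < K)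
    (hχd : ∀ t, |deriv χ t| ≤ K / (m2 - m1))
    (hQ : ∫ t in m1..m2, (cI (fun z => (Dt U z - s) ^ 2) t + qB U t) ≤ Cm) :
    (∫ t in m1..m2, deriv χ t ^ 2 * qA U t) ≤ K ^ 2 * (2 * Cm + 4 * π * L ^ 2) / (m2 - m1) ∧
    (∫ t in m1..m2, qB U t) ≤ Cm := by
  obtain ⟨c1, c2, c3, c4, c5⟩ := cont_q hτ h
  have hχ' : ContinuousOn (deriv χ) (Iio T) := (hχ.continuous_deriv (by simp)).continuousOn
  have sV : Sm T (fun z => Dt U z - s) := h.sm.dt.sub (Sm.const T s)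
  have cV := cI_contOn (sV.pow 2).contOn
  have h12' : m1 ≤ m2 := by linarith
  have hl : 0 < m2 - m1 := by linarith
  have hB0 : ∀ t, 0 ≤ qB U t := fun t => cI_nonneg fun θ => by positivity
  have hV0 : ∀ t, 0 ≤ cI (fun z => (Dt U z - s) ^ 2) t := fun t => cI_nonneg fun θ => by positivity
  have hA0 : ∀ t, 0 ≤ qA U t := fun t => cI_nonneg fun θ => by positivity
  constructor
  · have h1 : (∫ t in m1..m2, deriv χ t ^ 2 * qA U t) ≤ ∫ t in m1..m2,
        (K / (m2 - m1)) ^ 2 * (2 * (cI (fun z => (Dt U z - s) ^ 2) t + qB U t) + 4 * π * L ^ 2) := by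
      apply intervalIntegral.integral_mono_on (μ := volume) h12'
      · exact sm_int_t (T := T) (by fun_prop) h12' h2T
      · exact sm_int_t (T := T) (by fun_prop) h12' h2T
      · intro t ht
        have := qA_le h.sm (lt_of_le_of_lt ht.2 h2T) hs
        apply mul_le_mul
        · rw [← sq_abs (deriv χ t)]; exact pow_le_pow_left₀ (abs_nonneg _) (hχd t) 2
        · linarith [hB0 t]
        · exact hA0 t
        · positivity
    refine h1.trans ?_
    rw [intervalIntegral.integral_const_mul, intervalIntegral.integral_add (sm_int_t (T := T) (by fun_prop) h12' h2T) (by simp),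
      intervalIntegral.integral_const_mul, intervalIntegral.integral_const, smul_eq_mul]
    have hCm0 : 0 ≤ Cm := le_trans (intervalIntegral.integral_nonneg h12' fun t _ => add_nonneg (hV0 t) (hB0 t)) hQ
    calc (K / (m2 - m1)) ^ 2 * (2 * (∫ t in m1..m2, (cI (fun z => (Dt U z - s) ^ 2) t + qB U t)) + (m2 - m1) * (4 * π * L ^ 2))
        ≤ (K / (m2 - m1)) ^ 2 * ((m2 - m1) * (2 * Cm + 4 * π * L ^ 2)) := by
          apply mul_le_mul_of_nonneg_left _ (by positivity)
          nlinarith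
      _ = _ := by field_simp
  · refine le_trans (intervalIntegral.integral_mono_on (μ := volume) h12' (sm_int_t (T := T) (by fun_prop) h12' h2T)
      (sm_int_t (T := T) (by fun_prop) h12' h2T) fun t _ => ?_) hQ
    linarith [hV0 t]

lemma mid_case1 (hτ : 0 < τ) (hm : 0 ≤ m) (hE : 0 < E) (h : CylSol τ m E T Λ cf U) (hS : StabC τ E T U)
    {C4 κ0 tb : ℝ} (hB : Bub m E T Λ C4 κ0 U tb)
    {m1 m2 s L Cm K : ℝ} {χ : ℝ → ℝ}
    (hχ : ContDiff ℝ (⊤ : ℕ∞) χ) (h12 : 1 ≤ m2 - m1) (h2T : m2 < T) (hs : |s| ≤ L) (hK : 0 < K)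
    (hχ1 : ∀ t ≤ m1, χ t = 1) (hχ2 : ∀ t ≥ m2, χ t = 0) (hχ01 : ∀ t, 0 ≤ χ t ∧ χ t ≤ 1)
    (hχn : ∀ t, deriv χ t ≤ 0)
    (hχd : ∀ t, |deriv χ t| ≤ K / (m2 - m1)) (hbm : tb ≤ m1) (hγ : avg' U m1 ≤ 0)
    (hQ : ∫ t in m1..m2, (cI (fun z => (Dt U z - s) ^ 2) t + qB U t) ≤ Cm) :
    2 * π * avg' U m1 ^ 2 ≤ 8 * π * m ^ 2 + (K ^ 2 * (2 * Cm + 4 * π * L ^ 2) + 2 * K * Cm) / (m2 - m1) := by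
  obtain ⟨q1, q2⟩ := chi_qA hτ h hχ h12 h2T hs hK hχd hQ
  obtain ⟨c1, c2, c3, c4, c5⟩ := cont_q hτ h
  have hχc := hχ.continuous.continuousOn (s := Iio T)
  have hχ' : ContinuousOn (deriv χ) (Iio T) := (hχ.continuous_deriv (by simp)).continuousOn
  have h12' : m1 ≤ m2 := by linarith
  have hl : 0 < m2 - m1 := by linarith
  have hst := stab1 hτ hm h hS hχ (by linarith) h2T hχ1 hχ2
  have hB0 : ∀ t, 0 ≤ qB U t := fun t => cI_nonneg fun θ => by positivity
  have hle : ∫ t in m1..m2, (deriv χ t ^ 2 * qA U t + 2 * χ t * deriv χ t * (qA U t - qB U t)) ≤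
      ∫ t in m1..m2, (deriv χ t ^ 2 * qA U t + (2 * π * avg' U m1 ^ 2 * (2 * χ t * deriv χ t) +
        2 * (K / (m2 - m1)) * qB U t)) := by
    apply intervalIntegral.integral_mono_on (μ := volume) h12'
    · exact sm_int_t (T := T) (by fun_prop) h12' h2T
    · exact sm_int_t (T := T) (by fun_prop) h12' h2T
    · intro t ht
      have htT : t < T := lt_of_le_of_lt ht.2 h2T
      have hanti := avg'_anti hτ hE h hB hbm ht.1 htT
      have h1 : avg' U m1 ^ 2 ≤ avg' U t ^ 2 := by nlinarith
      have h2 : 2 * π * avg' U m1 ^ 2 ≤ qA U t := by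
        have := cI_sq h.sm.dt.contOn htT
        have e : cI (Dt U) t = 2 * π * avg' U t := by unfold avg'; field_simp
        rw [e] at this
        have h3 : 2 * π * (2 * π * avg' U t ^ 2) ≤ 2 * π * qA U t := by unfold qA; linarith
        have h4 := le_of_mul_le_mul_left h3 (by positivity)
        have : 2 * π * avg' U m1 ^ 2 ≤ 2 * π * avg' U t ^ 2 := mul_le_mul_of_nonneg_left h1 (by positivity)
        linarith
      have h3 : 0 ≤ - (2 * χ t * deriv χ t) := by
        have := mul_nonneg (hχ01 t).1 (neg_nonneg.2 (hχn t)); linarith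
      have h4 : - (2 * χ t * deriv χ t) ≤ 2 * (K / (m2 - m1)) := by
        have h5 := hχd t
        rw [abs_of_nonpos (hχn t)] at h5
        have := mul_le_mul (hχ01 t).2 h5 (neg_nonneg.2 (hχn t)) zero_le_one
        linarith
      have h6 := mul_le_mul_of_nonneg_left h2 h3
      have h7 := mul_le_mul_of_nonneg_right h4 (hB0 t)
      linarith
  have hχχ : ∫ t in m1..m2, 2 * χ t * deriv χ t = -1 := by
    have := ftc (T := T) (F := fun t => χ t ^ 2) (q := fun t => 2 * χ t * deriv χ t) (fun t _ => by
      exact ((((hχ.differentiable (by simp)) t).hasDerivAt).pow 2).congr_deriv (by ring)) (by fun_prop) h12' h2T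
    rw [this, hχ1 m1 le_rfl, hχ2 m2 le_rfl]; norm_num
  have hle := hst.trans (add_le_add_right hle (8 * π * m ^ 2))
  rw [intervalIntegral.integral_add (sm_int_t (T := T) (by fun_prop) h12' h2T) (sm_int_t (T := T) (by fun_prop) h12' h2T),
    intervalIntegral.integral_add (sm_int_t (T := T) (by fun_prop) h12' h2T) (sm_int_t (T := T) (by fun_prop) h12' h2T),
    intervalIntegral.integral_const_mul, intervalIntegral.integral_const_mul, hχχ] at hle
  have h8 : 2 * (K / (m2 - m1)) * ∫ t in m1..m2, qB U t ≤ 2 * (K / (m2 - m1)) * Cm :=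
    mul_le_mul_of_nonneg_left q2 (by positivity)
  have e : (K ^ 2 * (2 * Cm + 4 * π * L ^ 2) + 2 * K * Cm) / (m2 - m1) =
    K ^ 2 * (2 * Cm + 4 * π * L ^ 2) / (m2 - m1) + 2 * (K / (m2 - m1)) * Cm := by ring
  rw [e]
  linarith

lemma qH_low (hm : 0 ≤ m) (hΛ : 0 < Λ) (hE : 0 < E) (h : CylSol 1 m E T Λ cf U)
    {C4 κ0 tb : ℝ} (hB : Bub m E T Λ C4 κ0 U tb) (htb : tb + 1 < T) :
    π * (exp (-C4 - Lc m Λ - C1 m Λ) / 4) ≤ ∫ t in tb..(tb + 1), qH E U t := by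
  have hL : 0 ≤ Lc m Λ := by unfold Lc; positivity
  have := S2 one_pos hE hm hΛ h htb (q := qH E U) (qH_cont h.sm) (c0 := 2 * π * (exp (-C4 - Lc m Λ - C1 m Λ) / 4))
    (by positivity) (fun t _ => qH_nonneg hE t) (by
      intro t ht hg
      have htT : t < T := lt_of_le_of_lt ht.2 htb
      have h1 : 2 * π * (exp (-C4 - Lc m Λ - C1 m Λ) / 4) ≤ cI (fun z => F1 (U z)) t := by
        apply le_cI (h.sm.comp F1_contDiff).contOn htT
        intro θ
        have hlip := avg_lip one_pos hE hm h (s := tb) (t := t) (by linarith) htT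
        have h1 : |t - tb| ≤ 1 := by rw [abs_le]; constructor <;> linarith [ht.1, ht.2]
        have h2 : Lc m Λ * |t - tb| ≤ Lc m Λ := by nlinarith
        have h3 := (abs_le.1 hlip).1
        have h4 := (abs_le.1 (hg θ)).1
        have h5 := hB.low
        have h6 : exp (-C4 - Lc m Λ - C1 m Λ) ≤ exp (U (t, θ)) := exp_le_exp.2 (by linarith)
        have h7 : exp (U (t, θ)) ≤ 1 := exp_le_one_iff.2 (hB.nonpos (t, θ) ht.1 htT)
        have h8 := exp_pos (U (t, θ))
        unfold F1
        apply div_le_div₀ h8.le h6 (by positivity)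
        nlinarith
      have h2 : 1 ≤ E * exp (2 * t) := hB.one.trans (by
        apply mul_le_mul_of_nonneg_left _ hE.le
        exact exp_le_exp.2 (by linarith [ht.1]))
      have h3 : 0 ≤ 2 * π * (exp (-C4 - Lc m Λ - C1 m Λ) / 4) := by positivity
      unfold qH
      nlinarith)
  linarith

lemma mid_case2 (hm : 0 ≤ m) (hE : 0 < E) (h : CylSol 1 m E T Λ cf U) (hS : StabC 1 E T U)
    {tb m1 m2 s L Cm K δ : ℝ} {χ : ℝ → ℝ}
    (hχ : ContDiff ℝ (⊤ : ℕ∞) χ) (h12 : 1 ≤ m2 - m1) (h2T : m2 < T) (hs : |s| ≤ L) (hK : 0 < K)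
    (hχ1 : ∀ t ≤ m1, χ t = 1) (hχ2 : ∀ t ≥ m2, χ t = 0) (hχ01 : ∀ t, 0 ≤ χ t ∧ χ t ≤ 1)
    (hχn : ∀ t, deriv χ t ≤ 0)
    (hχd : ∀ t, |deriv χ t| ≤ K / (m2 - m1)) (hbm : tb + 1 ≤ m1)
    (hg : ∀ t θ, m1 ≤ t → t ≤ m2 → E * exp (2 * t) * exp (U (t, θ)) ≤ δ) (hδ : δ * (m2 - m1) ≤ 1)
    (hQ : ∫ t in m1..m2, (cI (fun z => (Dt U z - s) ^ 2) t + qB U t) ≤ Cm) :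
    4 * ∫ t in tb..(tb + 1), qH E U t ≤ (K ^ 2 * (2 * Cm + 4 * π * L ^ 2) + 8 * π * K) / (m2 - m1) := by
  obtain ⟨q1, q2⟩ := chi_qA one_pos h hχ h12 h2T hs hK hχd hQ
  obtain ⟨c1, c2, c3, c4, c5⟩ := cont_q one_pos h
  have cH := qH_cont (E := E) h.sm
  have hχc := hχ.continuous.continuousOn (s := Iio T)
  have hχ' : ContinuousOn (deriv χ) (Iio T) := (hχ.continuous_deriv (by simp)).continuousOn
  have h12' : m1 ≤ m2 := by linarith
  have hl : 0 < m2 - m1 := by linarith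
  refine (stab2 hE hm h hS hχ (by linarith) h2T hχ1 hχ2 hbm).trans ?_
  have hle : ∫ t in m1..m2, (deriv χ t ^ 2 * qA U t - 4 * χ t * deriv χ t * qH E U t) ≤
      ∫ t in m1..m2, (deriv χ t ^ 2 * qA U t + 4 * (K / (m2 - m1)) * (2 * π * δ)) := by
    apply intervalIntegral.integral_mono_on (μ := volume) h12'
    · exact sm_int_t (T := T) (by fun_prop) h12' h2T
    · exact sm_int_t (T := T) (by fun_prop) h12' h2T
    · intro t ht
      have htT : t < T := lt_of_le_of_lt ht.2 h2T
      have h0 : qH E U t ≤ 2 * π * δ := by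
        have e : qH E U t = cI (fun z => E * exp (2 * z.1) * F1 (U z)) t :=
          (cI_smul (fun t => E * exp (2 * t)) (fun z => F1 (U z)) t).symm
        rw [e]
        apply cI_le _ htT
        · intro θ
          refine le_trans (mul_le_mul_of_nonneg_left ?_ (by positivity)) (hg t θ ht.1 ht.2)
          have h8 := exp_pos (U (t, θ))
          unfold F1
          rw [div_le_iff₀ (by positivity)]
          nlinarith [mul_pos h8 h8, mul_pos h8 (mul_pos h8 h8)]
        · exact ((Sm.of_t T (F := fun t => E * exp (2 * t)) (by fun_prop)).mul (h.sm.comp F1_contDiff)).contOn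
      have h4 : - (χ t * deriv χ t) ≤ K / (m2 - m1) := by
        have h5 := hχd t
        rw [abs_of_nonpos (hχn t)] at h5
        have := mul_le_mul (hχ01 t).2 h5 (neg_nonneg.2 (hχn t)) zero_le_one
        linarith
      have h6 := mul_le_mul h4 h0 (qH_nonneg hE t) (by positivity)
      linarith
  rw [intervalIntegral.integral_add (sm_int_t (T := T) (by fun_prop) h12' h2T) (by simp),
    intervalIntegral.integral_const, smul_eq_mul] at hle
  refine hle.trans ?_
  have e : (K ^ 2 * (2 * Cm + 4 * π * L ^ 2) + 8 * π * K) / (m2 - m1) =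
    K ^ 2 * (2 * Cm + 4 * π * L ^ 2) / (m2 - m1) + 8 * π * K / (m2 - m1) := by ring
  rw [e]
  refine add_le_add q1 ?_
  have : (m2 - m1) * (4 * (K / (m2 - m1)) * (2 * π * δ)) = 8 * π * K / (m2 - m1) * (δ * (m2 - m1)) := by
    field_simp; ring
  rw [this]
  have h9 : 0 ≤ 8 * π * K / (m2 - m1) := by positivity
  nlinarith

end

section
variable {τ m E T Λ : ℝ} {cf : ℝ → ℝ} {U : ℝ × ℝ → ℝ}

set_option maxHeartbeats 2000000 in
theorem lemmaB (hτ : 0 < τ) (hm : 0 ≤ m) (hΛ : 0 < Λ) (T : ℝ) (cf : ℝ → ℝ) {η : ℝ} (hη : 0 < η)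
    (C0 : ℝ) (hc : τ = 1 ∨ m ≤ 1) : ∃ M : ℝ, ∀ᶠ E in atTop, ∀ U, CylSol τ m E T Λ cf U → StabC τ E T U →
      avg U (T - 2) < - log E - M → ∀ θ0, U (log η - log E / 2, θ0) < -C0 := by
  obtain ⟨C4, κ0, hbub⟩ := exists_bub hτ hm hΛ T cf hη C0
  obtain ⟨N, hN0, hfin⟩ := S6 hτ hm hΛ C4
  obtain ⟨K, hK, hchi⟩ := exists_chi
  have hN0' : (0:ℝ) < N := by exact_mod_cast hN0
  set L := Lc m Λ with hL
  have hL0 : 0 ≤ L := by rw [hL]; unfold Lc; positivity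
  set C := C1 m Λ with hC
  have hC0 : 0 ≤ C := C1_nonneg hm hΛ.le
  set Cm := (8 / 3) * (4 * π * C ^ 2 + π * (C + 1)) with hCm
  have hCm0 : 0 ≤ Cm := by positivity
  set K1 := K ^ 2 * (2 * Cm + 4 * π * L ^ 2) + 2 * K * Cm with hK1
  set K2 := K ^ 2 * (2 * Cm + 4 * π * L ^ 2) + 8 * π * K with hK2
  set c5 := π * (exp (-C4 - Lc m Λ - C1 m Λ) / 4) with hc5
  have hc5p : 0 < c5 := by positivity
  have hK10 : 0 ≤ K1 := by positivity
  have hK20 : 0 ≤ K2 := by positivity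
  set N2 : ℝ := 4 + 2 * (K1 * N + K2 / c5) with hN2
  have hN24 : 4 ≤ N2 := by
    have : 0 ≤ K1 * N + K2 / c5 := by positivity
    linarith
  set t0 := T - 2 - N2 with ht0
  set δ' := min 1 (τ ^ 3) / (N2 ^ 2 + 1) with hδ'
  have hmin : 0 < min 1 (τ ^ 3) := lt_min one_pos (by positivity)
  have hδ'0 : 0 < δ' := by positivity
  set g0 := exp (2 * T + cf t0) with hg0
  have hg0p : 0 < g0 := exp_pos _
  set M := 2 * T + L * N2 + C + g0 / τ ^ 3 * N2 ^ 2 - log δ' with hM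
  refine ⟨M, ?_⟩
  filter_upwards [hbub, eventually_gt_atTop 0,
    tendsto_log_atTop.eventually_ge_atTop (2 * (κ0 + N + 1 - t0))] with E hE1 hE hE2
  clear_value N2 Cm K1 K2 c5 M δ' g0 t0
  intro U h hS hav θ0
  by_contra hcon
  push Not at hcon
  obtain ⟨tb, hB⟩ := hE1 U h θ0 hcon
  have htb : tb + N + 1 ≤ t0 := by have := hB.le; linarith
  obtain ⟨a, ha, ga⟩ := S2_exists hτ hE hm hΛ h (a := t0) (by linarith)
  obtain ⟨b, hb, gb⟩ := S2_exists hτ hE hm hΛ h (a := T - 3) (by linarith)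
  have ha1 := ha.1
  have ha2 := ha.2
  have hb1 := hb.1
  have hb2 := hb.2
  have hba : N2 - 2 ≤ b - a := by linarith
  have hba' : b - a ≤ N2 := by linarith
  have hab : a < b := by linarith
  have hbT : b < T := by linarith
  have htba : tb ≤ a := by linarith
  have hneg : ∀ z : ℝ × ℝ, a ≤ z.1 → z.1 < T → U z ≤ 0 := fun z h1 h2 => hB.nonpos z (htba.trans h1) h2
  have hτ3 : 0 < τ ^ 3 := by positivity
  -- crude bound
  have crude : ∀ t θ, a ≤ t → t ≤ b → E * exp (2 * t) * fτ τ (U (t, θ)) ≤ g0 / τ ^ 3 := by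
    intro t θ h1 h2
    have h3 := h.outer t0 (t, θ) (by simp; linarith) (by simp; linarith)
    have h4 := fτ_le_exp (U (t, θ)) hτ
    calc E * exp (2 * t) * fτ τ (U (t, θ)) ≤ E * exp (2 * t) * (exp (U (t, θ)) / τ ^ 3) :=
          mul_le_mul_of_nonneg_left h4 (by positivity)
      _ = exp (log E + 2 * t + U (t, θ)) / τ ^ 3 := by
          rw [exp_add, exp_add, exp_log hE]; ring
      _ ≤ g0 / τ ^ 3 := by
          apply div_le_div_of_nonneg_right _ hτ3.le
          rw [hg0]; exact exp_le_exp.2 (by linarith)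
  have up1 := lin_upper h hab hbT ga gb crude
  have hslp : |slp U a b| ≤ L := by
    have := avg_lip hτ hE hm h (s := a) (t := b) (by linarith) hbT
    unfold slp
    rw [abs_div, div_le_iff₀ (abs_pos.2 (by linarith))]
    exact this
  have hlin : ∀ t, a ≤ t → t ≤ b → linI U a b t ≤ - log E - M + L * N2 := by
    intro t h1 h2
    have e : linI U a b t = avg U b + slp U a b * (t - b) := by
      rw [← linI_right U hab]; unfold linI; ring
    have h3 := avg_lip hτ hE hm h (s := T - 2) (t := b) (by linarith) hbT
    have h4 : |b - (T - 2)| = T - 2 - b := by rw [abs_of_nonpos (by linarith)]; ring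
    rw [h4] at h3
    have h5 := (abs_le.1 h3).2
    have h6 : slp U a b * (t - b) ≤ L * (b - t) := by
      have h8 := (abs_le.1 hslp).1
      have h9 : (- slp U a b) * (b - t) ≤ L * (b - t) := mul_le_mul_of_nonneg_right (by linarith) (by linarith)
      linarith
    have h7 : L * (b - t) + L * (T - 2 - b) ≤ L * N2 := by
      have : L * (T - 2 - t) ≤ L * N2 := mul_le_mul_of_nonneg_left (by linarith) hL0
      linarith
    rw [e]; linarith
  have fine : ∀ t θ, a ≤ t → t ≤ b → E * exp (2 * t) * exp (U (t, θ)) ≤ δ' := by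
    intro t θ h1 h2
    have h3 := up1 t θ h1 h2
    have h4 := hlin t h1 h2
    have h5 : g0 / τ ^ 3 / 2 * ((t - a) * (b - t)) ≤ g0 / τ ^ 3 * N2 ^ 2 := by
      have p1 : (t - a) * (b - t) ≤ N2 * N2 := mul_le_mul (by linarith) (by linarith) (by linarith) (by linarith)
      have p0 : 0 ≤ g0 / τ ^ 3 := by positivity
      have := mul_le_mul_of_nonneg_left p1 p0
      have p2 : 0 ≤ (t - a) * (b - t) := mul_nonneg (by linarith) (by linarith)
      have := mul_nonneg p0 p2
      nlinarith
    have : E * exp (2 * t) * exp (U (t, θ)) = exp (log E + 2 * t + U (t, θ)) := by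
      rw [exp_add, exp_add, exp_log hE]
    rw [this, ← exp_log hδ'0]
    apply exp_le_exp.2
    rw [hM] at h4
    linarith
  set δ := δ' / τ ^ 3 with hδ
  have hgδ : ∀ t θ, a ≤ t → t ≤ b → E * exp (2 * t) * fτ τ (U (t, θ)) ≤ δ := by
    intro t θ h1 h2
    have h4 := fτ_le_exp (U (t, θ)) hτ
    calc E * exp (2 * t) * fτ τ (U (t, θ)) ≤ E * exp (2 * t) * (exp (U (t, θ)) / τ ^ 3) :=
          mul_le_mul_of_nonneg_left h4 (by positivity)
      _ = E * exp (2 * t) * exp (U (t, θ)) / τ ^ 3 := by ring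
      _ ≤ δ := div_le_div_of_nonneg_right (fine t θ h1 h2) hτ3.le
  have hsqN : (b - a) ^ 2 ≤ N2 ^ 2 + 1 := by
    have := pow_le_pow_left₀ (by linarith) hba' 2
    linarith
  have hδ'h : δ' * (b - a) ^ 2 ≤ min 1 (τ ^ 3) := by
    rw [hδ', div_mul_eq_mul_div, div_le_iff₀ (by positivity)]
    exact mul_le_mul_of_nonneg_left hsqN hmin.le
  have hδh : δ * (b - a) ^ 2 ≤ 1 := by
    rw [hδ, div_mul_eq_mul_div, div_le_iff₀ hτ3, one_mul]
    exact hδ'h.trans (min_le_right _ _)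
  have hδ0 : 0 < δ := by positivity
  have up2 := lin_upper h hab hbT ga gb hgδ
  have lo := lin_lower hE hτ h hab hbT ga gb hneg
  have hD : ∀ t θ, a ≤ t → t ≤ b → |U (t, θ) - linI U a b t| ≤ C + 1 := by
    intro t θ h1 h2
    have u := up2 t θ h1 h2
    have l := lo t θ h1 h2
    have p1 : (t - a) * (b - t) ≤ (b - a) ^ 2 := by nlinarith
    have p2 : δ / 2 * ((t - a) * (b - t)) ≤ 1 := by
      have p3 : 0 ≤ (t - a) * (b - t) := mul_nonneg (by linarith) (by linarith)
      nlinarith [mul_le_mul_of_nonneg_left p1 hδ0.le, mul_nonneg hδ0.le p3]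
    rw [abs_le]; constructor <;> linarith
  have hmid := mid_energy hE hτ h hC0 hab hbT ga gb hneg hgδ hδh hD (by linarith)
  rw [← hCm] at hmid
  set m1 := a + (b - a) / 4 with hm1
  set m2 := b - (b - a) / 4 with hm2
  have h21 : m2 - m1 = (b - a) / 2 := by rw [hm1, hm2]; ring
  have h12 : 1 ≤ m2 - m1 := by rw [h21]; linarith
  have h2T : m2 < T := by rw [hm2]; linarith
  have ham1 : a ≤ m1 := by rw [hm1]; linarith
  obtain ⟨χ, hχ, x1, x2, x01, xn, xd⟩ := hchi m1 m2 (by linarith)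
  have hlen : 1 + (K1 * N + K2 / c5) ≤ m2 - m1 := by rw [h21]; linarith
  have hl0 : 0 < m2 - m1 := by linarith
  rcases hc with h1 | h1
  · subst h1
    have hlow := qH_low hm hΛ hE h hB (by linarith)
    rw [← hc5] at hlow
    have hδm : δ' * (m2 - m1) ≤ 1 := by
      have p : m2 - m1 ≤ (b - a) ^ 2 := by rw [h21]; nlinarith
      exact (mul_le_mul_of_nonneg_left p hδ'0.le).trans (hδ'h.trans (min_le_left _ _))
    have := mid_case2 hm hE h hS hχ h12 h2T hslp hK x1 x2 x01 xn xd (tb := tb) (by linarith)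
      (fun t θ p1 p2 => fine t θ (ham1.trans p1) (p2.trans (by rw [hm2]; linarith))) hδm hmid
    rw [← hK2] at this
    have h3 : c5 ≤ K2 / (m2 - m1) := by
      have : 4 * c5 ≤ K2 / (m2 - m1) := (mul_le_mul_of_nonneg_left hlow (by norm_num)).trans this
      linarith
    rw [le_div_iff₀ hl0] at h3
    have h4 : K2 / c5 < m2 - m1 := by
      have : 0 ≤ K1 * N := by positivity
      linarith
    rw [div_lt_iff₀ hc5p] at h4
    linarith
  · apply hfin E T cf U κ0 tb m1 hE h hB (by linarith) (by linarith)
    by_contra hγ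
    push Not at hγ
    have hNi : 0 < 1 / (N:ℝ) := by positivity
    have := mid_case1 hτ hm hE h hS hB hχ h12 h2T hslp hK x1 x2 x01 xn xd (by linarith) (by linarith) hmid
    rw [← hK1] at this
    have h3 : 4 + 4 * (1 / (N:ℝ)) < avg' U m1 ^ 2 := by
      have q : (2 + 1 / (N:ℝ)) ^ 2 < (- avg' U m1) ^ 2 := pow_lt_pow_left₀ hγ (by positivity) (by norm_num)
      have q2 : 0 ≤ (1 / (N:ℝ)) ^ 2 := by positivity
      linarith
    have h4 : K1 / (m2 - m1) ≤ 1 / N := by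
      rw [div_le_div_iff₀ hl0 hN0']
      have : 0 ≤ K2 / c5 := by positivity
      linarith
    have h5 : m ^ 2 ≤ 1 := pow_le_one₀ hm h1
    have h6 : 2 * π * (4 + 4 * (1 / (N:ℝ))) < 2 * π * avg' U m1 ^ 2 :=
      mul_lt_mul_of_pos_left h3 (by positivity)
    have h7 : 8 * π * m ^ 2 ≤ 8 * π * 1 := mul_le_mul_of_nonneg_left h5 (by positivity)
    have h8 : 1 * (1 / (N:ℝ)) ≤ 8 * π * (1 / (N:ℝ)) :=
      mul_le_mul_of_nonneg_right (by linarith [pi_gt_three]) hNi.le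
    linarith

end

/-! ### the torus -/

lemma lat_iff {v : Pl} : v ∈ unitLattice ↔ ∃ a b : ℤ, v 0 = a ∧ v 1 = b := by
  constructor
  · rintro ⟨a, b, rfl⟩
    exact ⟨a, b, by simp, by simp⟩
  · rintro ⟨a, b, h0, h1⟩
    refine ⟨a, b, ?_⟩
    ext i
    fin_cases i
    · simpa using h0
    · simpa using h1

def TLat : AddSubgroup Pl where
  carrier := unitLattice
  add_mem' := by
    intro x y hx hy
    obtain ⟨a, b, h0, h1⟩ := lat_iff.1 hx
    obtain ⟨c, d, h2, h3⟩ := lat_iff.1 hy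
    exact lat_iff.2 ⟨a + c, b + d, by simp [h0, h2], by simp [h1, h3]⟩
  zero_mem' := lat_iff.2 ⟨0, 0, by simp, by simp⟩
  neg_mem' := by
    intro x hx
    obtain ⟨a, b, h0, h1⟩ := lat_iff.1 hx
    exact lat_iff.2 ⟨-a, -b, by simp [h0], by simp [h1]⟩

lemma lat_add {v w : Pl} (hv : v ∈ unitLattice) (hw : w ∈ unitLattice) : v + w ∈ unitLattice :=
  TLat.add_mem hv hw
lemma lat_neg {v : Pl} (hv : v ∈ unitLattice) : -v ∈ unitLattice := TLat.neg_mem hv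
lemma lat_sub {v w : Pl} (hv : v ∈ unitLattice) (hw : w ∈ unitLattice) : v - w ∈ unitLattice :=
  TLat.sub_mem hv hw
lemma lat_zero : (0 : Pl) ∈ unitLattice := TLat.zero_mem

instance : Countable TLat := by
  have : Function.Surjective (fun z : ℤ × ℤ => (⟨(z.1 : ℝ) • EuclideanSpace.single 0 (1:ℝ) +
      (z.2 : ℝ) • EuclideanSpace.single 1 (1:ℝ), ⟨z.1, z.2, rfl⟩⟩ : TLat)) := by
    rintro ⟨v, a, b, h⟩
    exact ⟨(a, b), Subtype.ext h.symm⟩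
  exact this.countable

def tsq (c : Pl) : Set Pl := {x | x 0 - c 0 ∈ Ico (0:ℝ) 1 ∧ x 1 - c 1 ∈ Ico (0:ℝ) 1}

lemma meas_sq (c : Pl) : MeasurableSet (tsq c) := by
  apply MeasurableSet.inter
  · exact measurableSet_Ico.preimage (by fun_prop : Measurable (fun x : Pl => x 0 - c 0))
  · exact measurableSet_Ico.preimage (by fun_prop : Measurable (fun x : Pl => x 1 - c 1))

lemma fund_eq_sq : fund = tsq 0 := by ext x; simp [fund, tsq]

lemma sq_fd (c : Pl) : IsAddFundamentalDomain TLat (tsq c) (volume : Measure Pl) := by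
  refine IsAddFundamentalDomain.mk' (meas_sq c).nullMeasurableSet ?_
  intro x
  refine ⟨⟨-((⌊x 0 - c 0⌋ : ℝ) • EuclideanSpace.single 0 (1:ℝ) +
      (⌊x 1 - c 1⌋ : ℝ) • EuclideanSpace.single 1 (1:ℝ)), lat_neg ⟨_, _, rfl⟩⟩, ?_, ?_⟩
  · have h0 := Int.floor_le (x 0 - c 0)
    have h1 := Int.lt_floor_add_one (x 0 - c 0)
    have h2 := Int.floor_le (x 1 - c 1)
    have h3 := Int.lt_floor_add_one (x 1 - c 1)
    simp only [tsq, AddSubgroup.mk_vadd, vadd_eq_add, mem_ofPred_eq]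
    simp
    refine ⟨⟨?_, ?_⟩, ?_, ?_⟩ <;> linarith
  · rintro ⟨v, hv⟩ h
    obtain ⟨a, b, ha, hb⟩ := lat_iff.1 hv
    simp only [tsq, AddSubgroup.mk_vadd, vadd_eq_add, mem_ofPred_eq] at h
    simp [ha, hb] at h
    have e0 : ⌊x 0 - c 0⌋ = -a := by
      rw [Int.floor_eq_iff]; push_cast; constructor <;> linarith [h.1.1, h.1.2]
    have e1 : ⌊x 1 - c 1⌋ = -b := by
      rw [Int.floor_eq_iff]; push_cast; constructor <;> linarith [h.2.1, h.2.2]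
    apply Subtype.ext
    ext i
    fin_cases i
    · simp [e0, ha]
    · simp [e1, hb]

lemma fund_sq {G : Pl → ℝ} (hG : Periodic2 G) (c : Pl) : ∫ x in fund, G x = ∫ x in tsq c, G x := by
  rw [fund_eq_sq]
  apply (sq_fd 0).setIntegral_eq (sq_fd c)
  rintro ⟨v, hv⟩ x
  have := hG x v hv
  rw [AddSubgroup.mk_vadd, vadd_eq_add, add_comm, this]

lemma abs_coord_le (x : Pl) (i : Fin 2) : |x i| ≤ ‖x‖ := by
  simpa using PiLp.norm_apply_le x i

lemma norm_sq_pl (x : Pl) : ‖x‖ ^ 2 = x 0 ^ 2 + x 1 ^ 2 := by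
  rw [EuclideanSpace.norm_sq_eq]; simp

/-- centre of the square -/
def hf : Pl := !₂[(1/2 : ℝ), 1/2]

lemma ball_sub_sq (p : Pl) {r : ℝ} (hr : r ≤ 1/2) : ball p r ⊆ tsq (p - hf) := by
  intro x hx
  rw [mem_ball, dist_eq_norm] at hx
  have h0 := abs_lt.1 (((abs_coord_le (x - p) 0).trans_lt hx).trans_le hr)
  have h1 := abs_lt.1 (((abs_coord_le (x - p) 1).trans_lt hx).trans_le hr)
  simp at h0 h1
  simp [tsq, hf]
  refine ⟨⟨?_, ?_⟩, ?_, ?_⟩ <;> linarith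

lemma lat_small {v : Pl} (hv : v ∈ unitLattice) (h0 : |v 0| < 1) (h1 : |v 1| < 1) : v = 0 := by
  obtain ⟨a, b, ha, hb⟩ := lat_iff.1 hv
  rw [ha] at h0; rw [hb] at h1
  have ha' : a = 0 := by
    have : |a| < 1 := (Int.cast_lt (R := ℝ)).1 (by push_cast; exact h0)
    exact Int.abs_lt_one_iff.1 this
  have hb' : b = 0 := by
    have : |b| < 1 := (Int.cast_lt (R := ℝ)).1 (by push_cast; exact h1)
    exact Int.abs_lt_one_iff.1 this
  ext i
  fin_cases i
  · simp [ha, ha']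
  · simp [hb, hb']

lemma unfold_ball {G : Pl → ℝ} (hG : Periodic2 G) (p : Pl) {r : ℝ} (hr : r ≤ 1/2)
    (h0 : ∀ x, (∀ v ∈ unitLattice, r ≤ dist x (p + v)) → G x = 0) :
    ∫ x in fund, G x = ∫ x in ball p r, G x := by
  rw [fund_sq hG (p - hf)]
  apply setIntegral_eq_of_subset_of_forall_sdiff_eq_zero (meas_sq _) (ball_sub_sq p hr)
  rintro x ⟨hx, hxb⟩
  apply h0
  intro v hv
  by_contra! hlt
  have hd : ‖x - (p + v)‖ < r := by rwa [← dist_eq_norm]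
  have a0 := abs_lt.1 (((abs_coord_le _ 0).trans_lt hd).trans_le hr)
  have a1 := abs_lt.1 (((abs_coord_le _ 1).trans_lt hd).trans_le hr)
  simp [tsq, hf] at hx
  simp at a0 a1
  have : v = 0 := by
    apply lat_small hv
    · rw [abs_lt]; constructor <;> linarith [hx.1.1, hx.1.2]
    · rw [abs_lt]; constructor <;> linarith [hx.2.1, hx.2.2]
  subst this
  simp at hlt
  exact hxb hlt

/-! product coordinates -/

def mkP (z : ℝ × ℝ) : Pl := !₂[z.1, z.2]

@[simp] lemma mkP0 (z : ℝ × ℝ) : mkP z 0 = z.1 := by simp [mkP]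
@[simp] lemma mkP1 (z : ℝ × ℝ) : mkP z 1 = z.2 := by simp [mkP]

lemma mkP_coord (x : Pl) : mkP (x 0, x 1) = x := by
  ext i; fin_cases i <;> simp

def eqv : Pl ≃ᵐ ℝ × ℝ :=
  (MeasurableEquiv.toLp 2 (Fin 2 → ℝ)).symm.trans MeasurableEquiv.finTwoArrow

lemma eqv_apply (x : Pl) : eqv x = (x 0, x 1) := rfl
lemma eqv_symm (z : ℝ × ℝ) : eqv.symm z = mkP z := by
  apply eqv.injective
  rw [MeasurableEquiv.apply_symm_apply, eqv_apply]; simp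

lemma eqv_mp : MeasurePreserving eqv volume volume :=
  (EuclideanSpace.volume_preserving_symm_measurableEquiv_toLp (Fin 2)).trans
    (volume_preserving_finTwoArrow ℝ)

lemma mkP_mp : MeasurePreserving mkP volume volume := by
  have := eqv_mp.symm
  have e : (eqv.symm : ℝ × ℝ → Pl) = mkP := funext eqv_symm
  rwa [e] at this

lemma mkP_emb : MeasurableEmbedding mkP := by
  have e : (eqv.symm : ℝ × ℝ → Pl) = mkP := funext eqv_symm
  rw [← e]; exact eqv.symm.measurableEmbedding

lemma int_fund_prod (G : Pl → ℝ) :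
    ∫ x in fund, G x = ∫ z in (Ico (0:ℝ) 1) ×ˢ (Ico (0:ℝ) 1), G (mkP z) := by
  have := mkP_mp.setIntegral_preimage_emb mkP_emb G fund
  rw [← this]
  rfl

lemma int_fund_iter {G : Pl → ℝ} (hG : Continuous G) :
    ∫ x in fund, G x = ∫ a in (0:ℝ)..1, ∫ b in (0:ℝ)..1, G (mkP (a, b)) := by
  have hm : Continuous mkP := by unfold mkP; fun_prop
  rw [int_fund_prod, Measure.volume_eq_prod, setIntegral_prod]
  · rw [intervalIntegral.integral_of_le zero_le_one, integral_Ico_eq_integral_Ioc]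
    congr 1
    ext a
    rw [intervalIntegral.integral_of_le zero_le_one, integral_Ico_eq_integral_Ioc]
  · have : IntegrableOn (fun z => G (mkP z)) (Icc (0:ℝ) 1 ×ˢ Icc (0:ℝ) 1) (volume.prod volume) :=
      (hG.comp hm).continuousOn.integrableOn_compact (isCompact_Icc.prod isCompact_Icc)
    exact this.mono_set (prod_mono Ico_subset_Icc_self Ico_subset_Icc_self)

lemma int_fund_iter' {G : Pl → ℝ} (hG : Continuous G) :
    ∫ x in fund, G x = ∫ b in (0:ℝ)..1, ∫ a in (0:ℝ)..1, G (mkP (a, b)) := by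
  have hm : Continuous mkP := by unfold mkP; fun_prop
  rw [int_fund_iter hG]
  simp only [intervalIntegral.integral_of_le zero_le_one]
  apply integral_integral_swap (f := fun a b => G (mkP (a, b)))
  have : IntegrableOn (fun z => G (mkP z)) (Icc (0:ℝ) 1 ×ˢ Icc (0:ℝ) 1) (volume.prod volume) :=
      (hG.comp hm).continuousOn.integrableOn_compact (isCompact_Icc.prod isCompact_Icc)
  have h2 := this.mono_set (prod_mono Ioc_subset_Icc_self Ioc_subset_Icc_self)
  rw [IntegrableOn, ← Measure.prod_restrict] at h2
  exact h2

/-! partial derivatives -/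

lemma pd_eq {q : Pl → ℝ} {x : Pl} (h : DifferentiableAt ℝ q x) (i : Fin 2) :
    pd q i x = fderiv ℝ q x (EuclideanSpace.single i 1) := h.lineDeriv_eq_fderiv

lemma pd_congr {q k : Pl → ℝ} {x : Pl} (h : q =ᶠ[𝓝 x] k) (i : Fin 2) : pd q i x = pd k i x := by
  exact Filter.EventuallyEq.lineDeriv_eq h

lemma pd_congr' {q k : Pl → ℝ} {x : Pl} (h : q =ᶠ[𝓝 x] k) (i : Fin 2) :
    pd q i =ᶠ[𝓝 x] pd k i := by
  filter_upwards [h.eventuallyEq_nhds] with y hy using pd_congr hy i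

lemma lap_congr {q k : Pl → ℝ} {x : Pl} (h : q =ᶠ[𝓝 x] k) : lap q x = lap k x := by
  unfold lap
  rw [pd_congr (pd_congr' h 0) 0, pd_congr (pd_congr' h 1) 1]

lemma gradSq_congr {q k : Pl → ℝ} {x : Pl} (h : q =ᶠ[𝓝 x] k) : gradSq q x = gradSq k x := by
  unfold gradSq
  rw [pd_congr h 0, pd_congr h 1]

/-- smooth at a point -/
abbrev SmAt (q : Pl → ℝ) (x : Pl) : Prop := ContDiffAt ℝ (⊤ : ℕ∞) q x

lemma SmAt.diff {q : Pl → ℝ} {x : Pl} (h : SmAt q x) : DifferentiableAt ℝ q x :=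
  h.differentiableAt (by simp)

lemma SmAt.ev {q : Pl → ℝ} {x : Pl} {O : Set Pl} (hO : IsOpen O) (hx : x ∈ O)
    (h : ∀ y ∈ O, SmAt q y) : ∀ᶠ y in 𝓝 x, SmAt q y :=
  Filter.eventually_of_mem (hO.mem_nhds hx) h

lemma SmAt.pd {q : Pl → ℝ} {O : Set Pl} (hO : IsOpen O) (h : ∀ y ∈ O, SmAt q y) (i : Fin 2) :
    ∀ y ∈ O, SmAt (pd q i) y := by
  intro y hy
  have h1 : SmAt (fun x => fderiv ℝ q x (EuclideanSpace.single i 1)) y := by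
    have := (h y hy).fderiv_right (m := (⊤ : ℕ∞)) (by simp)
    exact this.clm_apply contDiffAt_const
  refine h1.congr_of_eventuallyEq ?_
  filter_upwards [hO.mem_nhds hy] with x hx
  exact pd_eq (h x hx).diff i

lemma pd_per {q : Pl → ℝ} (h : Periodic2 q) (i : Fin 2) : Periodic2 (pd q i) := by
  intro x v hv
  unfold pd lineDeriv
  congr 1
  funext t
  rw [add_right_comm, h _ v hv]

lemma lap_per {q : Pl → ℝ} (h : Periodic2 q) : Periodic2 (lap q) := by
  intro x v hv
  unfold lap
  rw [pd_per (pd_per h 0) 0 x v hv, pd_per (pd_per h 1) 1 x v hv]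

lemma gradSq_per {q : Pl → ℝ} (h : Periodic2 q) : Periodic2 (gradSq q) := by
  intro x v hv
  unfold gradSq
  rw [pd_per h 0 x v hv, pd_per h 1 x v hv]

lemma hasDeriv_c0 {q : Pl → ℝ} {a b : ℝ} (h : DifferentiableAt ℝ q (mkP (a, b))) :
    HasDerivAt (fun s => q (mkP (s, b))) (pd q 0 (mkP (a, b))) a := by
  rw [pd_eq h]
  have h2 : HasDerivAt (fun s => mkP (s, b)) (EuclideanSpace.single 0 1) a := by
    have e : (fun s => mkP (s, b)) = fun s : ℝ => mkP (0, b) + s • EuclideanSpace.single 0 (1:ℝ) := by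
      funext s; ext i; fin_cases i <;> simp
    rw [e]
    simpa using ((hasDerivAt_id a).smul_const (EuclideanSpace.single (0 : Fin 2) (1:ℝ))).const_add (mkP (0, b))
  exact h.hasFDerivAt.comp_hasDerivAt a h2

lemma hasDeriv_c1 {q : Pl → ℝ} {a b : ℝ} (h : DifferentiableAt ℝ q (mkP (a, b))) :
    HasDerivAt (fun s => q (mkP (a, s))) (pd q 1 (mkP (a, b))) b := by
  rw [pd_eq h]
  have h2 : HasDerivAt (fun s => mkP (a, s)) (EuclideanSpace.single 1 1) b := by
    have e : (fun s => mkP (a, s)) = fun s : ℝ => mkP (a, 0) + s • EuclideanSpace.single 1 (1:ℝ) := by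
      funext s; ext i; fin_cases i <;> simp
    rw [e]
    simpa using ((hasDerivAt_id b).smul_const (EuclideanSpace.single (1 : Fin 2) (1:ℝ))).const_add (mkP (a, 0))
  exact h.hasFDerivAt.comp_hasDerivAt b h2

lemma smAll_cont {q : Pl → ℝ} (h : ∀ y, SmAt q y) : Continuous q :=
  continuous_iff_continuousAt.2 fun y => (h y).continuousAt

lemma smAll_pd {q : Pl → ℝ} (h : ∀ y, SmAt q y) (i : Fin 2) : ∀ y, SmAt (pd q i) y :=
  fun y => SmAt.pd isOpen_univ (fun y _ => h y) i y (mem_univ _)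

lemma int_pd0 {q : Pl → ℝ} (h : ∀ y, SmAt q y) (hp : Periodic2 q) : ∫ x in fund, pd q 0 x = 0 := by
  have hm : Continuous mkP := by unfold mkP; fun_prop
  have hc := smAll_cont (smAll_pd h 0)
  rw [int_fund_iter' hc]
  have : ∀ b, ∫ a in (0:ℝ)..1, pd q 0 (mkP (a, b)) = 0 := by
    intro b
    rw [intervalIntegral.integral_eq_sub_of_hasDerivAt (f := fun a => q (mkP (a, b)))
      (fun a _ => hasDeriv_c0 (h _).diff)
      ((hc.comp (hm.comp (by fun_prop : Continuous (fun a : ℝ => (a, b))))).intervalIntegrable _ _)]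
    have e : mkP (1, b) = mkP (0, b) + EuclideanSpace.single 0 (1:ℝ) := by
      ext i; fin_cases i <;> simp
    rw [e, hp _ _ (lat_iff.2 ⟨1, 0, by simp, by simp⟩)]; simp
  simp [this]

lemma int_pd1 {q : Pl → ℝ} (h : ∀ y, SmAt q y) (hp : Periodic2 q) : ∫ x in fund, pd q 1 x = 0 := by
  have hm : Continuous mkP := by unfold mkP; fun_prop
  have hc := smAll_cont (smAll_pd h 1)
  rw [int_fund_iter hc]
  have : ∀ a, ∫ b in (0:ℝ)..1, pd q 1 (mkP (a, b)) = 0 := by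
    intro a
    rw [intervalIntegral.integral_eq_sub_of_hasDerivAt (f := fun b => q (mkP (a, b)))
      (fun a _ => hasDeriv_c1 (h _).diff)
      ((hc.comp (hm.comp (by fun_prop : Continuous (fun b : ℝ => (a, b))))).intervalIntegrable _ _)]
    have e : mkP (a, 1) = mkP (a, 0) + EuclideanSpace.single 1 (1:ℝ) := by
      ext i; fin_cases i <;> simp
    rw [e, hp _ _ (lat_iff.2 ⟨0, 1, by simp, by simp⟩)]; simp
  simp [this]

lemma fund_bdd : fund ⊆ closedBall (0 : Pl) 2 := by
  intro x hx
  rw [mem_closedBall_zero_iff]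
  have := norm_sq_pl x
  obtain ⟨⟨a, b⟩, c, d⟩ := hx
  have : ‖x‖ ^ 2 ≤ 2 ^ 2 := by nlinarith
  exact abs_le_of_sq_le_sq this (by norm_num) |>.trans' (le_abs_self _)

lemma meas_fund : MeasurableSet fund := by rw [fund_eq_sq]; exact meas_sq 0

lemma int_fund_cont {q : Pl → ℝ} {S : Set Pl} (hS : IsClosed S) (hq : ContinuousOn q S) :
    IntegrableOn (S.indicator q) fund := by
  have hcpt : IsCompact (closedBall (0 : Pl) 2 ∩ S) := (isCompact_closedBall 0 2).inter_right hS
  have h1 : IntegrableOn q (closedBall (0 : Pl) 2 ∩ S) :=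
    (hq.mono inter_subset_right).integrableOn_compact hcpt
  have h2 : IntegrableOn (S.indicator q) (closedBall (0 : Pl) 2) := by
    rw [IntegrableOn, integrable_indicator_iff hS.measurableSet, IntegrableOn,
      Measure.restrict_restrict hS.measurableSet, inter_comm]
    exact h1
  exact h2.mono_set fund_bdd

lemma int_lap {q : Pl → ℝ} (h : ∀ y, SmAt q y) (hp : Periodic2 q) : ∫ x in fund, lap q x = 0 := by
  have hi : ∀ i j, IntegrableOn (pd (pd q i) j) fund := by
    intro i j
    have := int_fund_cont (S := univ) isClosed_univ
      (smAll_cont (smAll_pd (smAll_pd h i) j)).continuousOn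
    simpa using this
  unfold lap
  rw [integral_add (hi 0 0) (hi 1 1), int_pd0 (smAll_pd h 0) (pd_per hp 0),
    int_pd1 (smAll_pd h 1) (pd_per hp 1), add_zero]

/-! ### logarithmic polar coordinates -/

def PP (p : Pl) (z : ℝ × ℝ) : Pl := p + mkP (exp z.1 * cos z.2, exp z.1 * sin z.2)

def cyl (p : Pl) (G : Pl → ℝ) (z : ℝ × ℝ) : ℝ := G (PP p z)

lemma mkP_contDiff : ContDiff ℝ (⊤ : ℕ∞) mkP := by
  rw [contDiff_euclidean]
  intro i
  fin_cases i
  · simpa using contDiff_fst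
  · simpa using contDiff_snd

lemma PP_contDiff (p : Pl) : ContDiff ℝ (⊤ : ℕ∞) (PP p) := by
  unfold PP
  apply contDiff_const.add
  apply mkP_contDiff.comp
  exact ContDiff.prodMk ((Real.contDiff_exp.comp contDiff_fst).mul
      (Real.contDiff_cos.comp contDiff_snd)) ((Real.contDiff_exp.comp contDiff_fst).mul
      (Real.contDiff_sin.comp contDiff_snd))

lemma PP_norm (p : Pl) (z : ℝ × ℝ) : ‖PP p z - p‖ = exp z.1 := by
  have h : ‖PP p z - p‖ ^ 2 = exp z.1 ^ 2 := by
    rw [norm_sq_pl]; simp [PP]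
    have := sin_sq_add_cos_sq z.2
    linear_combination (exp z.1 ^ 2) * this
  exact (pow_left_inj₀ (norm_nonneg _) (exp_pos _).le two_ne_zero).1 h

lemma PP_dist (p : Pl) (z : ℝ × ℝ) : dist (PP p z) p = exp z.1 := by
  rw [dist_eq_norm, PP_norm]

lemma PP_ne (p : Pl) (z : ℝ × ℝ) : PP p z ≠ p := by
  intro h
  have := PP_dist p z
  rw [h, dist_self] at this
  exact (exp_pos z.1).ne this

lemma PP_surj (p : Pl) {x : Pl} (hx : x ≠ p) : ∃ θ, PP p (log ‖x - p‖, θ) = x := by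
  set w : ℂ := ⟨(x - p) 0, (x - p) 1⟩ with hw
  have hn : ‖w‖ = ‖x - p‖ := by
    have h : ‖w‖ ^ 2 = ‖x - p‖ ^ 2 := by
      rw [norm_sq_pl, ← Complex.normSq_eq_norm_sq, Complex.normSq_apply, hw]; ring
    exact (pow_left_inj₀ (norm_nonneg _) (norm_nonneg _) two_ne_zero).1 h
  have hpos : 0 < ‖x - p‖ := norm_pos_iff.2 (sub_ne_zero.2 hx)
  refine ⟨Complex.arg w, ?_⟩
  have h1 := Complex.norm_mul_cos_arg w
  have h2 := Complex.norm_mul_sin_arg w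
  rw [hn] at h1 h2
  unfold PP
  simp only [exp_log hpos, h1, h2]
  ext i
  fin_cases i <;> simp [hw]

lemma cyl_per (p : Pl) (G : Pl → ℝ) : PerH (cyl p G) := by
  intro t θ
  simp [cyl, PP]

lemma fderiv_two {G : Pl → ℝ} {x : Pl} (h : DifferentiableAt ℝ G x) (a b : ℝ) :
    fderiv ℝ G x (mkP (a, b)) = a * pd G 0 x + b * pd G 1 x := by
  have e : mkP (a, b) = a • EuclideanSpace.single 0 (1:ℝ) + b • EuclideanSpace.single 1 (1:ℝ) := by
    ext i; fin_cases i <;> simp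
  rw [e, map_add, map_smul, map_smul, pd_eq h, pd_eq h]; simp

lemma mkP_hasDeriv {f g : ℝ → ℝ} {f' g' s : ℝ} (hf : HasDerivAt f f' s) (hg : HasDerivAt g g' s) :
    HasDerivAt (fun s => mkP (f s, g s)) (mkP (f', g')) s := by
  have e : ∀ a b : ℝ, mkP (a, b) = a • EuclideanSpace.single 0 (1:ℝ)
      + b • EuclideanSpace.single 1 (1:ℝ) := by
    intro a b; ext i; fin_cases i <;> simp
  simp only [e]
  exact (hf.smul_const _).add (hg.smul_const _)

lemma cyl_smAt {p : Pl} {G : Pl → ℝ} {z : ℝ × ℝ} (h : SmAt G (PP p z)) :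
    ContDiffAt ℝ (⊤ : ℕ∞) (cyl p G) z :=
  ContDiffAt.comp z h (PP_contDiff p).contDiffAt

lemma cyl_diff {p : Pl} {G : Pl → ℝ} {z : ℝ × ℝ} (h : DifferentiableAt ℝ G (PP p z)) :
    DifferentiableAt ℝ (cyl p G) z :=
  DifferentiableAt.comp z h ((PP_contDiff p).contDiffAt.differentiableAt (by simp))

lemma cyl_hd_t {p : Pl} {G : Pl → ℝ} {t θ : ℝ} (h : DifferentiableAt ℝ G (PP p (t, θ))) :
    HasDerivAt (fun s => cyl p G (s, θ)) (exp t * cos θ * cyl p (pd G 0) (t, θ)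
      + exp t * sin θ * cyl p (pd G 1) (t, θ)) t := by
  have h1 : HasDerivAt (fun s => PP p (s, θ)) (mkP (exp t * cos θ, exp t * sin θ)) t :=
    (mkP_hasDeriv ((Real.hasDerivAt_exp t).mul_const (cos θ))
      ((Real.hasDerivAt_exp t).mul_const (sin θ))).const_add p
  have := h.hasFDerivAt.comp_hasDerivAt t h1
  rw [fderiv_two h] at this
  exact this

lemma cyl_hd_h {p : Pl} {G : Pl → ℝ} {t θ : ℝ} (h : DifferentiableAt ℝ G (PP p (t, θ))) :
    HasDerivAt (fun s => cyl p G (t, s)) (-(exp t * sin θ) * cyl p (pd G 0) (t, θ)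
      + exp t * cos θ * cyl p (pd G 1) (t, θ)) θ := by
  have h1 : HasDerivAt (fun s => PP p (t, s)) (mkP (exp t * -sin θ, exp t * cos θ)) θ :=
    (mkP_hasDeriv ((Real.hasDerivAt_cos θ).const_mul (exp t))
      ((Real.hasDerivAt_sin θ).const_mul (exp t))).const_add p
  have := h.hasFDerivAt.comp_hasDerivAt θ h1
  rw [fderiv_two h] at this
  refine this.congr_deriv ?_
  unfold cyl; ring

lemma Dt_cyl {p : Pl} {G : Pl → ℝ} {z : ℝ × ℝ} (h : DifferentiableAt ℝ G (PP p z)) :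
    Dt (cyl p G) z = exp z.1 * cos z.2 * cyl p (pd G 0) z + exp z.1 * sin z.2 * cyl p (pd G 1) z :=
  Dt_eq (t := z.1) (θ := z.2) (cyl_diff h) (cyl_hd_t h)

lemma Dh_cyl {p : Pl} {G : Pl → ℝ} {z : ℝ × ℝ} (h : DifferentiableAt ℝ G (PP p z)) :
    Dh (cyl p G) z = -(exp z.1 * sin z.2) * cyl p (pd G 0) z
      + exp z.1 * cos z.2 * cyl p (pd G 1) z :=
  Dh_eq (t := z.1) (θ := z.2) (cyl_diff h) (cyl_hd_h h)

lemma grad_cyl {p : Pl} {G : Pl → ℝ} {z : ℝ × ℝ} (h : DifferentiableAt ℝ G (PP p z)) :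
    Dt (cyl p G) z ^ 2 + Dh (cyl p G) z ^ 2 = exp (2 * z.1) * gradSq G (PP p z) := by
  rw [Dt_cyl h, Dh_cyl h]
  have := sin_sq_add_cos_sq z.2
  have e : exp (2 * z.1) = exp z.1 ^ 2 := by rw [← exp_nat_mul]; norm_num
  unfold gradSq cyl
  rw [e]
  linear_combination (exp z.1 ^ 2 * (pd G 0 (PP p z) ^ 2 + pd G 1 (PP p z) ^ 2)) * this

lemma PP_ev (p : Pl) {O : Set Pl} (hO : IsOpen O) {z : ℝ × ℝ} (hz : PP p z ∈ O) :
    ∀ᶠ y in 𝓝 z, PP p y ∈ O :=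
  (PP_contDiff p).continuous.continuousAt.eventually (hO.mem_nhds hz)

lemma DtDt_cyl {p : Pl} {G : Pl → ℝ} {O : Set Pl} (hO : IsOpen O) (h : ∀ y ∈ O, SmAt G y)
    {z : ℝ × ℝ} (hz : PP p z ∈ O) :
    Dt (Dt (cyl p G)) z = exp z.1 * cos z.2 * cyl p (pd G 0) z
      + exp z.1 * sin z.2 * cyl p (pd G 1) z
      + exp z.1 * cos z.2 * (exp z.1 * cos z.2 * cyl p (pd (pd G 0) 0) z
          + exp z.1 * sin z.2 * cyl p (pd (pd G 0) 1) z)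
      + exp z.1 * sin z.2 * (exp z.1 * cos z.2 * cyl p (pd (pd G 1) 0) z
          + exp z.1 * sin z.2 * cyl p (pd (pd G 1) 1) z) := by
  have ev : Dt (cyl p G) =ᶠ[𝓝 z] fun z => exp z.1 * cos z.2 * cyl p (pd G 0) z
      + exp z.1 * sin z.2 * cyl p (pd G 1) z := by
    filter_upwards [PP_ev p hO hz] with y hy using Dt_cyl (h _ hy).diff
  have e1 : Dt (Dt (cyl p G)) z = Dt (fun z => exp z.1 * cos z.2 * cyl p (pd G 0) z
      + exp z.1 * sin z.2 * cyl p (pd G 1) z) z := by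
    unfold Dt at ev ⊢; rw [ev.fderiv_eq]
  rw [e1]
  obtain ⟨t, θ⟩ := z
  have d0 := (SmAt.pd hO h 0 _ hz).diff
  have d1 := (SmAt.pd hO h 1 _ hz).diff
  apply Dt_eq
  · have := cyl_diff d0
    have := cyl_diff d1
    fun_prop
  · refine ((((Real.hasDerivAt_exp t).mul_const (cos θ)).mul (cyl_hd_t d0)).add
      (((Real.hasDerivAt_exp t).mul_const (sin θ)).mul (cyl_hd_t d1))).congr_deriv ?_
    ring

lemma DhDh_cyl {p : Pl} {G : Pl → ℝ} {O : Set Pl} (hO : IsOpen O) (h : ∀ y ∈ O, SmAt G y)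
    {z : ℝ × ℝ} (hz : PP p z ∈ O) :
    Dh (Dh (cyl p G)) z = -(exp z.1 * cos z.2) * cyl p (pd G 0) z
      - exp z.1 * sin z.2 * cyl p (pd G 1) z
      - exp z.1 * sin z.2 * (-(exp z.1 * sin z.2) * cyl p (pd (pd G 0) 0) z
          + exp z.1 * cos z.2 * cyl p (pd (pd G 0) 1) z)
      + exp z.1 * cos z.2 * (-(exp z.1 * sin z.2) * cyl p (pd (pd G 1) 0) z
          + exp z.1 * cos z.2 * cyl p (pd (pd G 1) 1) z) := by
  have ev : Dh (cyl p G) =ᶠ[𝓝 z] fun z => -(exp z.1 * sin z.2) * cyl p (pd G 0) z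
      + exp z.1 * cos z.2 * cyl p (pd G 1) z := by
    filter_upwards [PP_ev p hO hz] with y hy using Dh_cyl (h _ hy).diff
  have e1 : Dh (Dh (cyl p G)) z = Dh (fun z => -(exp z.1 * sin z.2) * cyl p (pd G 0) z
      + exp z.1 * cos z.2 * cyl p (pd G 1) z) z := by
    unfold Dh at ev ⊢; rw [ev.fderiv_eq]
  rw [e1]
  obtain ⟨t, θ⟩ := z
  have d0 := (SmAt.pd hO h 0 _ hz).diff
  have d1 := (SmAt.pd hO h 1 _ hz).diff
  apply Dh_eq
  · have := cyl_diff d0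
    have := cyl_diff d1
    fun_prop
  · have hn : HasDerivAt (fun θ => -(exp t * sin θ)) (-(exp t * cos θ)) θ :=
      ((Real.hasDerivAt_sin θ).const_mul (exp t)).neg
    refine ((hn.mul (cyl_hd_h d0)).add
      (((Real.hasDerivAt_cos θ).const_mul (exp t)).mul (cyl_hd_h d1))).congr_deriv ?_
    ring

lemma lap_cyl {p : Pl} {G : Pl → ℝ} {O : Set Pl} (hO : IsOpen O) (h : ∀ y ∈ O, SmAt G y)
    {z : ℝ × ℝ} (hz : PP p z ∈ O) :
    Dt (Dt (cyl p G)) z + Dh (Dh (cyl p G)) z = exp (2 * z.1) * lap G (PP p z) := by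
  rw [DtDt_cyl hO h hz, DhDh_cyl hO h hz]
  have := sin_sq_add_cos_sq z.2
  have e : exp (2 * z.1) = exp z.1 ^ 2 := by rw [← exp_nat_mul]; norm_num
  unfold lap cyl
  rw [e]
  linear_combination (exp z.1 ^ 2 * (pd (pd G 0) 0 (PP p z) + pd (pd G 1) 1 (PP p z))) * this

/-! polar integration -/

def ann (p : Pl) (a b : ℝ) : Set Pl := {x | exp a ≤ ‖x - p‖ ∧ ‖x - p‖ < exp b}

lemma meas_ann (p : Pl) (a b : ℝ) : MeasurableSet (ann p a b) := by
  apply MeasurableSet.inter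
  · exact measurableSet_le measurable_const (by fun_prop : Measurable (fun x : Pl => ‖x - p‖))
  · exact measurableSet_lt (by fun_prop : Measurable (fun x : Pl => ‖x - p‖)) measurable_const

lemma polar_ann {p : Pl} {G : Pl → ℝ} {T a b : ℝ} (hG : ContinuousOn (cyl p G) (strip T))
    (hab : a ≤ b) (hb : b < T) :
    ∫ x in ann p a b, G x = ∫ t in a..b, cI (fun z => exp (2 * z.1) * cyl p G z) t := by
  have s1 : ∫ x in ann p a b, G x = ∫ x, (ann p a b).indicator G (p + x) := by
    rw [integral_add_left_eq_self, integral_indicator (meas_ann p a b)]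
  have s2 : ∫ x, (ann p a b).indicator G (p + x)
      = ∫ z : ℝ × ℝ, (ann p a b).indicator G (p + mkP z) :=
    (mkP_mp.integral_comp mkP_emb (fun x => (ann p a b).indicator G (p + x))).symm
  rw [s1, s2, ← integral_comp_polarCoord_symm]
  have s3 : ∫ z in polarCoord.target, z.1 • (ann p a b).indicator G (p + mkP (polarCoord.symm z))
      = ∫ z in (Ico (exp a) (exp b)) ×ˢ (Ioo (-π) π), z.1 * cyl p G (log z.1, z.2) := by
    have hm2 : MeasurableSet ((Ico (exp a) (exp b)) ×ˢ (Ioo (-π) π)) :=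
      measurableSet_Ico.prod measurableSet_Ioo
    rw [← integral_indicator polarCoord.open_target.measurableSet, ← integral_indicator hm2]
    congr 1
    funext z
    obtain ⟨r, θ⟩ := z
    by_cases hr : 0 < r
    · have hPP : p + mkP (polarCoord.symm (r, θ)) = PP p (log r, θ) := by
        simp [polarCoord_symm_apply, PP, exp_log hr]
      have hn : ‖PP p (log r, θ) - p‖ = r := by rw [PP_norm]; exact exp_log hr
      by_cases hθ : θ ∈ Ioo (-π) π
      · have h1 : (r, θ) ∈ polarCoord.target := ⟨hr, hθ⟩
        rw [indicator_of_mem h1, hPP]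
        by_cases h2 : r ∈ Ico (exp a) (exp b)
        · have h3 : (r, θ) ∈ (Ico (exp a) (exp b)) ×ˢ (Ioo (-π) π) := ⟨h2, hθ⟩
          have h4 : PP p (log r, θ) ∈ ann p a b := by
            refine ⟨?_, ?_⟩ <;> rw [hn]
            exacts [h2.1, h2.2]
          rw [indicator_of_mem h3, indicator_of_mem h4]
          rfl
        · have h3 : (r, θ) ∉ (Ico (exp a) (exp b)) ×ˢ (Ioo (-π) π) := fun h => h2 h.1
          have h4 : PP p (log r, θ) ∉ ann p a b := by
            rintro ⟨h5, h6⟩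
            rw [hn] at h5 h6
            exact h2 ⟨h5, h6⟩
          rw [indicator_of_notMem h3, indicator_of_notMem h4, smul_zero]
      · rw [indicator_of_notMem (fun h => hθ h.2), indicator_of_notMem (fun h => hθ h.2)]
    · rw [indicator_of_notMem (fun h => hr h.1),
        indicator_of_notMem (fun h => hr ((exp_pos a).trans_le h.1.1))]
  rw [s3]
  have hexp : exp a ≤ exp b := exp_le_exp.2 hab
  have hcont : ContinuousOn (fun z : ℝ × ℝ => z.1 * cyl p G (log z.1, z.2))
      (Icc (exp a) (exp b) ×ˢ Icc (-π) π) := by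
    apply continuousOn_fst.mul
    apply hG.comp
    · apply ContinuousOn.prodMk _ continuousOn_snd
      apply ContinuousOn.log continuousOn_fst
      rintro z hz
      exact ((exp_pos a).trans_le hz.1.1).ne'
    · rintro z hz
      have h0 := (exp_pos a).trans_le hz.1.1
      have : log z.1 ≤ b := by rw [log_le_iff_le_exp h0]; exact hz.1.2
      exact this.trans_lt hb
  have hintG : IntegrableOn (fun z : ℝ × ℝ => z.1 * cyl p G (log z.1, z.2))
      (Ico (exp a) (exp b) ×ˢ Ioo (-π) π) (volume.prod volume) :=
    (hcont.integrableOn_compact (isCompact_Icc.prod isCompact_Icc)).mono_set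
      (prod_mono Ico_subset_Icc_self Ioo_subset_Icc_self)
  rw [Measure.volume_eq_prod, setIntegral_prod _ hintG]
  have s4 : ∀ r, ∫ θ in Ioo (-π) π, r * cyl p G (log r, θ) = r * cI (cyl p G) (log r) := by
    intro r
    rw [integral_const_mul, ← integral_Ioc_eq_integral_Ioo,
      ← intervalIntegral.integral_of_le (by linarith [pi_pos])]
    congr 1
    have hper : Function.Periodic (fun s => cyl p G (log r, s)) (2 * π) :=
      fun s => cyl_per p G (log r) s
    have := hper.intervalIntegral_add_eq (-π) 0
    unfold cI
    rw [zero_add] at this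
    rw [← this]
    congr 1; ring
  simp only [s4]
  rw [integral_Ico_eq_integral_Ioc, ← intervalIntegral.integral_of_le hexp]
  have hcI : ContinuousOn (fun r => r * cI (cyl p G) (log r)) (exp '' (uIcc a b)) := by
    apply continuousOn_id.mul
    apply (cI_contOn hG).comp
    · apply ContinuousOn.log continuousOn_id
      rintro _ ⟨t, _, rfl⟩
      exact (exp_pos t).ne'
    · rintro _ ⟨t, ht, rfl⟩
      rw [uIcc_of_le hab] at ht
      simp only [log_exp]
      exact ht.2.trans_lt hb
  have := intervalIntegral.integral_comp_mul_deriv'' (a := a) (b := b) (f := exp) (f' := exp)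
    (g := fun r => r * cI (cyl p G) (log r)) Real.continuous_exp.continuousOn
    (fun x _ => (Real.hasDerivAt_exp x).hasDerivWithinAt) Real.continuous_exp.continuousOn hcI
  rw [← this]
  apply intervalIntegral.integral_congr
  intro t _
  have e1 := cI_smul (fun t => exp (2 * t)) (cyl p G) t
  have e2 : exp (2 * t) = exp t * exp t := by rw [← exp_add]; ring_nf
  simp only [Function.comp, log_exp]
  rw [e1, e2]; ring

/-! ### separated sets and gluing -/

def TSep (S : Set Pl) (ρ : ℝ) : Prop := ∀ z ∈ S, ∀ z' ∈ S, z ≠ z' → 4 * ρ ≤ dist z z'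
def LatInv (S : Set Pl) : Prop := ∀ z ∈ S, ∀ v ∈ unitLattice, z + v ∈ S

lemma TSep.eq {S : Set Pl} {ρ : ℝ} (h : TSep S ρ) {x z z' : Pl} (hz : z ∈ S) (hz' : z' ∈ S)
    (h1 : dist x z < 2 * ρ) (h2 : dist x z' < 2 * ρ) : z = z' := by
  by_contra hne
  have := h z hz z' hz' hne
  have := dist_triangle_left z z' x
  linarith

lemma TSep.far {S : Set Pl} {ρ : ℝ} (hρ : 0 < ρ) (h : TSep S ρ) {x : Pl} (hx : x ∉ S) :
    ∃ δ > 0, ∀ z ∈ S, δ ≤ dist x z := by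
  by_cases hn : ∃ z ∈ S, dist x z < 2 * ρ
  · obtain ⟨z, hz, hd⟩ := hn
    have hpos : 0 < dist x z := dist_pos.2 (fun e => hx (e ▸ hz))
    refine ⟨min (dist x z) (2 * ρ), lt_min hpos (by linarith), fun z' hz' => ?_⟩
    by_cases h2 : dist x z' < 2 * ρ
    · rw [h.eq hz hz' hd h2]; exact min_le_left _ _
    · exact (min_le_right _ _).trans (not_lt.1 h2)
  · push Not at hn
    exact ⟨2 * ρ, by linarith, hn⟩

lemma TSep.isClosed {S : Set Pl} {ρ : ℝ} (hρ : 0 < ρ) (h : TSep S ρ) : IsClosed S := by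
  rw [← isOpen_compl_iff, Metric.isOpen_iff]
  intro x hx
  obtain ⟨δ, hδ, hd⟩ := h.far hρ hx
  refine ⟨δ, hδ, fun y hy hyS => ?_⟩
  have := hd y hyS
  rw [mem_ball, dist_comm] at hy
  linarith

open Classical in
def glue (S : Set Pl) (ρ : ℝ) (k : Pl → Pl → ℝ) (g : Pl → ℝ) (x : Pl) : ℝ :=
  if h : ∃ z, z ∈ S ∧ dist x z < 2 * ρ then k h.choose x else g x

section glue
variable {S : Set Pl} {ρ : ℝ} {k : Pl → Pl → ℝ} {g : Pl → ℝ}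

lemma glue_in (hS : TSep S ρ) {x z : Pl} (hz : z ∈ S) (h : dist x z < 2 * ρ) :
    glue S ρ k g x = k z x := by
  have hex : ∃ z, z ∈ S ∧ dist x z < 2 * ρ := ⟨z, hz, h⟩
  unfold glue
  rw [dif_pos hex, hS.eq hz hex.choose_spec.1 h hex.choose_spec.2]

lemma glue_out (hS : TSep S ρ) (hk : ∀ z ∈ S, ∀ x, ρ ≤ dist x z → k z x = g x) {x : Pl}
    (h : ∀ z ∈ S, ρ ≤ dist x z) : glue S ρ k g x = g x := by
  by_cases hn : ∃ z, z ∈ S ∧ dist x z < 2 * ρ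
  · obtain ⟨z, hz, hd⟩ := hn
    rw [glue_in hS hz hd, hk z hz x (h z hz)]
  · unfold glue; rw [dif_neg hn]

lemma glue_in_ev (hS : TSep S ρ) {x z : Pl} (hz : z ∈ S) (h : dist x z < 2 * ρ) :
    glue S ρ k g =ᶠ[𝓝 x] k z := by
  have : ball z (2 * ρ) ∈ 𝓝 x := isOpen_ball.mem_nhds h
  filter_upwards [this] with y hy using glue_in hS hz hy

lemma glue_sm (hρ : 0 < ρ) (hS : TSep S ρ) (hk : ∀ z ∈ S, ∀ x, ρ ≤ dist x z → k z x = g x)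
    (hks : ∀ z ∈ S, ∀ x, dist x z < 2 * ρ → SmAt (k z) x)
    (hgs : ∀ x, (∀ z ∈ S, ρ < dist x z) → SmAt g x) (x : Pl) : SmAt (glue S ρ k g) x := by
  by_cases hn : ∃ z, z ∈ S ∧ dist x z < 2 * ρ
  · obtain ⟨z, hz, hd⟩ := hn
    exact (hks z hz x hd).congr_of_eventuallyEq (glue_in_ev hS hz hd)
  · push Not at hn
    have hg := hgs x (fun z hz => by have := hn z hz; linarith)
    refine hg.congr_of_eventuallyEq ?_
    filter_upwards [ball_mem_nhds x hρ] with y hy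
    apply glue_out hS hk
    intro z hz
    have h1 := hn z hz
    have h2 := dist_triangle_left x z y
    rw [mem_ball] at hy
    linarith

lemma glue_per (hS : TSep S ρ) (hL : LatInv S)
    (hk : ∀ z x, ∀ v ∈ unitLattice, k (z + v) (x + v) = k z x) (hg : Periodic2 g) :
    Periodic2 (glue S ρ k g) := by
  intro x v hv
  by_cases hn : ∃ z, z ∈ S ∧ dist x z < 2 * ρ
  · obtain ⟨z, hz, hd⟩ := hn
    rw [glue_in hS hz hd, glue_in hS (hL z hz v hv) (by rwa [dist_add_right]), hk z x v hv]
  · have hn' : ¬ ∃ z, z ∈ S ∧ dist (x + v) z < 2 * ρ := by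
      rintro ⟨z, hz, hd⟩
      refine hn ⟨z + -v, hL z hz _ (lat_neg hv), ?_⟩
      rw [← dist_add_right _ _ v]; simpa using hd
    unfold glue
    rw [dif_neg hn, dif_neg hn', hg x v hv]

end glue

/-! vortex set separation -/

def VP (V : VortexData) : Fin V.d₁ ⊕ Fin V.d₂ → Pl := Sum.elim V.p₁ V.p₂

lemma memZ {V : VortexData} {x : Pl} : x ∈ V.Z ↔ ∃ i, ∃ v ∈ unitLattice, x = VP V i + v := by
  constructor
  · rintro (⟨j, v, hv, rfl⟩ | ⟨j, v, hv, rfl⟩)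
    · exact ⟨Sum.inl j, v, hv, rfl⟩
    · exact ⟨Sum.inr j, v, hv, rfl⟩
  · rintro ⟨i | i, v, hv, rfl⟩
    · exact Or.inl ⟨i, v, hv, rfl⟩
    · exact Or.inr ⟨i, v, hv, rfl⟩

lemma Z_inv (V : VortexData) : LatInv V.Z := by
  intro z hz v hv
  obtain ⟨i, w, hw, rfl⟩ := memZ.1 hz
  exact memZ.2 ⟨i, w + v, lat_add hw hv, by rw [add_assoc]⟩

lemma real_sep (a : ℝ) : ∃ δ > 0, ∀ n : ℤ, a - n = 0 ∨ δ ≤ |a - n| := by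
  by_cases h : Int.fract a = 0
  · refine ⟨1, one_pos, fun n => ?_⟩
    have ha : a = ⌊a⌋ := by have := Int.floor_add_fract a; linarith
    by_cases hn : ⌊a⌋ = n
    · left; rw [ha, hn]; simp
    · right
      rw [ha, ← Int.cast_sub, ← Int.cast_abs]
      have : 1 ≤ |⌊a⌋ - n| := Int.one_le_abs (sub_ne_zero.2 hn)
      exact_mod_cast this
  · have h0 : 0 < Int.fract a := lt_of_le_of_ne (Int.fract_nonneg a) (Ne.symm h)
    have h1 : 0 < 1 - Int.fract a := by linarith [Int.fract_lt_one a]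
    refine ⟨min (Int.fract a) (1 - Int.fract a), lt_min h0 h1, fun n => Or.inr ?_⟩
    have e := Int.floor_add_fract a
    rcases le_or_gt n ⌊a⌋ with hn | hn
    · have : (n : ℝ) ≤ ⌊a⌋ := by exact_mod_cast hn
      exact (min_le_left _ _).trans ((by linarith : Int.fract a ≤ a - n).trans (le_abs_self _))
    · have : (⌊a⌋ : ℝ) + 1 ≤ n := by exact_mod_cast hn
      exact (min_le_right _ _).trans ((by linarith : 1 - Int.fract a ≤ -(a - n)).trans (neg_le_abs _))

lemma vec_sep (a : Pl) : ∃ δ > 0, ∀ v ∈ unitLattice, a - v = 0 ∨ δ ≤ ‖a - v‖ := by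
  obtain ⟨δ0, h0, H0⟩ := real_sep (a 0)
  obtain ⟨δ1, h1, H1⟩ := real_sep (a 1)
  refine ⟨min δ0 δ1, lt_min h0 h1, fun v hv => ?_⟩
  obtain ⟨n, m, hn, hm⟩ := lat_iff.1 hv
  have e0 : (a - v) 0 = a 0 - n := by simp [hn]
  have e1 : (a - v) 1 = a 1 - m := by simp [hm]
  rcases H0 n with k0 | k0
  · rcases H1 m with k1 | k1
    · left
      ext i
      fin_cases i
      · simpa using e0.trans k0
      · simpa using e1.trans k1
    · right
      rw [← e1] at k1
      exact (min_le_right _ _).trans (k1.trans (abs_coord_le _ _))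
  · right
    rw [← e0] at k0
    exact (min_le_left _ _).trans (k0.trans (abs_coord_le _ _))

lemma Z_sep (V : VortexData) : ∃ ρ > 0, ρ ≤ 1 / 8 ∧ TSep V.Z ρ := by
  choose δ hδ H using fun ij : (Fin V.d₁ ⊕ Fin V.d₂) × (Fin V.d₁ ⊕ Fin V.d₂) =>
    vec_sep (VP V ij.1 - VP V ij.2)
  obtain ⟨d, hd, hdle⟩ : ∃ d > 0, ∀ ij, d ≤ δ ij := by
    have := Finite.exists_min (fun o : Option ((Fin V.d₁ ⊕ Fin V.d₂) × (Fin V.d₁ ⊕ Fin V.d₂)) =>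
      o.elim 1 δ)
    obtain ⟨o, ho⟩ := this
    refine ⟨o.elim 1 δ, ?_, fun ij => ho (some ij)⟩
    cases o
    · simp
    · exact hδ _
  refine ⟨min (d / 4) (1 / 8), lt_min (by linarith) (by norm_num), min_le_right _ _, ?_⟩
  intro z hz z' hz' hne
  obtain ⟨i, v, hv, rfl⟩ := memZ.1 hz
  obtain ⟨j, w, hw, rfl⟩ := memZ.1 hz'
  have h1 := min_le_left (d / 4) (1 / 8)
  rcases H (i, j) (w - v) (lat_sub hw hv) with h | h
  · exfalso
    apply hne
    have e : VP V i + v - (VP V j + w) = 0 := by rw [← h]; simp only; abel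
    exact sub_eq_zero.1 e
  · have h2 := hdle (i, j)
    have e : VP V i + v - (VP V j + w) = VP V i - VP V j - (w - v) := by abel
    rw [dist_eq_norm, e]
    simp only at h
    linarith

/-! ### divergence theorem on the perforated torus -/

def cut (s : ℝ) (r2 : ℝ) : ℝ :=
  Real.smoothTransition ((r2 - exp (2 * (s - 2))) / (exp (2 * (s - 1)) - exp (2 * (s - 2))))

lemma cut_den (s : ℝ) : 0 < exp (2 * (s - 1)) - exp (2 * (s - 2)) :=
  sub_pos.2 (exp_lt_exp.2 (by linarith))

lemma cut_zero {s r : ℝ} (h0 : 0 ≤ r) (h : r ≤ exp (s - 2)) : cut s (r ^ 2) = 0 := by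
  apply Real.smoothTransition.zero_of_nonpos
  apply div_nonpos_of_nonpos_of_nonneg _ (cut_den s).le
  have e : exp (2 * (s - 2)) = exp (s - 2) ^ 2 := by rw [← exp_nat_mul]; norm_num
  rw [e]
  nlinarith

lemma cut_one {s r : ℝ} (h : exp (s - 1) ≤ r) : cut s (r ^ 2) = 1 := by
  apply Real.smoothTransition.one_of_one_le
  rw [le_div_iff₀ (cut_den s)]
  have e : exp (2 * (s - 1)) = exp (s - 1) ^ 2 := by rw [← exp_nat_mul]; norm_num
  have := exp_pos (s - 1)
  rw [e]
  nlinarith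

lemma cut_contDiff (s : ℝ) : ContDiff ℝ (⊤ : ℕ∞) (cut s) := by
  unfold cut
  exact Real.smoothTransition.contDiff.comp ((contDiff_id.sub contDiff_const).div_const _)

lemma cutN_contDiff (s : ℝ) (z : Pl) : ContDiff ℝ (⊤ : ℕ∞) (fun x : Pl => cut s (‖x - z‖ ^ 2)) :=
  (cut_contDiff s).comp ((contDiff_id.sub contDiff_const).norm_sq ℝ)

lemma exists_K {V : VortexData} {ρ : ℝ} (hρ : 0 < ρ) (hS : TSep V.Z ρ) {W : Pl → ℝ}
    (hW : ∀ x ∉ V.Z, SmAt W x) (hWp : Periodic2 W) {s : ℝ} (hs : exp s ≤ ρ) :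
    ∃ K : Pl → ℝ, Periodic2 K ∧ (∀ x, SmAt K x) ∧
      (∀ x, (∀ z ∈ V.Z, exp (s - 1) ≤ dist x z) → K x = W x) ∧
      (∀ x, ∀ z ∈ V.Z, dist x z < exp (s - 2) → K x = 0) := by
  have hs1 : exp (s - 1) ≤ ρ := (exp_le_exp.2 (by linarith)).trans hs
  have hs2 : exp (s - 2) ≤ ρ := (exp_le_exp.2 (by linarith)).trans hs
  have hk : ∀ z ∈ V.Z, ∀ x, ρ ≤ dist x z → cut s (‖x - z‖ ^ 2) * W x = W x := by
    intro z _ x hx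
    rw [← dist_eq_norm, cut_one (hs1.trans hx), one_mul]
  refine ⟨glue V.Z ρ (fun z x => cut s (‖x - z‖ ^ 2) * W x) W, ?_, ?_, ?_, ?_⟩
  · apply glue_per hS (Z_inv V) _ hWp
    intro z x v hv
    simp only [hWp x v hv, add_sub_add_right_eq_sub]
  · apply glue_sm hρ hS hk
    · intro z hz x hx
      by_cases hxz : dist x z < exp (s - 2)
      · have : (fun x => cut s (‖x - z‖ ^ 2) * W x) =ᶠ[𝓝 x] fun _ => 0 := by
          filter_upwards [isOpen_ball.mem_nhds (show x ∈ ball z (exp (s - 2)) from hxz)] with y hy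
          rw [mem_ball, dist_eq_norm] at hy
          rw [cut_zero (norm_nonneg _) hy.le, zero_mul]
        exact contDiffAt_const.congr_of_eventuallyEq this
      · apply (cutN_contDiff s z).contDiffAt.mul
        apply hW
        intro hxZ
        have := hS.eq hz hxZ hx (by rw [dist_self]; linarith)
        rw [this, dist_self] at hxz
        exact hxz (exp_pos _)
    · intro x hx
      apply hW
      intro hxZ
      have := hx x hxZ
      rw [dist_self] at this
      linarith
  · intro x hx
    by_cases hn : ∃ z, z ∈ V.Z ∧ dist x z < 2 * ρ
    · obtain ⟨z, hz, hd⟩ := hn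
      have := hx z hz
      rw [glue_in hS hz hd, ← dist_eq_norm, cut_one this, one_mul]
    · unfold glue; rw [dif_neg hn]
  · intro x z hz hd
    rw [glue_in hS hz (by linarith), ← dist_eq_norm, cut_zero dist_nonneg hd.le, zero_mul]

def perf (V : VortexData) (s : ℝ) : Set Pl := {x | ∀ z ∈ V.Z, exp s ≤ dist x z}

lemma perf_closed (V : VortexData) (s : ℝ) : IsClosed (perf V s) := by
  have : perf V s = ⋂ z ∈ V.Z, {x | exp s ≤ dist x z} := by ext x; simp [perf]
  rw [this]
  exact isClosed_biInter fun z _ => isClosed_le continuous_const (by fun_prop)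

lemma perf_notMem {V : VortexData} {s : ℝ} {x : Pl} (h : x ∈ perf V s) : x ∉ V.Z := by
  intro hx
  have := h x hx
  rw [dist_self] at this
  linarith [exp_pos s]

lemma perf_per {V : VortexData} {s : ℝ} {x v : Pl} (hv : v ∈ unitLattice) :
    x + v ∈ perf V s ↔ x ∈ perf V s := by
  constructor
  · intro h z hz
    have := h _ (Z_inv V z hz v hv)
    rwa [dist_add_right] at this
  · intro h z hz
    have := h _ (Z_inv V z hz _ (lat_neg hv))
    rw [← dist_add_right _ _ v] at this
    simpa using this

def nb (q : Pl) (s : ℝ) : Set Pl := {x | ∃ v ∈ unitLattice, dist x (q + v) < exp s}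

lemma nb_open (q : Pl) (s : ℝ) : IsOpen (nb q s) := by
  have : nb q s = ⋃ v ∈ unitLattice, ball (q + v) (exp s) := by ext x; simp [nb]
  rw [this]
  exact isOpen_biUnion fun z _ => isOpen_ball

lemma nb_per {q : Pl} {s : ℝ} {x v : Pl} (hv : v ∈ unitLattice) : x + v ∈ nb q s ↔ x ∈ nb q s := by
  constructor
  · rintro ⟨w, hw, h⟩
    refine ⟨w - v, lat_sub hw hv, ?_⟩
    have e : q + (w - v) + v = q + w := by abel
    rw [← dist_add_right _ _ v, e]; exact h
  · rintro ⟨w, hw, h⟩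
    refine ⟨w + v, lat_add hw hv, ?_⟩
    rw [← add_assoc, dist_add_right]; exact h

lemma ind_per {A : Set Pl} {G : Pl → ℝ} (hA : ∀ x v, v ∈ unitLattice → (x + v ∈ A ↔ x ∈ A))
    (hG : Periodic2 G) : Periodic2 (A.indicator G) := by
  intro x v hv
  by_cases h : x ∈ A
  · rw [indicator_of_mem h, indicator_of_mem ((hA x v hv).2 h), hG x v hv]
  · rw [indicator_of_notMem h, indicator_of_notMem (fun h' => h ((hA x v hv).1 h'))]

lemma int_nb {G : Pl → ℝ} (hG : Periodic2 G) (q : Pl) {s : ℝ} (hs : exp s ≤ 1 / 2) :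
    ∫ x in fund, (nb q s).indicator G x = ∫ x in ball q (exp s), G x := by
  rw [unfold_ball (ind_per (fun x v hv => nb_per hv) hG) q hs]
  · apply setIntegral_congr_fun measurableSet_ball
    intro x hx
    apply indicator_of_mem
    exact ⟨0, lat_zero, by simpa using hx⟩
  · intro x hx
    apply indicator_of_notMem
    rintro ⟨v, hv, h⟩
    linarith [hx v hv]

theorem div_perf {V : VortexData} {ρ : ℝ} (hρ : 0 < ρ) (hρ8 : ρ ≤ 1 / 8) (hS : TSep V.Z ρ) {W : Pl → ℝ}
    (hW : ∀ x ∉ V.Z, SmAt W x) (hWp : Periodic2 W) {s : ℝ} (hs : exp s ≤ ρ) :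
    ∫ x in fund, (perf V s).indicator (lap W) x = - ∑ i, cI (Dt (cyl (VP V i) W)) s := by
  obtain ⟨K, hKp, hK, hKW, hK0⟩ := exists_K hρ hS hW hWp hs
  have hs1 : exp (s - 1) < exp s := exp_lt_exp.2 (by linarith)
  have hlapc : Continuous (lap K) := by
    have h0 := smAll_cont (smAll_pd (smAll_pd hK 0) 0)
    have h1 := smAll_cont (smAll_pd (smAll_pd hK 1) 1)
    exact h0.add h1
  have hintG : IntegrableOn (lap K) fund := by
    simpa using int_fund_cont (S := univ) isClosed_univ hlapc.continuousOn
  have e0 := int_lap hK hKp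
  have dec : ∀ x, lap K x = (perf V s).indicator (lap W) x + ∑ i, (nb (VP V i) s).indicator (lap K) x := by
    intro x
    by_cases hx : x ∈ perf V s
    · have h1 : lap K x = lap W x := by
        apply lap_congr
        filter_upwards [ball_mem_nhds x (sub_pos.2 hs1)] with y hy
        apply hKW
        intro z hz
        have h1 := hx z hz
        have h2 := dist_triangle_left x z y
        rw [mem_ball] at hy
        linarith
      have h2 : ∀ i, (nb (VP V i) s).indicator (lap K) x = 0 := by
        intro i
        apply indicator_of_notMem
        rintro ⟨v, hv, h⟩
        linarith [hx _ (memZ.2 ⟨i, v, hv, rfl⟩)]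
      rw [indicator_of_mem hx, h1]; simp [h2]
    · rw [indicator_of_notMem hx, zero_add]
      simp only [perf, mem_ofPred_eq] at hx
      push Not at hx
      obtain ⟨z, hz, hd⟩ := hx
      obtain ⟨i, v, hv, rfl⟩ := memZ.1 hz
      rw [Finset.sum_eq_single i]
      · rw [indicator_of_mem (show x ∈ nb (VP V i) s from ⟨v, hv, hd⟩)]
      · intro j _ hji
        apply indicator_of_notMem
        rintro ⟨w, hw, h⟩
        have := hS.eq (memZ.2 ⟨j, w, hw, rfl⟩) (memZ.2 ⟨i, v, hv, rfl⟩)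
          (h.trans_le (by linarith)) (hd.trans_le (by linarith))
        refine V.distinct j i hji (v - w) (lat_sub hv hw) ?_
        change VP V j = VP V i + (v - w)
        rw [← add_sub_assoc, ← this]; simp
      · simp
  have hlapWc : ContinuousOn (lap W) (perf V s) := by
    have hO : IsOpen (V.Z)ᶜ := (hS.isClosed hρ).isOpen_compl
    intro x hx
    have hx' := perf_notMem hx
    have h0 := (SmAt.pd hO (SmAt.pd hO hW 0) 0 x hx').continuousAt
    have h1 := (SmAt.pd hO (SmAt.pd hO hW 1) 1 x hx').continuousAt
    exact (h0.add h1).continuousWithinAt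
  have hi1 := int_fund_cont (perf_closed V s) hlapWc
  have hi2 : ∀ i ∈ Finset.univ, IntegrableOn ((nb (VP V i) s).indicator (lap K)) fund :=
    fun i _ => hintG.indicator (nb_open _ _).measurableSet
  have e1 : ∫ x in fund, lap K x = (∫ x in fund, (perf V s).indicator (lap W) x)
      + ∑ i, ∫ x in fund, (nb (VP V i) s).indicator (lap K) x := by
    rw [← integral_finsetSum _ hi2, ← integral_add hi1 (integrable_finsetSum _ hi2)]
    apply integral_congr_ae
    filter_upwards with x using dec x
  have e2 : ∀ i, ∫ x in fund, (nb (VP V i) s).indicator (lap K) x = cI (Dt (cyl (VP V i) W)) s := by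
    intro i
    have hpZ : VP V i ∈ V.Z := memZ.2 ⟨i, 0, lat_zero, by simp⟩
    rw [int_nb (lap_per hKp) _ (by linarith)]
    have hSm : Sm (s + 1) (cyl (VP V i) K) := fun z _ => (cyl_smAt (hK _)).contDiffWithinAt
    have b1 : ∫ x in ball (VP V i) (exp s), lap K x = ∫ x in ann (VP V i) (s - 3) s, lap K x := by
      apply setIntegral_eq_of_subset_of_forall_sdiff_eq_zero measurableSet_ball
      · intro x hx
        rw [mem_ball, dist_eq_norm]; exact hx.2
      · rintro x ⟨hx, hx'⟩
        rw [mem_ball, dist_eq_norm] at hx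
        have h3 : dist x (VP V i) < exp (s - 2) := by
          rw [dist_eq_norm]
          by_contra! h
          exact hx' ⟨(exp_le_exp.2 (by linarith)).trans h, hx⟩
        have h4 : K =ᶠ[𝓝 x] fun _ => 0 := by
          filter_upwards [isOpen_ball.mem_nhds (show x ∈ ball (VP V i) (exp (s - 2)) from h3)]
            with y hy using hK0 y _ hpZ hy
        rw [lap_congr h4]
        simp [lap, pd, lineDeriv]
    have hcc : ContinuousOn (cyl (VP V i) (lap K)) (strip (s + 1)) :=
      (hlapc.comp (PP_contDiff _).continuous).continuousOn
    rw [b1, polar_ann hcc (by linarith) (by linarith)]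
    have b2 : ∀ t, t < s + 1 → HasDerivAt (cI (Dt (cyl (VP V i) K)))
        (cI (fun z => exp (2 * z.1) * cyl (VP V i) (lap K) z) t) t := by
      intro t ht
      have h1 := cI_hasDerivAt hSm.dt ht
      refine h1.congr_deriv ?_
      have h2 := cI_dh hSm.dh (cyl_per _ K).dh ht
      have h3 := cI_add hSm.dt.dt.contOn hSm.dh.dh.contOn ht
      rw [h2, add_zero] at h3
      rw [← h3]
      apply cI_congr
      intro θ
      exact lap_cyl isOpen_univ (fun y _ => hK y) (mem_univ _)
    have hcont : ContinuousOn (cI (fun z => exp (2 * z.1) * cyl (VP V i) (lap K) z)) (Iio (s + 1)) := by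
      apply cI_contOn
      exact (by fun_prop : Continuous (fun z : ℝ × ℝ => exp (2 * z.1))).continuousOn.mul hcc
    rw [ftc b2 hcont (by linarith) (by linarith)]
    have c1 : cI (Dt (cyl (VP V i) K)) s = cI (Dt (cyl (VP V i) W)) s := by
      apply cI_congr
      intro θ
      have : cyl (VP V i) K =ᶠ[𝓝 (s, θ)] cyl (VP V i) W := by
        have hO : IsOpen {z : ℝ × ℝ | s - 1 < z.1 ∧ z.1 < log (2 * ρ)} :=
          (isOpen_lt continuous_const continuous_fst).inter (isOpen_lt continuous_fst continuous_const)
        have hmem : (s, θ) ∈ {z : ℝ × ℝ | s - 1 < z.1 ∧ z.1 < log (2 * ρ)} := by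
          refine ⟨by simp, ?_⟩
          rw [lt_log_iff_exp_lt (by linarith)]
          simp only; linarith
        filter_upwards [hO.mem_nhds hmem] with z hz
        apply hKW
        intro z' hz'
        have hd := PP_dist (VP V i) z
        have h2 : exp z.1 < 2 * ρ := by rw [← lt_log_iff_exp_lt (by linarith)]; exact hz.2
        by_cases hc : z' = VP V i
        · rw [hc, hd]; exact exp_le_exp.2 hz.1.le
        · have h3 := hS _ hpZ _ hz' (fun e => hc e.symm)
          have h4 := dist_triangle_left (VP V i) z' (PP (VP V i) z)
          linarith
      unfold Dt
      rw [this.fderiv_eq]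
    have c2 : cI (Dt (cyl (VP V i) K)) (s - 3) = 0 := by
      have : ∀ θ, Dt (cyl (VP V i) K) (s - 3, θ) = (fun _ => (0:ℝ)) (s - 3, θ) := by
        intro θ
        have h1 : Dt (cyl (VP V i) K) (s - 3, θ) = Dt (fun _ => 0) (s - 3, θ) := by
          refine Dt_congr (T := s - 2) ?_ (show s - 3 < s - 2 by linarith)
          intro z hz
          apply hK0 _ _ hpZ
          rw [PP_dist]; exact exp_lt_exp.2 hz
        rw [h1]; simp [Dt]
      unfold cI; simp [this]
    rw [c1, c2, sub_zero]
  rw [e0] at e1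
  simp only [e2] at e1
  linarith

/-! ### asymptotics at a vortex -/

lemma trig_bd {e c s A B M : ℝ} (he : 0 ≤ e) (hc : |c| ≤ 1) (hs : |s| ≤ 1) (hA : |A| ≤ M) (hB : |B| ≤ M) :
    |e * c * A + e * s * B| ≤ 2 * M * e := by
  have hM : 0 ≤ M := (abs_nonneg A).trans hA
  have h1 : |e * c * A| ≤ M * e := by
    rw [abs_mul, abs_mul, abs_of_nonneg he]
    have : |c| * |A| ≤ 1 * M := mul_le_mul hc hA (abs_nonneg _) zero_le_one
    nlinarith
  have h2 : |e * s * B| ≤ M * e := by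
    rw [abs_mul, abs_mul, abs_of_nonneg he]
    have : |s| * |B| ≤ 1 * M := mul_le_mul hs hB (abs_nonneg _) zero_le_one
    nlinarith
  have := abs_add_le (e * c * A) (e * s * B)
  linarith

lemma asy_sing {u : Pl → ℝ} {q : Pl} {a : ℝ} (h : LogSing u q a) :
    ∃ C a0, 0 ≤ C ∧ ∀ z, z.1 ≤ a0 → |cyl q u z - 2 * a * z.1| ≤ C ∧
      |Dt (cyl q u) z - 2 * a| ≤ C * exp z.1 ∧ |Dh (cyl q u) z| ≤ C * exp z.1 ∧
      |Dt (Dt (cyl q u)) z| ≤ C * exp z.1 := by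
  obtain ⟨r, hr, v, hv, huv⟩ := h
  have hO : IsOpen (ball q r) := isOpen_ball
  have hvS : ∀ y ∈ ball q r, SmAt v y := fun y hy => hv.contDiffAt (hO.mem_nhds hy)
  have hsub : closedBall q (r / 2) ⊆ ball q r := closedBall_subset_ball (by linarith)
  have bd : ∀ g : Pl → ℝ, (∀ y ∈ ball q r, SmAt g y) → ∃ B, ∀ x ∈ closedBall q (r / 2), |g x| ≤ B := by
    intro g hg
    obtain ⟨B, hB⟩ := (isCompact_closedBall q (r / 2)).exists_bound_of_continuousOn
      (f := g) (fun x hx => (hg x (hsub hx)).continuousAt.continuousWithinAt)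
    exact ⟨B, hB⟩
  have p0 := SmAt.pd hO hvS 0
  have p1 := SmAt.pd hO hvS 1
  obtain ⟨B, hB⟩ := bd v hvS
  obtain ⟨B0, hB0⟩ := bd _ p0
  obtain ⟨B1, hB1⟩ := bd _ p1
  obtain ⟨B00, hB00⟩ := bd _ (SmAt.pd hO p0 0)
  obtain ⟨B01, hB01⟩ := bd _ (SmAt.pd hO p0 1)
  obtain ⟨B10, hB10⟩ := bd _ (SmAt.pd hO p1 0)
  obtain ⟨B11, hB11⟩ := bd _ (SmAt.pd hO p1 1)
  set M := max B (max B0 (max B1 (max B00 (max B01 (max B10 B11))))) with hM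
  have i0 : B ≤ M := by simp [hM]
  have i1 : B0 ≤ M := by simp [hM]
  have i2 : B1 ≤ M := by simp [hM]
  have i3 : B00 ≤ M := by simp [hM]
  have i4 : B01 ≤ M := by simp [hM]
  have i5 : B10 ≤ M := by simp [hM]
  have i6 : B11 ≤ M := by simp [hM]
  have hM0 : 0 ≤ M := ((abs_nonneg _).trans (hB q (mem_closedBall_self (by linarith)))).trans i0
  refine ⟨6 * M, min (log (r / 2)) 0, by linarith, fun z hz => ?_⟩
  have hz1 : exp z.1 ≤ r / 2 := (le_log_iff_exp_le (by linarith)).1 (hz.trans (min_le_left _ _))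
  have hz0 : z.1 ≤ 0 := hz.trans (min_le_right _ _)
  have he0 := exp_pos z.1
  have he1 : exp z.1 ≤ 1 := exp_le_one_iff.2 hz0
  have hzT : z.1 < log r := by rw [lt_log_iff_exp_lt hr]; linarith
  have hmem : ∀ z : ℝ × ℝ, z.1 < log r → PP q z ∈ ball q r := by
    intro z hz
    rw [mem_ball, PP_dist]; exact (lt_log_iff_exp_lt hr).1 hz
  have hcb : PP q z ∈ closedBall q (r / 2) := by rw [mem_closedBall, PP_dist]; exact hz1
  have eq0 : ∀ z : ℝ × ℝ, z.1 < log r → cyl q u z = 2 * a * z.1 + cyl q v z := by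
    intro z hz
    unfold cyl
    rw [huv _ (hmem z hz) (PP_ne q z), PP_norm, log_exp]
  have hd : ∀ z : ℝ × ℝ, z.1 < log r → DifferentiableAt ℝ (cyl q v) z := fun z hz =>
    cyl_diff (hvS _ (hmem z hz)).diff
  have hSm : Sm (log r) (cyl q v) := fun z hz => (cyl_smAt (hvS _ (hmem z hz))).contDiffWithinAt
  have hd2 : ∀ z : ℝ × ℝ, z.1 < log r →
      DifferentiableAt ℝ (fun z : ℝ × ℝ => 2 * a * z.1 + cyl q v z) z := fun z hz =>
    ((differentiableAt_fst).const_mul (2 * a)).add (hd z hz)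
  have eq1 : ∀ z : ℝ × ℝ, z.1 < log r → Dt (cyl q u) z = 2 * a + Dt (cyl q v) z := by
    intro z hz
    rw [Dt_congr eq0 hz]
    apply Dt_eq (t := z.1) (θ := z.2) (hd2 z hz)
    have h1 := hasDerivAt_t (t := z.1) (θ := z.2) (hd z hz)
    exact (((hasDerivAt_id z.1).const_mul (2 * a)).add h1).congr_deriv (by simp)
  have eq2 : Dh (cyl q u) z = Dh (cyl q v) z := by
    rw [Dh_congr eq0 hzT]
    apply Dh_eq (t := z.1) (θ := z.2) (hd2 z hzT)
    have h1 := hasDerivAt_h (t := z.1) (θ := z.2) (hd z hzT)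
    exact h1.const_add (2 * a * z.1)
  have eq3 : Dt (Dt (cyl q u)) z = Dt (Dt (cyl q v)) z := by
    rw [Dt_congr eq1 hzT]
    have hdd := hSm.dt.diffAt hzT
    apply Dt_eq (t := z.1) (θ := z.2) (hdd.const_add (2 * a))
    exact (hasDerivAt_t (t := z.1) (θ := z.2) hdd).const_add (2 * a)
  have c0 := abs_cos_le_one z.2
  have c1 := abs_sin_le_one z.2
  have b0 : |cyl q (pd v 0) z| ≤ M := (hB0 _ hcb).trans i1
  have b1 : |cyl q (pd v 1) z| ≤ M := (hB1 _ hcb).trans i2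
  have b00 : |cyl q (pd (pd v 0) 0) z| ≤ M := (hB00 _ hcb).trans i3
  have b01 : |cyl q (pd (pd v 0) 1) z| ≤ M := (hB01 _ hcb).trans i4
  have b10 : |cyl q (pd (pd v 1) 0) z| ≤ M := (hB10 _ hcb).trans i5
  have b11 : |cyl q (pd (pd v 1) 1) z| ≤ M := (hB11 _ hcb).trans i6
  have hMe : 0 ≤ M * exp z.1 := mul_nonneg hM0 he0.le
  have hcv : |cyl q v z| ≤ M := (hB _ hcb).trans i0
  have t1 := trig_bd he0.le c0 c1 b0 b1
  refine ⟨?_, ?_, ?_, ?_⟩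
  · rw [eq0 z hzT, add_sub_cancel_left]
    linarith
  · rw [eq1 z hzT, add_sub_cancel_left, Dt_cyl (hvS _ (hmem z hzT)).diff]
    linarith
  · rw [eq2, Dh_cyl (hvS _ (hmem z hzT)).diff]
    have := trig_bd he0.le (by rwa [abs_neg] : |(-sin z.2)| ≤ 1) c0 b0 b1
    rw [show -(exp z.1 * sin z.2) = exp z.1 * -sin z.2 by ring]
    linarith
  · rw [eq3, DtDt_cyl hO hvS (hmem z hzT)]
    have u0 := trig_bd he0.le c0 c1 b00 b01
    have u1 := trig_bd he0.le c0 c1 b10 b11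
    have hk : 2 * M * exp z.1 ≤ 2 * M := by nlinarith
    have t2 := trig_bd he0.le c0 c1 (u0.trans hk) (u1.trans hk)
    refine (abs_le.2 ⟨?_, ?_⟩)
    · have := (abs_le.1 t1).1
      have := (abs_le.1 t2).1
      linarith
    · have := (abs_le.1 t1).2
      have := (abs_le.1 t2).2
      linarith

/-! ### integral identities on the perforated torus -/

lemma pd_of {q : Pl → ℝ} {x : Pl} {L : Pl →L[ℝ] ℝ} (h : HasFDerivAt q L x) (i : Fin 2) :
    pd q i x = L (EuclideanSpace.single i 1) := by
  rw [pd_eq h.differentiableAt, h.fderiv]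

lemma pd_comp {u : Pl → ℝ} {x : Pl} {F : ℝ → ℝ} {F' : ℝ} (hF : HasDerivAt F F' (u x))
    (hu : DifferentiableAt ℝ u x) (i : Fin 2) : pd (fun y => F (u y)) i x = F' * pd u i x := by
  have h : HasFDerivAt (fun y => F (u y)) _ x := hF.comp_hasFDerivAt x hu.hasFDerivAt
  rw [pd_of h i, pd_eq hu]; simp

lemma pd_mul' {f g : Pl → ℝ} {x : Pl} (hf : DifferentiableAt ℝ f x) (hg : DifferentiableAt ℝ g x)
    (i : Fin 2) : pd (fun y => f y * g y) i x = pd f i x * g x + f x * pd g i x := by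
  have h : HasFDerivAt (fun y => f y * g y) _ x := hf.hasFDerivAt.mul hg.hasFDerivAt
  rw [pd_of h i, pd_eq hf, pd_eq hg]; simp; ring

lemma lap_comp {u : Pl → ℝ} {O : Set Pl} (hO : IsOpen O) (hu : ∀ y ∈ O, SmAt u y) {H H1 H2 : ℝ → ℝ}
    (h1 : ∀ x, HasDerivAt H (H1 x) x) (h2 : ∀ x, HasDerivAt H1 (H2 x) x) {x : Pl} (hx : x ∈ O) :
    lap (fun y => H (u y)) x = H2 (u x) * gradSq u x + H1 (u x) * lap u x := by
  have e : ∀ i, pd (pd (fun y => H (u y)) i) i x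
      = H2 (u x) * pd u i x * pd u i x + H1 (u x) * pd (pd u i) i x := by
    intro i
    have ev : pd (fun y => H (u y)) i =ᶠ[𝓝 x] fun y => H1 (u y) * pd u i y := by
      filter_upwards [hO.mem_nhds hx] with y hy using pd_comp (h1 _) (hu y hy).diff i
    have hd : DifferentiableAt ℝ (fun y => H1 (u y)) x :=
      (h2 (u x)).differentiableAt.comp x (hu x hx).diff
    rw [pd_congr ev, pd_mul' hd (SmAt.pd hO hu i x hx).diff, pd_comp (h2 _) (hu x hx).diff]
  unfold lap gradSq
  rw [e 0, e 1]; ring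

def mm (V : VortexData) : Fin V.d₁ ⊕ Fin V.d₂ → ℝ := Sum.elim V.m₁ V.m₂

def Lam0 (V : VortexData) : ℝ := ∑ i, 2 * π * (2 * mm V i + 1)

lemma mm_nonneg (V : VortexData) (i) : 0 ≤ mm V i := by
  rcases i with i | i
  · exact V.m₁_nonneg i
  · exact V.m₂_nonneg i

lemma Lam0_nonneg (V : VortexData) : 0 ≤ Lam0 V := by
  apply Finset.sum_nonneg
  intro i _
  have := mm_nonneg V i
  positivity

lemma VP_mem (V : VortexData) (i) : VP V i ∈ V.Z := memZ.2 ⟨i, 0, lat_zero, by simp⟩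

lemma PP_notMem {V : VortexData} {ρ : ℝ} (hS : TSep V.Z ρ) {q : Pl} (hq : q ∈ V.Z) {z : ℝ × ℝ}
    (hz : exp z.1 < 4 * ρ) : PP q z ∉ V.Z := by
  intro h
  have := hS _ h _ hq (PP_ne q z)
  rw [PP_dist] at this
  linarith

section sol
variable {V : VortexData} {τ ε ρ : ℝ} {u : Pl → ℝ}

lemma sol_sm (hρ : 0 < ρ) (hS : TSep V.Z ρ) (hu : IsSolution V τ ε u) : ∀ x ∉ V.Z, SmAt u x :=
  fun _ hx => hu.smooth.contDiffAt ((hS.isClosed hρ).isOpen_compl.mem_nhds hx)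

lemma cyl_Sm (hρ : 0 < ρ) (hS : TSep V.Z ρ) {W : Pl → ℝ} (hW : ∀ x ∉ V.Z, SmAt W x) {q : Pl}
    (hq : q ∈ V.Z) {T : ℝ} (hT : exp T ≤ 2 * ρ) : Sm T (cyl q W) := by
  intro z hz
  apply (cyl_smAt (hW _ (PP_notMem hS hq _))).contDiffWithinAt
  have := exp_lt_exp.2 (show z.1 < T from hz)
  linarith

lemma sing_bd (hρ : 0 < ρ) (hu : IsSolution V τ ε u) :
    ∃ s0, exp s0 ≤ ρ ∧ ∀ s ≤ s0, ∀ i θ, |Dt (cyl (VP V i) u) (s, θ)| ≤ 2 * mm V i + 1 := by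
  have h1 : ∀ i, ∃ s0, ∀ s ≤ s0, ∀ θ, |Dt (cyl (VP V i) u) (s, θ)| ≤ 2 * mm V i + 1 := by
    intro i
    obtain ⟨a, ha, hL⟩ : ∃ a, |2 * a| = 2 * mm V i ∧ LogSing u (VP V i) a := by
      rcases i with i | i
      · exact ⟨V.m₁ i, abs_of_nonneg (mul_nonneg zero_le_two (V.m₁_nonneg i)), hu.sing₁ i⟩
      · refine ⟨-V.m₂ i, ?_, hu.sing₂ i⟩
        rw [mul_neg, abs_neg]
        exact abs_of_nonneg (mul_nonneg zero_le_two (V.m₂_nonneg i))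
    obtain ⟨C, a0, hC, h⟩ := asy_sing hL
    refine ⟨min a0 (log (1 / (C + 1))), fun s hs θ => ?_⟩
    have h2 := (h (s, θ) (hs.trans (min_le_left _ _))).2.1
    have h3 : exp s ≤ 1 / (C + 1) :=
      (le_log_iff_exp_le (by positivity)).1 (hs.trans (min_le_right _ _))
    have h4 : C * exp s ≤ 1 := by
      rw [le_div_iff₀ (by linarith)] at h3
      have := exp_pos s
      nlinarith
    simp only at h2
    rw [← ha]
    have := abs_add_le (Dt (cyl (VP V i) u) (s, θ) - 2 * a) (2 * a)
    rw [sub_add_cancel] at this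
    linarith
  choose σ hσ using h1
  obtain ⟨o, ho⟩ := Finite.exists_min (fun o : Option (Fin V.d₁ ⊕ Fin V.d₂) => o.elim (log ρ) σ)
  refine ⟨o.elim (log ρ) σ, ?_, fun s hs i θ => hσ i s (hs.trans (ho (some i))) θ⟩
  exact (le_log_iff_exp_le hρ).1 (ho none)

lemma grad_contOn (hρ : 0 < ρ) (hS : TSep V.Z ρ) (hu : IsSolution V τ ε u) :
    ContinuousOn (gradSq u) (V.Z)ᶜ := by
  intro x hx
  have hO : IsOpen (V.Z)ᶜ := (hS.isClosed hρ).isOpen_compl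
  have h0 := (SmAt.pd hO (sol_sm hρ hS hu) 0 x hx).continuousAt
  have h1 := (SmAt.pd hO (sol_sm hρ hS hu) 1 x hx).continuousAt
  exact ((h0.pow 2).add (h1.pow 2)).continuousWithinAt

lemma u_contOn (hu : IsSolution V τ ε u) : ContinuousOn u (V.Z)ᶜ := hu.smooth.continuousOn

theorem key_bd (hρ : 0 < ρ) (hρ8 : ρ ≤ 1 / 8) (hS : TSep V.Z ρ) (hu : IsSolution V τ ε u) {s : ℝ}
    (hs : exp s ≤ ρ) (hb : ∀ i θ, |Dt (cyl (VP V i) u) (s, θ)| ≤ 2 * mm V i + 1)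
    {H H1 H2 : ℝ → ℝ} (hH : ContDiff ℝ (⊤ : ℕ∞) H)
    (h1 : ∀ x, HasDerivAt H (H1 x) x) (h2 : ∀ x, HasDerivAt H1 (H2 x) x) {B : ℝ}
    (hB : ∀ x, |H1 x| ≤ B) :
    |∫ x in fund, (perf V s).indicator (fun x => H2 (u x) * gradSq u x
      - H1 (u x) * ((ε ^ 2)⁻¹ * fτ τ (u x))) x| ≤ B * Lam0 V := by
  have hO : IsOpen (V.Z)ᶜ := (hS.isClosed hρ).isOpen_compl
  have hus := sol_sm hρ hS hu
  have hW : ∀ x ∉ V.Z, SmAt (fun y => H (u y)) x := fun x hx => hH.contDiffAt.comp x (hus x hx)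
  have hWp : Periodic2 (fun y => H (u y)) := fun x v hv => by simp only [hu.periodic x v hv]
  have e := div_perf hρ hρ8 hS hW hWp hs
  have e2 : (perf V s).indicator (fun x => H2 (u x) * gradSq u x
      - H1 (u x) * ((ε ^ 2)⁻¹ * fτ τ (u x))) = (perf V s).indicator (lap (fun y => H (u y))) := by
    ext x
    by_cases hx : x ∈ perf V s
    · have hxZ := perf_notMem hx
      rw [indicator_of_mem hx, indicator_of_mem hx, lap_comp hO hus h1 h2 hxZ]
      have := hu.pde x hxZ
      linear_combination - H1 (u x) * this
    · rw [indicator_of_notMem hx, indicator_of_notMem hx]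
  rw [e2, e, abs_neg]
  refine (Finset.abs_sum_le_sum_abs _ _).trans ?_
  rw [Lam0, Finset.mul_sum]
  apply Finset.sum_le_sum
  intro i _
  have hT : exp (log (2 * ρ)) ≤ 2 * ρ := by rw [exp_log (by linarith)]
  have hsT : s < log (2 * ρ) := by rw [lt_log_iff_exp_lt (by linarith)]; linarith
  have hSm := cyl_Sm hρ hS hW (VP_mem V i) hT
  have hSu := cyl_Sm hρ hS hus (VP_mem V i) hT
  have := cI_abs (c := B * (2 * mm V i + 1)) hSm.dt.contOn hsT (fun θ => ?_)
  · linarith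
  · have : Dt (cyl (VP V i) fun y => H (u y)) (s, θ)
        = H1 (cyl (VP V i) u (s, θ)) * Dt (cyl (VP V i) u) (s, θ) := by
      apply Dt_eq (hSm.diffAt hsT)
      exact (h1 (cyl (VP V i) u (s, θ))).comp s (hasDerivAt_t (hSu.diffAt hsT))
    rw [this, abs_mul]
    exact mul_le_mul (hB _) (hb i θ) (abs_nonneg _) ((abs_nonneg _).trans (hB 0))

lemma abs_fτ_lin {τ : ℝ} (hτ : 0 < τ) (x : ℝ) : |fτ τ x| ≤ (1 + 1 / τ ^ 3) * |x| := by
  have hp := exp_pos x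
  have ht3 : 0 < 1 / τ ^ 3 := by positivity
  rcases le_total x 0 with hx | hx
  · rw [abs_of_nonneg (fτ_nonneg hτ hx), abs_of_nonpos hx]
    have h1 : 1 - exp x ≤ -x := by have := add_one_le_exp x; linarith
    have h2 : exp x ≤ 1 := exp_le_one_iff.2 hx
    have h3 : fτ τ x ≤ -x / τ ^ 3 := by
      unfold fτ
      apply div_le_div₀ (by linarith) _ (by positivity)
      · exact pow_le_pow_left₀ hτ.le (by linarith) 3
      · nlinarith
    have h4 : -x / τ ^ 3 = 1 / τ ^ 3 * -x := by ring
    nlinarith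
  · rw [abs_of_nonpos (fτ_nonpos hτ hx), abs_of_nonneg hx]
    have h1 : exp x - 1 ≤ x * exp x := by
      have h := add_one_le_exp (-x)
      have h' : exp (-x) * exp x = 1 := by rw [← exp_add]; simp
      nlinarith
    have h3 : - fτ τ x ≤ x := by
      unfold fτ
      rw [← neg_div, div_le_iff₀ (by positivity)]
      have h5 : exp x ^ 3 ≤ (τ + exp x) ^ 3 := pow_le_pow_left₀ hp.le (by linarith) 3
      have h6 : 1 ≤ exp x := one_le_exp hx
      calc -(exp x * (1 - exp x)) = exp x * (exp x - 1) := by ring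
        _ ≤ exp x * (x * exp x) := mul_le_mul_of_nonneg_left h1 hp.le
        _ = x * exp x ^ 2 := by ring
        _ ≤ x * exp x ^ 3 := mul_le_mul_of_nonneg_left (pow_le_pow_right₀ h6 (by norm_num)) hx
        _ ≤ _ := mul_le_mul_of_nonneg_left h5 hx
    nlinarith

def Ar : ℝ := ∫ _ in fund, (1 : ℝ)

lemma Ar_nonneg : 0 ≤ Ar := integral_nonneg fun _ => zero_le_one

lemma sqrt_deriv {κ : ℝ} (hκ : 0 < κ) (x : ℝ) :
    HasDerivAt (fun x => √(x ^ 2 + κ ^ 2)) (x / √(x ^ 2 + κ ^ 2)) x := by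
  have hpos : 0 < x ^ 2 + κ ^ 2 := by positivity
  have h := (((hasDerivAt_id x).pow 2).add_const (κ ^ 2)).sqrt (by simpa using hpos.ne')
  refine h.congr_deriv ?_
  have := (sqrt_pos.2 hpos).ne'
  simp only [id, Pi.pow_apply]
  field_simp
  simp

lemma sqrt_deriv2 {κ : ℝ} (hκ : 0 < κ) (x : ℝ) :
    HasDerivAt (fun x => x / √(x ^ 2 + κ ^ 2)) (κ ^ 2 / √(x ^ 2 + κ ^ 2) ^ 3) x := by
  have hpos : 0 < x ^ 2 + κ ^ 2 := by positivity
  have hs := sqrt_pos.2 hpos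
  have h := (hasDerivAt_id x).div (sqrt_deriv hκ x) hs.ne'
  refine h.congr_deriv ?_
  have hsq : √(x ^ 2 + κ ^ 2) ^ 2 = x ^ 2 + κ ^ 2 := sq_sqrt hpos.le
  have hne := hs.ne'
  simp only [id]
  field_simp
  linear_combination hsq

lemma perf_sub (V : VortexData) (s : ℝ) : perf V s ⊆ (V.Z)ᶜ := fun _ h => perf_notMem h

theorem mass_perf (hτ : 0 < τ) (hε : 0 < ε) (hρ : 0 < ρ) (hρ8 : ρ ≤ 1 / 8) (hS : TSep V.Z ρ)
    (hu : IsSolution V τ ε u) {s : ℝ}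
    (hs : exp s ≤ ρ) (hb : ∀ i θ, |Dt (cyl (VP V i) u) (s, θ)| ≤ 2 * mm V i + 1) :
    ∫ x in fund, (perf V s).indicator (fun x => (ε ^ 2)⁻¹ * |fτ τ (u x)|) x ≤ Lam0 V + Ar := by
  set E := (ε ^ 2)⁻¹ with hE
  have hE0 : 0 < E := by positivity
  set L := 1 + 1 / τ ^ 3 with hL
  have hL0 : 0 < L := by positivity
  set κ := 1 / (E * L) with hκd
  have hκ : 0 < κ := by positivity
  have hκE : E * L * κ = 1 := by rw [hκd]; field_simp
  have hpos : ∀ x : ℝ, 0 < x ^ 2 + κ ^ 2 := fun x => by positivity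
  have hsp : ∀ x : ℝ, 0 < √(x ^ 2 + κ ^ 2) := fun x => sqrt_pos.2 (hpos x)
  have hsx : ∀ x : ℝ, |x| ≤ √(x ^ 2 + κ ^ 2) := fun x => by
    apply abs_le_sqrt; nlinarith
  have hsx2 : ∀ x : ℝ, √(x ^ 2 + κ ^ 2) ≤ |x| + κ := fun x => by
    rw [sqrt_le_iff]
    refine ⟨by positivity, ?_⟩
    have := sq_abs x
    nlinarith [abs_nonneg x]
  have hH : ContDiff ℝ (⊤ : ℕ∞) (fun x : ℝ => √(x ^ 2 + κ ^ 2)) :=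
    ContDiff.sqrt (by fun_prop) (fun x => (hpos x).ne')
  have hB : ∀ x : ℝ, |x / √(x ^ 2 + κ ^ 2)| ≤ 1 := by
    intro x
    rw [abs_div, abs_of_pos (hsp x)]
    exact div_le_one_of_le₀ (hsx x) (hsp x).le
  have key := key_bd hρ hρ8 hS hu hs hb hH (sqrt_deriv hκ) (sqrt_deriv2 hκ) hB
  have key := (abs_le.1 key).2
  have hcu : ContinuousOn u (perf V s) := (u_contOn hu).mono (perf_sub V s)
  have hcf : ContinuousOn (fun x => fτ τ (u x)) (perf V s) :=
    (fτ_contDiff hτ).continuous.comp_continuousOn hcu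
  have hcg : ContinuousOn (gradSq u) (perf V s) := (grad_contOn hρ hS hu).mono (perf_sub V s)
  have hs0 : Continuous (fun x : ℝ => √(x ^ 2 + κ ^ 2)) := hH.continuous
  have hc1 : Continuous (fun x : ℝ => x / √(x ^ 2 + κ ^ 2)) := continuous_id.div hs0 (fun x => (hsp x).ne')
  have hc2 : Continuous (fun x : ℝ => κ ^ 2 / √(x ^ 2 + κ ^ 2) ^ 3) :=
    continuous_const.div (hs0.pow 3) (fun x => (pow_pos (hsp x) 3).ne')
  have hi1 := int_fund_cont (perf_closed V s) (((hc2.comp_continuousOn hcu).mul hcg).sub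
    ((hc1.comp_continuousOn hcu).mul (hcf.const_smul E)))
  have hi0 := int_fund_cont (perf_closed V s) (hcf.abs.const_smul E)
  have hi2 : IntegrableOn (fun _ => (1:ℝ)) fund := by
    simpa using int_fund_cont (S := univ) isClosed_univ (continuousOn_const (c := (1:ℝ)))
  have hle : ∀ x, (perf V s).indicator (fun x => E * |fτ τ (u x)|) x ≤
      (perf V s).indicator (fun x => κ ^ 2 / √(u x ^ 2 + κ ^ 2) ^ 3 * gradSq u x
      - u x / √(u x ^ 2 + κ ^ 2) * (E * fτ τ (u x))) x + 1 := by
    intro x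
    by_cases hx : x ∈ perf V s
    · rw [indicator_of_mem hx, indicator_of_mem hx]
      have g0 : 0 ≤ κ ^ 2 / √(u x ^ 2 + κ ^ 2) ^ 3 * gradSq u x := by
        unfold gradSq; have := hsp (u x); positivity
      have hsg : - (u x * fτ τ (u x)) = |u x| * |fτ τ (u x)| := by
        rw [← abs_mul, abs_of_nonpos]
        rcases le_total (u x) 0 with h | h
        · exact mul_nonpos_of_nonpos_of_nonneg h (fτ_nonneg hτ h)
        · exact mul_nonpos_of_nonneg_of_nonpos h (fτ_nonpos hτ h)
      have hq : - (u x / √(u x ^ 2 + κ ^ 2) * (E * fτ τ (u x)))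
          = E * (|u x| * |fτ τ (u x)|) / √(u x ^ 2 + κ ^ 2) := by rw [← hsg]; ring
      have h3 : E * |fτ τ (u x)| ≤ E * (|u x| * |fτ τ (u x)|) / √(u x ^ 2 + κ ^ 2) + 1 := by
        rw [← sub_le_iff_le_add, le_div_iff₀ (hsp _)]
        have hf := abs_fτ_lin hτ (u x)
        have m1 : E * |fτ τ (u x)| * √(u x ^ 2 + κ ^ 2) ≤ E * |fτ τ (u x)| * (|u x| + κ) :=
          mul_le_mul_of_nonneg_left (hsx2 _) (by positivity)
        have m2 : E * |fτ τ (u x)| * κ ≤ E * (L * |u x|) * κ := by gcongr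
        have m3 : E * (L * |u x|) * κ = |u x| := by
          calc _ = E * L * κ * |u x| := by ring
            _ = _ := by rw [hκE, one_mul]
        have := hsx (u x)
        nlinarith
      linarith
    · rw [indicator_of_notMem hx, indicator_of_notMem hx]; norm_num
  have := integral_mono hi0 (hi1.add hi2) hle
  rw [integral_add' hi1 hi2] at this
  refine this.trans ?_
  rw [one_mul] at key
  exact add_le_add key le_rfl

lemma arctan_int (c x : ℝ) : HasDerivAt (fun x => (x - c) * arctan (x - c) - log (1 + (x - c) ^ 2) / 2)
    (arctan (x - c)) x := by
  have h0 : HasDerivAt (fun x : ℝ => x - c) 1 x := (hasDerivAt_id x).sub_const c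
  have hp : 0 < 1 + (x - c) ^ 2 := by positivity
  have h1 := (Real.hasDerivAt_arctan (x - c)).comp x h0
  have h2 := (((h0.pow 2).const_add 1).log (by simpa using hp.ne')).div_const 2
  refine ((h0.mul h1).sub h2).congr_deriv ?_
  simp
  field_simp
  ring

lemma arctan_d (c x : ℝ) : HasDerivAt (fun x => arctan (x - c)) (1 / (1 + (x - c) ^ 2)) x := by
  have h0 : HasDerivAt (fun x : ℝ => x - c) 1 x := (hasDerivAt_id x).sub_const c
  have h1 := (Real.hasDerivAt_arctan (x - c)).comp x h0
  rw [mul_one] at h1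
  exact h1

theorem energy_perf (hτ : 0 < τ) (hε : 0 < ε) (hρ : 0 < ρ) (hρ8 : ρ ≤ 1 / 8) (hS : TSep V.Z ρ)
    (hu : IsSolution V τ ε u) {s : ℝ} (c : ℝ)
    (hs : exp s ≤ ρ) (hb : ∀ i θ, |Dt (cyl (VP V i) u) (s, θ)| ≤ 2 * mm V i + 1) :
    ∫ x in fund, (perf V s).indicator (fun x => gradSq u x / (1 + (u x - c) ^ 2)) x
      ≤ π / 2 * (2 * Lam0 V + Ar) := by
  set E := (ε ^ 2)⁻¹ with hE
  have hE0 : 0 < E := by positivity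
  have hB : ∀ x : ℝ, |arctan (x - c)| ≤ π / 2 := fun x =>
    abs_le.2 ⟨(neg_pi_div_two_lt_arctan _).le, (arctan_lt_pi_div_two _).le⟩
  have hH : ContDiff ℝ (⊤ : ℕ∞) (fun x : ℝ => (x - c) * arctan (x - c) - log (1 + (x - c) ^ 2) / 2) := by
    apply ContDiff.sub
    · exact (contDiff_id.sub contDiff_const).mul (Real.contDiff_arctan.comp (contDiff_id.sub contDiff_const))
    · apply ContDiff.div_const
      apply ContDiff.log
      · fun_prop
      · intro x; positivity
  have key := (abs_le.1 (key_bd hρ hρ8 hS hu hs hb hH (arctan_int c) (arctan_d c) hB)).2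
  have mass := mass_perf hτ hε hρ hρ8 hS hu hs hb
  have hcu : ContinuousOn u (perf V s) := (u_contOn hu).mono (perf_sub V s)
  have hcf : ContinuousOn (fun x => fτ τ (u x)) (perf V s) :=
    (fτ_contDiff hτ).continuous.comp_continuousOn hcu
  have hcg : ContinuousOn (gradSq u) (perf V s) := (grad_contOn hρ hS hu).mono (perf_sub V s)
  have hc1 : Continuous (fun x : ℝ => arctan (x - c)) := by fun_prop
  have hc2 : Continuous (fun x : ℝ => 1 / (1 + (x - c) ^ 2)) :=
    continuous_const.div (by fun_prop) (fun x => by positivity)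
  have hi1 := int_fund_cont (perf_closed V s) (((hc2.comp_continuousOn hcu).mul hcg).sub
    ((hc1.comp_continuousOn hcu).mul (hcf.const_smul E)))
  have hi2 := (int_fund_cont (perf_closed V s) (hcf.abs.const_smul E)).const_mul (π / 2)
  have hi0 := int_fund_cont (perf_closed V s)
    (hcg.div (((hcu.sub (continuousOn_const (c := c))).pow 2).const_add 1)
      (fun x _ => (by positivity : (1 + (u x - c) ^ 2) ≠ 0)))
  have hle : ∀ x, (perf V s).indicator (fun x => gradSq u x / (1 + (u x - c) ^ 2)) x ≤
      (perf V s).indicator (fun x => 1 / (1 + (u x - c) ^ 2) * gradSq u x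
      - arctan (u x - c) * (E * fτ τ (u x))) x
      + π / 2 * (perf V s).indicator (fun x => E * |fτ τ (u x)|) x := by
    intro x
    by_cases hx : x ∈ perf V s
    · rw [indicator_of_mem hx, indicator_of_mem hx, indicator_of_mem hx]
      have h1 : arctan (u x - c) * (E * fτ τ (u x)) ≤ π / 2 * (E * |fτ τ (u x)|) := by
        refine (le_abs_self _).trans ?_
        rw [abs_mul, abs_mul, abs_of_pos hE0]
        exact mul_le_mul_of_nonneg_right (hB _) (by positivity)
      have h2 : gradSq u x / (1 + (u x - c) ^ 2) = 1 / (1 + (u x - c) ^ 2) * gradSq u x := by ring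
      linarith
    · rw [indicator_of_notMem hx, indicator_of_notMem hx, indicator_of_notMem hx]; simp
  have h := integral_mono hi0 (hi1.add hi2) hle
  rw [integral_add' hi1 hi2, integral_const_mul] at h
  have hm := mul_le_mul_of_nonneg_left mass (by positivity : 0 ≤ π / 2)
  refine h.trans ((add_le_add key hm).trans ?_)
  linarith

end sol

/-! ### a solution on the torus gives a solution on the half cylinder -/

lemma int_ball_cont {q : Pl → ℝ} {S : Set Pl} (hS : IsClosed S) (hq : ContinuousOn q S) (c : Pl) (r : ℝ) :
    IntegrableOn (S.indicator q) (ball c r) := by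
  have hcpt : IsCompact (closedBall c r ∩ S) := (isCompact_closedBall c r).inter_right hS
  have h1 : IntegrableOn q (closedBall c r ∩ S) :=
    (hq.mono inter_subset_right).integrableOn_compact hcpt
  have h2 : IntegrableOn (S.indicator q) (closedBall c r) := by
    rw [IntegrableOn, integrable_indicator_iff hS.measurableSet, IntegrableOn,
      Measure.restrict_restrict hS.measurableSet, inter_comm]
    exact h1
  exact h2.mono_set ball_subset_closedBall

def LamT (V : VortexData) : ℝ := π / 2 * (2 * Lam0 V + Ar) + 1

lemma LamT_pos (V : VortexData) : 0 < LamT V := by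
  have := Lam0_nonneg V
  have := Ar_nonneg
  unfold LamT; positivity

section tr
variable {V : VortexData} {τ ε ρ : ℝ} {u : Pl → ℝ}

lemma transfer (hρ : 0 < ρ) (hρ8 : ρ ≤ 1 / 8) (hS : TSep V.Z ρ) {q : Pl → ℝ} (hq0 : ∀ x, 0 ≤ q x)
    (hqp : Periodic2 q) (hqc : ContinuousOn q (V.Z)ᶜ) (i) {T a b s : ℝ} (hT : exp T ≤ ρ)
    (hab : a ≤ b) (hb : b < T) (hs : s ≤ a) :
    ∫ t in a..b, cI (fun z => exp (2 * z.1) * cyl (VP V i) q z) t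
      ≤ ∫ x in fund, (perf V s).indicator q x := by
  have hbT : exp b < ρ := (exp_lt_exp.2 hb).trans_le hT
  have hcc : ContinuousOn (cyl (VP V i) q) (strip T) := by
    apply hqc.comp (PP_contDiff _).continuous.continuousOn
    intro z hz
    apply PP_notMem hS (VP_mem V i)
    have := exp_lt_exp.2 (show z.1 < T from hz)
    linarith
  rw [← polar_ann hcc hab hb]
  have hG0 : ∀ x, 0 ≤ (perf V s).indicator q x := indicator_nonneg (fun x _ => hq0 x)
  have hGp : Periodic2 ((perf V s).indicator q) := ind_per (fun x v hv => perf_per hv) hqp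
  have hqc' : ContinuousOn q (perf V s) := hqc.mono (perf_sub V s)
  have hsub : ann (VP V i) a b ⊆ ball (VP V i) (exp b) := fun x hx => by
    rw [mem_ball, dist_eq_norm]; exact hx.2
  have e1 : ∫ x in ann (VP V i) a b, q x = ∫ x in ann (VP V i) a b, (perf V s).indicator q x := by
    apply setIntegral_congr_fun (meas_ann _ _ _)
    intro x hx
    refine (indicator_of_mem ?_ q).symm
    intro z hz
    have h1 : exp s ≤ exp a := exp_le_exp.2 hs
    by_cases hc : z = VP V i
    · rw [hc, dist_eq_norm]; exact h1.trans hx.1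
    · have h3 := hS _ (VP_mem V i) _ hz (fun e => hc e.symm)
      have h4 := dist_triangle_left (VP V i) z x
      have h5 := hsub hx
      rw [mem_ball] at h5
      have h6 : exp s < ρ := (exp_le_exp.2 (hs.trans hab)).trans_lt hbT
      linarith
  rw [e1]
  refine (setIntegral_mono_set (int_ball_cont (perf_closed V s) hqc' (VP V i) (exp b))
    (Eventually.of_forall hG0) hsub.eventuallyLE).trans ?_
  rw [← int_nb hGp (VP V i) (by linarith : exp b ≤ 1 / 2)]
  have hi := int_fund_cont (perf_closed V s) hqc'
  apply integral_mono (hi.indicator (nb_open _ _).measurableSet) hi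
  intro x
  exact indicator_le_self' (fun x _ => hG0 x) x

theorem cylsol (hτ : 0 < τ) (hε : 0 < ε) (hρ : 0 < ρ) (hρ8 : ρ ≤ 1 / 8) (hS : TSep V.Z ρ)
    (hu : IsSolution V τ ε u) (j : Fin V.d₂) {T : ℝ} (hT : exp T ≤ ρ) {cf : ℝ → ℝ}
    (hcf : ∀ t0, ∀ x, (∀ y ∈ V.Z2, min (exp t0) ρ ≤ dist x y) → u x - 2 * log ε < cf t0) :
    CylSol τ (V.m₂ j) (ε ^ 2)⁻¹ T (LamT V) cf (cyl (V.p₂ j) u) := by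
  have hpi : 3 < π := pi_gt_three
  have hL0 := Lam0_nonneg V
  have hA0 := Ar_nonneg
  have hus := sol_sm hρ hS hu
  have hO : IsOpen (V.Z)ᶜ := (hS.isClosed hρ).isOpen_compl
  have hp : V.p₂ j ∈ V.Z := VP_mem V (Sum.inr j)
  have hT2 : exp T ≤ 2 * ρ := by linarith
  have hSm := cyl_Sm hρ hS hus hp hT2
  have hnm : ∀ z : ℝ × ℝ, z.1 < T → PP (V.p₂ j) z ∉ V.Z := by
    intro z hz
    apply PP_notMem hS hp
    have := exp_lt_exp.2 hz
    linarith
  obtain ⟨s0, hs0, hsb⟩ := sing_bd hρ hu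
  obtain ⟨C, a0, hC, hasy⟩ := asy_sing (hu.sing₂ j)
  refine ⟨hSm, cyl_per _ _, ?_, ?_, ?_, ?_, ?_, ?_⟩
  · intro z hz
    rw [lap_cyl hO hus (hnm z hz)]
    have := hu.pde _ (hnm z hz)
    unfold cyl
    linear_combination exp (2 * z.1) * this
  · intro δ hδ
    refine ⟨min a0 (log (δ / (C + 1))), fun z hz => ?_⟩
    obtain ⟨_, h1, h2, h3⟩ := hasy z (hz.trans (min_le_left _ _))
    have h4 : exp z.1 ≤ δ / (C + 1) :=
      (le_log_iff_exp_le (by positivity)).1 (hz.trans (min_le_right _ _))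
    have h5 : C * exp z.1 ≤ δ := by
      rw [le_div_iff₀ (by linarith)] at h4
      have := exp_pos z.1
      nlinarith
    refine ⟨?_, h2.trans h5, h3.trans h5⟩
    have e : Dt (cyl (V.p₂ j) u) z + 2 * V.m₂ j = Dt (cyl (V.p₂ j) u) z - 2 * -V.m₂ j := by ring
    rw [e]; exact h1.trans h5
  · refine ⟨C, a0, fun z hz => ?_⟩
    have e : cyl (V.p₂ j) u z + 2 * V.m₂ j * z.1 = cyl (V.p₂ j) u z - 2 * -V.m₂ j * z.1 := by ring
    rw [e]; exact (hasy z hz).1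
  · intro a b hab hb
    have hb' := hsb (min a s0) (min_le_right _ _)
    have hs' : exp (min a s0) ≤ ρ := (exp_le_exp.2 (min_le_right _ _)).trans hs0
    have h1 := mass_perf hτ hε hρ hρ8 hS hu hs' hb'
    have hq0 : ∀ x, 0 ≤ (ε ^ 2)⁻¹ * |fτ τ (u x)| := fun x => by positivity
    have hqp : Periodic2 (fun x => (ε ^ 2)⁻¹ * |fτ τ (u x)|) := fun x v hv => by
      simp only [hu.periodic x v hv]
    have hqc : ContinuousOn (fun x => (ε ^ 2)⁻¹ * |fτ τ (u x)|) (V.Z)ᶜ :=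
      ((fτ_contDiff hτ).continuous.comp_continuousOn (u_contOn hu)).abs.const_smul (ε ^ 2)⁻¹
    have h2 := transfer hρ hρ8 hS hq0 hqp hqc (Sum.inr j) hT hab hb (min_le_left a s0)
    have e : (fun z : ℝ × ℝ => (ε ^ 2)⁻¹ * exp (2 * z.1) * |fτ τ (cyl (V.p₂ j) u z)|)
        = fun z => exp (2 * z.1) * cyl (VP V (Sum.inr j)) (fun x => (ε ^ 2)⁻¹ * |fτ τ (u x)|) z := by
      funext z
      simp only [cyl, VP, Sum.elim_inr]; ring
    rw [e]
    refine h2.trans (h1.trans ?_)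
    unfold LamT
    nlinarith
  · intro c a b hab hb
    have hb' := hsb (min a s0) (min_le_right _ _)
    have hs' : exp (min a s0) ≤ ρ := (exp_le_exp.2 (min_le_right _ _)).trans hs0
    have h1 := energy_perf hτ hε hρ hρ8 hS hu c hs' hb'
    have hq0 : ∀ x, 0 ≤ gradSq u x / (1 + (u x - c) ^ 2) := fun x => by
      unfold gradSq; positivity
    have hqp : Periodic2 (fun x => gradSq u x / (1 + (u x - c) ^ 2)) := fun x v hv => by
      simp only [hu.periodic x v hv, gradSq_per hu.periodic x v hv]
    have hqc : ContinuousOn (fun x => gradSq u x / (1 + (u x - c) ^ 2)) (V.Z)ᶜ :=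
      (grad_contOn hρ hS hu).div ((((u_contOn hu).sub (continuousOn_const (c := c))).pow 2).const_add 1)
        (fun x _ => (by positivity : (1 + (u x - c) ^ 2) ≠ 0))
    have h2 := transfer hρ hρ8 hS hq0 hqp hqc (Sum.inr j) hT hab hb (min_le_left a s0)
    have e : ∀ t ∈ uIcc a b, cI (fun z : ℝ × ℝ => (Dt (cyl (V.p₂ j) u) z ^ 2 + Dh (cyl (V.p₂ j) u) z ^ 2)
        / (1 + (cyl (V.p₂ j) u z - c) ^ 2)) t
        = cI (fun z => exp (2 * z.1) * cyl (VP V (Sum.inr j))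
          (fun x => gradSq u x / (1 + (u x - c) ^ 2)) z) t := by
      intro t ht
      rw [uIcc_of_le hab] at ht
      apply cI_congr
      intro θ
      rw [grad_cyl (hus _ (hnm (t, θ) (ht.2.trans_lt hb))).diff]
      simp only [cyl, VP, Sum.elim_inr]; ring
    rw [intervalIntegral.integral_congr e]
    refine h2.trans (h1.trans ?_)
    unfold LamT
    linarith
  · intro t0 z hz0 hzT
    have h := hcf t0 (PP (V.p₂ j) z) ?_
    · have hl : log (ε ^ 2)⁻¹ = - (2 * log ε) := by rw [log_inv, log_pow]; norm_num
      rw [hl]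
      unfold cyl
      linarith
    · intro y hy
      have hyZ : y ∈ V.Z := Or.inr hy
      have hze := exp_lt_exp.2 hzT
      by_cases hc : y = V.p₂ j
      · rw [hc, PP_dist]; exact (min_le_left _ _).trans (exp_le_exp.2 hz0)
      · have h3 := hS _ hp _ hyZ (fun e => hc e.symm)
        have h4 := dist_triangle_left (V.p₂ j) y (PP (V.p₂ j) z)
        rw [PP_dist] at h4
        exact (min_le_right _ _).trans (by linarith)

end tr

/-! ### stability in cylinder coordinates -/

lemma fτ'_cont {τ : ℝ} (hτ : 0 < τ) : Continuous (fτ' τ) := by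
  unfold fτ'
  apply Continuous.div
  · fun_prop
  · fun_prop
  · intro x; positivity

lemma fτ'_bd {τ : ℝ} (hτ : 0 < τ) (t : ℝ) : |fτ' τ t| ≤ (3 * τ + 3) / τ ^ 2 := by
  have hp := exp_pos t
  unfold fτ'
  have e2 : exp (2 * t) = exp t ^ 2 := by rw [← exp_nat_mul]; norm_num
  rw [e2]
  set x := exp t with hx
  rw [abs_div, abs_of_pos (show 0 < (τ + x) ^ 4 by positivity), abs_mul, abs_of_pos hp]
  have h1 : |τ - 2 * (τ + 1) * x + x ^ 2| ≤ τ + 2 * (τ + 1) * x + x ^ 2 := by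
    have h1 : 0 ≤ (τ + 1) * x := by positivity
    have h2 : 0 ≤ x ^ 2 := by positivity
    rw [abs_le]; constructor <;> linarith
  have h2 : x * (τ + 2 * (τ + 1) * x + x ^ 2) * τ ^ 2 ≤ (3 * τ + 3) * (τ + x) ^ 4 := by
    have hx3 : x * τ ^ 3 ≤ 3 * (τ + x) ^ 4 := by
      have : 0 ≤ 3 * (τ + x) ^ 4 - 12 * x * τ ^ 3 := by
        have : 3 * (τ + x) ^ 4 - 12 * x * τ ^ 3 = 3 * τ ^ 4 + 18 * τ ^ 2 * x ^ 2 + 12 * τ * x ^ 3 + 3 * x ^ 4 := by ring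
        rw [this]; positivity
      have h0 : 0 ≤ x * τ ^ 3 := by positivity
      nlinarith
    have key : (3 * τ + 3) * (τ + x) ^ 4 - x * (τ + 2 * (τ + 1) * x + x ^ 2) * τ ^ 2
        = 3 * τ ^ 5 + 12 * τ ^ 4 * x + 16 * τ ^ 3 * x ^ 2 + 11 * τ ^ 2 * x ^ 3 + 3 * τ * x ^ 4
          + 3 * τ ^ 4 + 11 * τ ^ 3 * x + 16 * τ ^ 2 * x ^ 2 + 12 * τ * x ^ 3 + 3 * x ^ 4 := by ring
    have : 0 ≤ (3 * τ + 3) * (τ + x) ^ 4 - x * (τ + 2 * (τ + 1) * x + x ^ 2) * τ ^ 2 := by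
      rw [key]; positivity
    linarith
  rw [div_le_div_iff₀ (by positivity) (by positivity)]
  refine le_trans ?_ h2
  gcongr

lemma LogSing.shift {u : Pl → ℝ} {p w : Pl} {a : ℝ} (h : LogSing u p a) (hu : Periodic2 u)
    (hw : w ∈ unitLattice) : LogSing u (p + w) a := by
  obtain ⟨r, hr, v, hv, huv⟩ := h
  have hm : ∀ x, x ∈ ball (p + w) r → x - w ∈ ball p r := by
    intro x hx
    rw [mem_ball, dist_eq_norm] at *
    rwa [show x - w - p = x - (p + w) by abel]
  refine ⟨r, hr, fun x => v (x - w), ?_, ?_⟩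
  · exact hv.comp (contDiff_id.sub contDiff_const).contDiffOn hm
  · intro x hx hne
    have h1 := huv (x - w) (hm x hx) (fun e => hne (by rw [← e]; simp))
    have h2 := hu (x - w) w hw
    rw [sub_add_cancel] at h2
    rw [h2, h1, show x - w - p = x - (p + w) by abel]

def rad (u : Pl → ℝ) (q x : Pl) : ℝ := (x - q) 0 * pd u 0 x + (x - q) 1 * pd u 1 x

lemma rad_PP {u : Pl → ℝ} {q : Pl} {z : ℝ × ℝ} (h : DifferentiableAt ℝ u (PP q z)) :
    rad u q (PP q z) = Dt (cyl q u) z := by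
  rw [Dt_cyl h]
  simp [rad, PP, cyl]

lemma rad_smAt {u : Pl → ℝ} {q : Pl} {O : Set Pl} (hO : IsOpen O) (h : ∀ y ∈ O, SmAt u y) :
    ∀ y ∈ O, SmAt (rad u q) y := by
  intro y hy
  have hc : ∀ i : Fin 2, SmAt (fun x : Pl => (x - q) i) y := by
    intro i
    have : ContDiff ℝ (⊤ : ℕ∞) (fun x : Pl => (x - q) i) := by fun_prop
    exact this.contDiffAt
  exact ((hc 0).mul (SmAt.pd hO h 0 y hy)).add ((hc 1).mul (SmAt.pd hO h 1 y hy))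

lemma rad_sing {u v : Pl → ℝ} {q : Pl} {a r : ℝ} (hr : 0 < r) (hv : ContDiffOn ℝ (⊤ : ℕ∞) v (ball q r))
    (huv : ∀ x ∈ ball q r, x ≠ q → u x = 2 * a * Real.log ‖x - q‖ + v x) {x : Pl}
    (hx : x ∈ ball q r) (hne : x ≠ q) : rad u q x = 2 * a + rad v q x := by
  have hO : IsOpen (ball q r) := isOpen_ball
  have hvS : ∀ y ∈ ball q r, SmAt v y := fun y hy => hv.contDiffAt (hO.mem_nhds hy)
  obtain ⟨θ, hθ⟩ := PP_surj q hne
  set z : ℝ × ℝ := (log ‖x - q‖, θ) with hz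
  have hmem : ∀ z : ℝ × ℝ, z.1 < log r → PP q z ∈ ball q r := by
    intro z hz
    rw [mem_ball, PP_dist]; exact (lt_log_iff_exp_lt hr).1 hz
  have hnp : 0 < ‖x - q‖ := norm_pos_iff.2 (sub_ne_zero.2 hne)
  have hzT : z.1 < log r := by
    rw [mem_ball, dist_eq_norm] at hx
    exact log_lt_log hnp hx
  have eq0 : ∀ z : ℝ × ℝ, z.1 < log r → cyl q u z = 2 * a * z.1 + cyl q v z := by
    intro z hz
    unfold cyl
    rw [huv _ (hmem z hz) (PP_ne q z), PP_norm, log_exp]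
  have hd : DifferentiableAt ℝ (cyl q v) z := cyl_diff (hvS _ (hmem z hzT)).diff
  have hud : DifferentiableAt ℝ u (PP q z) := by
    rw [hθ]
    have ev : u =ᶠ[𝓝 x] fun x => 2 * a * Real.log ‖x - q‖ + v x := by
      filter_upwards [hO.mem_nhds hx, isOpen_ne.mem_nhds hne] with y hy hy' using huv y hy hy'
    refine DifferentiableAt.congr_of_eventuallyEq ?_ ev
    refine DifferentiableAt.add ?_ (hvS x hx).diff
    refine DifferentiableAt.const_mul ?_ _
    refine DifferentiableAt.log ?_ hnp.ne'
    exact (differentiableAt_id.sub_const q).norm ℝ (sub_ne_zero.2 hne)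
  have e1 := rad_PP hud
  have e2 := rad_PP (hvS _ (hmem z hzT)).diff
  rw [hθ] at e1 e2
  rw [e1, e2, Dt_congr eq0 hzT]
  apply Dt_eq (t := z.1) (θ := z.2) ((differentiableAt_fst.const_mul (2 * a)).add hd)
  have h1 := hasDerivAt_t (t := z.1) (θ := z.2) hd
  exact (((hasDerivAt_id z.1).const_mul (2 * a)).add h1).congr_deriv (by simp)

open Classical in
/-- local test function `χ(log r) r ∂_r u` -/
def ktest (χ : ℝ → ℝ) (u : Pl → ℝ) (m : ℝ) (z x : Pl) : ℝ :=
  if x = z then -(2 * m) else χ (log ‖x - z‖) * rad u z x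

section st
variable {V : VortexData} {τ ε ρ : ℝ} {u : Pl → ℝ}

lemma exists_test (hρ : 0 < ρ) (hS : TSep V.Z ρ)
    (hu : IsSolution V τ ε u) (j : Fin V.d₂) {T : ℝ} (hT : exp T ≤ ρ) {χ : ℝ → ℝ} {m1 m2 : ℝ}
    (hχ : ContDiff ℝ (⊤ : ℕ∞) χ) (hm : m2 < T) (h1 : ∀ t ≤ m1, χ t = 1)
    (h2 : ∀ t ≥ m2, χ t = 0) :
    ∃ φ : Pl → ℝ, (∀ x, SmAt φ x) ∧ Periodic2 φ ∧
      (∀ z : ℝ × ℝ, z.1 < T → cyl (V.p₂ j) φ z = χ z.1 * Dt (cyl (V.p₂ j) u) z) ∧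
      (∀ x, (∀ v ∈ unitLattice, exp m2 ≤ dist x (V.p₂ j + v)) → φ x = 0) := by
  set p := V.p₂ j with hpd
  have hus := sol_sm hρ hS hu
  have hO : IsOpen (V.Z)ᶜ := (hS.isClosed hρ).isOpen_compl
  set S : Set Pl := {x | ∃ v ∈ unitLattice, x = p + v} with hSd
  have hSZ : S ⊆ V.Z := by
    rintro x ⟨v, hv, rfl⟩
    exact memZ.2 ⟨Sum.inr j, v, hv, rfl⟩
  have hS' : TSep S ρ := fun z hz z' hz' hne => hS z (hSZ hz) z' (hSZ hz') hne
  have hSL : LatInv S := by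
    rintro z ⟨w, hw, rfl⟩ v hv
    exact ⟨w + v, lat_add hw hv, by rw [add_assoc]⟩
  have hpS : p ∈ S := ⟨0, lat_zero, by simp⟩
  have hm2ρ : exp m2 < ρ := (exp_lt_exp.2 hm).trans_le hT
  have hk0 : ∀ z x, exp m2 ≤ dist x z → ktest χ u (V.m₂ j) z x = 0 := by
    intro z x hd
    have hne : x ≠ z := by
      rintro rfl
      rw [dist_self] at hd
      linarith [exp_pos m2]
    unfold ktest
    rw [if_neg hne, h2, zero_mul]
    rw [← dist_eq_norm]
    exact (le_log_iff_exp_le ((exp_pos m2).trans_le hd)).2 hd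
  have hk : ∀ z ∈ S, ∀ x, ρ ≤ dist x z → ktest χ u (V.m₂ j) z x = (fun _ => (0:ℝ)) x :=
    fun z _ x hd => hk0 z x (by linarith)
  refine ⟨glue S ρ (ktest χ u (V.m₂ j)) (fun _ => 0), ?_, ?_, ?_, ?_⟩
  · apply glue_sm hρ hS' hk _ (fun _ _ => contDiffAt_const)
    intro z hz x hd
    by_cases hne : x = z
    · subst hne
      obtain ⟨w, hw, hxw⟩ := hz
      have hL : LogSing u x (-(V.m₂ j)) := by
        rw [hxw]; exact (hu.sing₂ j).shift hu.periodic hw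
      obtain ⟨r, hr, v, hv, huv⟩ := hL
      have hvS : ∀ y ∈ ball x r, SmAt v y := fun y hy => hv.contDiffAt (isOpen_ball.mem_nhds hy)
      have ev : ktest χ u (V.m₂ j) x =ᶠ[𝓝 x] fun y => 2 * -(V.m₂ j) + rad v x y := by
        filter_upwards [ball_mem_nhds x hr, ball_mem_nhds x (exp_pos m1)] with y hy hy'
        unfold ktest
        by_cases hyx : y = x
        · rw [if_pos hyx, hyx]; simp [rad]
        · rw [if_neg hyx, rad_sing hr hv huv hy hyx, h1, one_mul]
          rw [mem_ball, dist_eq_norm] at hy'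
          have : 0 < ‖y - x‖ := norm_pos_iff.2 (sub_ne_zero.2 hyx)
          exact ((log_lt_iff_lt_exp this).2 hy').le
      exact (contDiffAt_const.add (rad_smAt isOpen_ball hvS x (mem_ball_self hr))).congr_of_eventuallyEq ev
    · have ev : ktest χ u (V.m₂ j) z =ᶠ[𝓝 x] fun y => χ (log ‖y - z‖) * rad u z y := by
        filter_upwards [isOpen_ne.mem_nhds hne] with y hy
        unfold ktest
        rw [if_neg hy]
      have hxZ : x ∉ V.Z := by
        intro hx
        exact hne (hS.eq hx (hSZ hz) (by rw [dist_self]; linarith) hd)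
      refine ContDiffAt.congr_of_eventuallyEq ?_ ev
      refine ContDiffAt.mul ?_ (rad_smAt hO hus x hxZ)
      refine hχ.contDiffAt.comp x ?_
      refine ContDiffAt.log ?_ (norm_ne_zero_iff.2 (sub_ne_zero.2 hne))
      exact (contDiffAt_id.sub contDiffAt_const).norm ℝ (sub_ne_zero.2 hne)
  · apply glue_per hS' hSL _ (fun _ _ _ => rfl)
    intro z x v hv
    unfold ktest rad
    simp only [add_left_inj, add_sub_add_right_eq_sub, pd_per hu.periodic 0 x v hv,
      pd_per hu.periodic 1 x v hv]
  · intro z hz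
    have hze := exp_lt_exp.2 hz
    have hd : dist (PP p z) p < 2 * ρ := by rw [PP_dist]; linarith
    have hnm : PP p z ∉ V.Z := PP_notMem hS (hSZ hpS) (by linarith)
    have e : cyl p (glue S ρ (ktest χ u (V.m₂ j)) (fun _ => 0)) z = ktest χ u (V.m₂ j) p (PP p z) :=
      glue_in hS' hpS hd
    rw [e]
    unfold ktest
    rw [if_neg (PP_ne p z), PP_norm, log_exp, rad_PP (hus _ hnm).diff]
  · intro x hx
    by_cases hn : ∃ z, z ∈ S ∧ dist x z < 2 * ρ
    · obtain ⟨z, hz, hd⟩ := hn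
      rw [glue_in hS' hz hd]
      obtain ⟨v, hv, rfl⟩ := hz
      exact hk0 _ _ (hx v hv)
    · unfold glue; rw [dif_neg hn]

theorem stabc (hτ : 0 < τ) (hρ : 0 < ρ) (hρ8 : ρ ≤ 1 / 8) (hS : TSep V.Z ρ)
    (hu : IsSolution V τ ε u) (hst : Stable τ ε u) (j : Fin V.d₂) {T : ℝ} (hT : exp T ≤ ρ) :
    StabC τ (ε ^ 2)⁻¹ T (cyl (V.p₂ j) u) := by
  intro χ m1 m2 hχ hm12 hm2 h1 h2 δ hδ
  obtain ⟨φ, hφ, hφp, hφc, hφ0⟩ := exists_test hρ hS hu j hT hχ hm2 h1 h2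
  have hus := sol_sm hρ hS hu
  set E := (ε ^ 2)⁻¹ with hE
  set p := V.p₂ j with hpd
  have hpZ : p ∈ V.Z := VP_mem V (Sum.inr j)
  have hQ : 0 ≤ ∫ x in fund, (gradSq φ x - E * fτ' τ (u x) * (φ x) ^ 2) :=
    hst φ (contDiff_iff_contDiffAt.2 hφ) hφp
  set G : Pl → ℝ := fun x => gradSq φ x - E * fτ' τ (u x) * (φ x) ^ 2 with hG
  have hGp : Periodic2 G := fun x v hv => by
    simp only [hG, hφp x v hv, hu.periodic x v hv, gradSq_per hφp x v hv]
  obtain ⟨m3, hm23, hm3⟩ := exists_between hm2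
  have hm3ρ : exp m3 < ρ := (exp_lt_exp.2 hm3).trans_le hT
  have hunf := unfold_ball hGp p (r := exp m3) (by linarith) (by
    intro x hx
    have ev : φ =ᶠ[𝓝 x] fun _ => 0 := by
      filter_upwards [ball_mem_nhds x (sub_pos.2 (exp_lt_exp.2 hm23))] with y hy
      apply hφ0
      intro v hv
      have h1 := hx v hv
      have h2 := dist_triangle_left x (p + v) y
      rw [mem_ball] at hy
      linarith
    have e1 : gradSq φ x = 0 := by rw [gradSq_congr ev]; simp [gradSq, pd, lineDeriv]
    have e2 : φ x = 0 := ev.eq_of_nhds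
    simp only [hG, e1, e2]; ring)
  rw [hunf] at hQ
  -- boundedness and integrability
  have hgc : Continuous (gradSq φ) :=
    ((smAll_cont (smAll_pd hφ 0)).pow 2).add ((smAll_cont (smAll_pd hφ 1)).pow 2)
  have hφcont : Continuous φ := smAll_cont hφ
  obtain ⟨B1, hB1⟩ := (isCompact_closedBall p (exp m3)).exists_bound_of_continuousOn hgc.continuousOn
  obtain ⟨B2, hB2⟩ := (isCompact_closedBall p (exp m3)).exists_bound_of_continuousOn hφcont.continuousOn
  have hpc : p ∈ closedBall p (exp m3) := mem_closedBall_self (exp_pos _).le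
  have hB20 : 0 ≤ B2 := (norm_nonneg _).trans (hB2 p hpc)
  have hE0 : 0 ≤ E := by positivity
  set K := (3 * τ + 3) / τ ^ 2 with hK
  have hK0 : 0 ≤ K := by positivity
  set B := B1 + E * K * B2 ^ 2 with hBd
  have hGB : ∀ x ∈ ball p (exp m3), ‖G x‖ ≤ B := by
    intro x hx
    have hx' := ball_subset_closedBall hx
    have a1 := hB1 x hx'
    have a2 := hB2 x hx'
    have a3 := fτ'_bd hτ (u x)
    rw [Real.norm_eq_abs] at *
    have a4 : |E * fτ' τ (u x) * φ x ^ 2| ≤ E * K * B2 ^ 2 := by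
      rw [abs_mul, abs_mul, abs_of_nonneg hE0, abs_pow]
      gcongr
    exact (abs_sub _ _).trans (add_le_add a1 a4)
  have hB0 : 0 ≤ B := (norm_nonneg _).trans (hGB p (mem_ball_self (exp_pos _)))
  have hGcZ : ContinuousOn G (V.Z)ᶜ :=
    hgc.continuousOn.sub (((((fτ'_cont hτ).comp_continuousOn (u_contOn hu))).const_smul E).mul
      (hφcont.pow 2).continuousOn)
  have hsubZ : ball p (exp m3) \ {p} ⊆ (V.Z)ᶜ := by
    rintro x ⟨hx, hxp⟩ hxZ
    rw [mem_ball] at hx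
    exact hxp (hS.eq hxZ hpZ (by rw [dist_self]; linarith) (by linarith))
  have hfin : volume (ball p (exp m3)) < ⊤ := measure_ball_lt_top
  have hintG : IntegrableOn G (ball p (exp m3)) := by
    have hi : IntegrableOn G (ball p (exp m3) \ {p}) := by
      haveI : IsFiniteMeasure (volume.restrict (ball p (exp m3) \ {p})) :=
        ⟨by rw [Measure.restrict_apply_univ]; exact (measure_mono diff_subset).trans_lt hfin⟩
      refine Integrable.of_bound ((hGcZ.mono hsubZ).aestronglyMeasurable
        (measurableSet_ball.diff (measurableSet_singleton p))) B ?_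
      filter_upwards [ae_restrict_mem (measurableSet_ball.diff (measurableSet_singleton p))] with x hx
        using hGB x hx.1
    exact hi.congr_set_ae (sdiff_null_ae_eq_self (measure_singleton p)).symm
  -- small ball
  refine ⟨min (log (δ / (B * π + 1)) / 2) m2, fun a ha ham2 => ?_⟩
  have hBπ : 0 < B * π + 1 := by positivity
  have hae : B * (π * exp a ^ 2) ≤ δ := by
    have h3 : exp (2 * a) ≤ δ / (B * π + 1) := by
      apply (le_log_iff_exp_le (by positivity)).1
      have := ha.trans (min_le_left _ _)
      linarith
    have h4 : exp (2 * a) = exp a ^ 2 := by rw [← exp_nat_mul]; norm_num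
    rw [le_div_iff₀ hBπ, h4] at h3
    have : 0 ≤ exp a ^ 2 := by positivity
    linarith
  have ham3 : a ≤ m3 := ham2.trans hm23.le
  have hsm : ‖∫ x in ball p (exp a), G x‖ ≤ δ := by
    have := norm_setIntegral_le_of_norm_le_const (f := G) (s := ball p (exp a)) (μ := volume)
      (C := B) measure_ball_lt_top
      (fun x hx => hGB x (ball_subset_ball (exp_le_exp.2 ham3) hx))
    refine this.trans (le_trans (le_of_eq ?_) hae)
    congr 1
    rw [Measure.real, EuclideanSpace.volume_ball_fin_two]
    simp [exp_pos, (exp_pos a).le, pi_pos.le]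
    ring
  have hsplit : ∫ x in ball p (exp m3), G x = (∫ x in ball p (exp a), G x) + ∫ x in ann p a m3, G x := by
    rw [← setIntegral_union _ (meas_ann _ _ _) (hintG.mono_set (ball_subset_ball (exp_le_exp.2 ham3)))
      (hintG.mono_set (fun x hx => by rw [mem_ball, dist_eq_norm]; exact hx.2))]
    · congr 2
      ext x
      simp only [mem_ball, dist_eq_norm, mem_union, ann, mem_ofPred_eq]
      constructor
      · intro h
        by_cases h' : ‖x - p‖ < exp a
        · exact Or.inl h'
        · exact Or.inr ⟨not_lt.1 h', h⟩
      · rintro (h | h)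
        · exact h.trans_le (exp_le_exp.2 ham3)
        · exact h.2
    · rw [Set.disjoint_left]
      intro x hx hx'
      rw [mem_ball, dist_eq_norm] at hx
      exact absurd hx'.1 (not_le.2 hx)
  have hnm : ∀ z : ℝ × ℝ, z.1 < T → PP p z ∉ V.Z := by
    intro z hz
    apply PP_notMem hS hpZ
    have := exp_lt_exp.2 hz
    linarith
  have hGcyl : ContinuousOn (cyl p G) (strip T) :=
    hGcZ.comp (PP_contDiff _).continuous.continuousOn (fun z hz => hnm z hz)
  have hpol := polar_ann hGcyl ham3 hm3
  have hdz : ∀ z : ℝ × ℝ, z.1 < T → exp (2 * z.1) * cyl p G z = dens τ E χ (cyl p u) z := by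
    intro z hz
    have hg := grad_cyl (p := p) (z := z) (hφ _).diff
    rw [Dt_congr hφc hz, Dh_congr hφc hz] at hg
    have hc := hφc z hz
    unfold dens
    rw [hg, ← hc]
    simp only [cyl, hG]; ring
  have hcont : ContinuousOn (cI (dens τ E χ (cyl p u))) (Iio T) := by
    apply cI_contOn
    refine ContinuousOn.congr ((by fun_prop : Continuous (fun z : ℝ × ℝ => exp (2 * z.1))).continuousOn.mul
      hGcyl) (fun z hz => (hdz z hz).symm)
  have hintG' : ∀ c d, c ≤ d → d < T → IntervalIntegrable (cI (dens τ E χ (cyl p u))) volume c d := by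
    intro c d hcd hd
    apply ContinuousOn.intervalIntegrable
    apply hcont.mono
    rw [uIcc_of_le hcd]
    exact fun t ht => ht.2.trans_lt hd
  have e3 : ∫ t in a..m3, cI (fun z => exp (2 * z.1) * cyl p G z) t
      = ∫ t in a..m3, cI (dens τ E χ (cyl p u)) t := by
    apply intervalIntegral.integral_congr
    intro t ht
    rw [uIcc_of_le ham3] at ht
    exact cI_congr (fun θ => hdz (t, θ) (ht.2.trans_lt hm3))
  have e4 : ∫ t in m2..m3, cI (dens τ E χ (cyl p u)) t = 0 := by
    apply intervalIntegral.integral_zero_ae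
    refine Eventually.of_forall fun t ht => ?_
    rw [uIoc_of_le hm23.le] at ht
    have : ∀ θ, dens τ E χ (cyl p u) (t, θ) = 0 := by
      intro θ
      have ev : (fun z : ℝ × ℝ => χ z.1 * Dt (cyl p u) z) =ᶠ[𝓝 (t, θ)] fun _ => 0 := by
        have ho : IsOpen {z : ℝ × ℝ | m2 < z.1} := isOpen_lt continuous_const continuous_fst
        filter_upwards [ho.mem_nhds (show (t, θ) ∈ {z : ℝ × ℝ | m2 < z.1} from ht.1)] with z hz
        have hz : m2 < z.1 := hz
        rw [h2 _ hz.le, zero_mul]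
      unfold dens Dt Dh
      unfold Dt at ev
      rw [ev.fderiv_eq, h2 _ ht.1.le]; simp
    unfold cI
    simp [this]
  have e5 := intervalIntegral.integral_add_adjacent_intervals (hintG' a m2 ham2 hm2)
    (hintG' m2 m3 hm23.le hm3)
  rw [e4, add_zero] at e5
  rw [e5, ← e3, ← hpol]
  have := (abs_le.1 (by rwa [Real.norm_eq_abs] at hsm)).2
  rw [hsplit] at hQ
  linarith

end st

/-- **Lemma 4.4.** Let `u_ε` be stable solutions of `(E_ε)` with
`u_ε − 2 ln ε < c_r` away from `Z₂`, fix `p = p_{j,2}` and let `û_ε(x) = u_ε(p + ε(x−p))`.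
If `τ = 1` or `m_{j,2} ∈ [0,1]` then `sup_{|x−p|=η} û_ε(x) → −∞` for every `η > 0`;
moreover, if `w_ε = u_ε − 2 ln ε` converges in `C²_loc(Ω∖Z₂)`, the same conclusion holds
without any restriction on `τ` and `m_{j,2}`. -/
theorem blow_down_on_spheres
    (V : VortexData) (τ : ℝ) (hτ : 0 < τ)
    (ε : ℕ → ℝ) (hε : ∀ n, 0 < ε n) (hε0 : Tendsto ε atTop (nhds 0))
    (u : ℕ → Pl → ℝ) (hu : ∀ n, IsSolution V τ (ε n) (u n))
    (hstab : ∀ n, Stable τ (ε n) (u n))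
    (hupper : ∀ r > 0, ∃ c > 0, ∀ n : ℕ, ∀ x : Pl, (∀ y ∈ V.Z2, r ≤ dist x y) →
        u n x - 2 * Real.log (ε n) < c)
    (j : Fin V.d₂) :
    ((τ = 1 ∨ V.m₂ j ∈ Icc (0:ℝ) 1) →
      ∀ η > 0, Tendsto
        (fun n => sSup ((fun x => u n (V.p₂ j + ε n • (x - V.p₂ j))) '' sphere (V.p₂ j) η))
        atTop atBot) ∧
    ((∃ w : Pl → ℝ,
        TendstoC2LocOn (fun n x => u n x - 2 * Real.log (ε n)) w (V.Z2)ᶜ) →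
      ∀ η > 0, Tendsto
        (fun n => sSup ((fun x => u n (V.p₂ j + ε n • (x - V.p₂ j))) '' sphere (V.p₂ j) η))
        atTop atBot) := by
  obtain ⟨ρ, hρ, hρ8, hS⟩ := Z_sep V
  have hT : exp (log ρ) ≤ ρ := (exp_log hρ).le
  have hpZ : V.p₂ j ∈ V.Z := VP_mem V (Sum.inr j)
  choose! c hc0 hc using hupper
  set cf : ℝ → ℝ := fun t0 => c (min (exp t0) ρ) with hcf
  have hsol : ∀ n, CylSol τ (V.m₂ j) ((ε n) ^ 2)⁻¹ (log ρ) (LamT V) cf (cyl (V.p₂ j) (u n)) := fun n =>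
    cylsol hτ (hε n) hρ hρ8 hS (hu n) j hT
      (fun t0 x hx => hc _ (lt_min (exp_pos _) hρ) n x hx)
  have hst : ∀ n, StabC τ ((ε n) ^ 2)⁻¹ (log ρ) (cyl (V.p₂ j) (u n)) := fun n =>
    stabc hτ hρ hρ8 hS (hu n) (hstab n) j hT
  have hE : Tendsto (fun n => ((ε n) ^ 2)⁻¹) atTop atTop := by
    apply Tendsto.inv_tendsto_nhdsGT_zero
    apply tendsto_nhdsWithin_iff.2
    refine ⟨?_, Eventually.of_forall fun n => pow_pos (hε n) 2⟩
    simpa using hε0.pow 2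
  have hlogE : ∀ n, log ((ε n) ^ 2)⁻¹ = - (2 * log (ε n)) := fun n => by
    rw [log_inv, log_pow]; norm_num
  have core : ∀ η > 0, (∀ C0 : ℝ, ∀ᶠ n in atTop, ∀ θ,
      cyl (V.p₂ j) (u n) (log η - log ((ε n) ^ 2)⁻¹ / 2, θ) < -C0) → Tendsto
        (fun n => sSup ((fun x => u n (V.p₂ j + ε n • (x - V.p₂ j))) '' sphere (V.p₂ j) η))
        atTop atBot := by
    intro η hη H
    rw [tendsto_atBot]
    intro b
    filter_upwards [H (-b)] with n hn
    apply csSup_le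
    · refine Set.Nonempty.image _ ⟨PP (V.p₂ j) (log η, 0), ?_⟩
      rw [mem_sphere, PP_dist, exp_log hη]
    · rintro _ ⟨x, hx, rfl⟩
      rw [mem_sphere, dist_eq_norm] at hx
      have hnorm : ‖V.p₂ j + ε n • (x - V.p₂ j) - V.p₂ j‖ = ε n * η := by
        rw [add_sub_cancel_left, norm_smul, hx, Real.norm_of_nonneg (hε n).le]
      have hne : V.p₂ j + ε n • (x - V.p₂ j) ≠ V.p₂ j := by
        intro h
        rw [h, sub_self, norm_zero] at hnorm
        exact (mul_pos (hε n) hη).ne hnorm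
      obtain ⟨θ, hθ⟩ := PP_surj _ hne
      have e : log η - log ((ε n) ^ 2)⁻¹ / 2 = log ‖V.p₂ j + ε n • (x - V.p₂ j) - V.p₂ j‖ := by
        rw [hnorm, log_mul (hε n).ne' hη.ne', hlogE]; ring
      have h := hn θ
      rw [e] at h
      simp only [cyl] at h
      rw [hθ] at h
      show u n (V.p₂ j + ε n • (x - V.p₂ j)) ≤ b
      linarith
  refine ⟨fun hcase η hη => core η hη fun C0 => ?_, ?_⟩
  · obtain ⟨M, hM⟩ := lemmaB hτ (V.m₂_nonneg j) (LamT_pos V) (log ρ) cf hη C0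
      (hcase.imp id fun h => h.2)
    have hA := lemmaA hτ (V.m₂_nonneg j) (LamT_pos V) (log ρ) cf hη C0 M
    filter_upwards [hE.eventually hM, hE.eventually hA] with n h1 h2 θ
    rcases lt_or_ge (avg (cyl (V.p₂ j) (u n)) (log ρ - 2)) (- log ((ε n) ^ 2)⁻¹ - M) with h | h
    · exact h1 _ (hsol n) (hst n) h θ
    · exact h2 _ (hsol n) h θ
  · rintro ⟨w, hw, -, -⟩ η hη
    refine core η hη fun C0 => ?_
    have hlt : exp (log ρ - 2) < ρ := by
      calc exp (log ρ - 2) < exp (log ρ) := exp_lt_exp.2 (by linarith)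
        _ = ρ := exp_log hρ
    set K : Set Pl := sphere (V.p₂ j) (exp (log ρ - 2)) with hK
    have hKc : IsCompact K := isCompact_sphere _ _
    have hKZ : K ⊆ (V.Z)ᶜ := by
      intro x hx hxZ
      rw [hK, mem_sphere] at hx
      have hxp : x = V.p₂ j :=
        hS.eq hxZ hpZ (by rw [dist_self]; linarith) (show dist x (V.p₂ j) < 2 * ρ by linarith)
      rw [hxp, dist_self] at hx
      exact (exp_pos _).ne hx
    have hKZ2 : K ⊆ (V.Z2)ᶜ := fun x hx h => hKZ hx (Or.inr h)
    have hunif := (tendstoLocallyUniformlyOn_iff_tendstoUniformlyOn_of_compact hKc).1 (hw.mono hKZ2)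
    obtain ⟨N, hN⟩ := eventually_atTop.1 (Metric.tendstoUniformlyOn_iff.1 hunif 1 one_pos)
    obtain ⟨M', hM'⟩ := (hKc.image_of_continuousOn ((u_contOn (hu N)).mono hKZ)).bddBelow
    have hA := lemmaA hτ (V.m₂_nonneg j) (LamT_pos V) (log ρ) cf hη C0 (2 + 2 * log (ε N) - M')
    filter_upwards [hE.eventually hA, eventually_ge_atTop N] with n h2 hn θ
    refine h2 _ (hsol n) ?_ θ
    have hb : ∀ θ, - log ((ε n) ^ 2)⁻¹ - (2 + 2 * log (ε N) - M') ≤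
        cyl (V.p₂ j) (u n) (log ρ - 2, θ) := by
      intro θ
      have hx : PP (V.p₂ j) (log ρ - 2, θ) ∈ K := by rw [hK, mem_sphere, PP_dist]
      have a1 := hN n hn _ hx
      have a2 := hN N le_rfl _ hx
      have a3 := hM' (mem_image_of_mem _ hx)
      rw [Real.dist_eq, abs_lt] at a1 a2
      rw [hlogE]
      simp only [cyl]
      linarith [a1.1, a1.2, a2.1, a2.2]
    have := le_cI (hsol n).sm.contOn (show log ρ - 2 < log ρ by linarith) hb
    rw [avg, le_div_iff₀ (by positivity)]
    linarith
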